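/- Fix integers n, m ≥ 1 and k₁, k₂ ≥ 0. Then there exist constants K > 0, δ₀ > 0 and κ₀ > 0 such that for all (x, t) ∈ ℝ^{2n} × ℝ^m with x ≠ 0, t ≠ 0, δ ≤ δ₀ and κ ≥ κ₀, one has |p_{1,k₁,k₂}(x,t) − P(x,t)| ≤ K |P(x,t)| (δ + 1/κ), where P(x,t) = ((−1)^{k₂} π^{k₁+k₂} / (4ⁿ (πδ)^{n+k₁−(m+1)/2} √(2π κ^m))) · e^{−d(x,t)²/4}. -/

import Mathlib

open Real Complex MeasureTheory
open scoped Classical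

/-- θ(y) = (2y − sin(2y))/(2 sin²(y)) for y ≠ 0, θ(0) = 0. -/
noncomputable def theta (y : ℝ) : ℝ :=
  if y = 0 then 0 else (2 * y - Real.sin (2 * y)) / (2 * Real.sin y ^ 2)

/-- The radial derivative p_{1,k₁,k₂} of the heat kernel at time 1 on an H-type group
with centre of dimension m, with R = |x|²/4 (integrand extended by continuity at λ = 0). -/
noncomputable def pT (n m k₁ k₂ : ℕ) (hm : 0 < m)
    (x : EuclideanSpace ℝ (Fin (2 * n))) (t : EuclideanSpace ℝ (Fin m)) : ℂ :=
  ((-1 : ℂ) ^ k₁ * Complex.I ^ k₂ / ((4 * (π : ℂ)) ^ n * (2 * (π : ℂ)) ^ m)) *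
    ∫ lam : EuclideanSpace ℝ (Fin m),
      if lam = 0 then (if k₂ = 0 then Complex.exp (-((‖x‖ ^ 2 / 4 : ℝ) : ℂ)) else 0)
      else
        Complex.exp (Complex.I * ((‖t‖ : ℝ) : ℂ) * ((lam ⟨0, hm⟩ : ℝ) : ℂ)
            - ((‖x‖ ^ 2 / 4 * ‖lam‖ * Real.cosh ‖lam‖ / Real.sinh ‖lam‖ : ℝ) : ℂ)) *
          (((‖lam‖ : ℝ) : ℂ) ^ (n + k₁) * ((Real.cosh ‖lam‖ : ℝ) : ℂ) ^ k₁
            / ((Real.sinh ‖lam‖ : ℝ) : ℂ) ^ (n + k₁)) *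
          ((lam ⟨0, hm⟩ : ℝ) : ℂ) ^ k₂

/-- The right side of a square centred at `0` may be replaced by the circular arc with the same
end points. -/
lemma integral_side_eq_arc {g : ℂ → ℂ} {h : ℝ} (hh : 0 < h)
    (hg : ∀ z ∈ Metric.ball (0 : ℂ) (4 * h), z ≠ 0 → DifferentiableAt ℂ g z) :
    ∫ y in (-h)..h, Complex.I * g (h + y * Complex.I) =
      ∫ θ in (-(π / 4))..(π / 4), (Complex.I * (√2 * h * Complex.exp (θ * Complex.I))) *
        g (√2 * h * Complex.exp (θ * Complex.I)) := by
  have hsub : ∀ z ∈ Metric.ball (2 * h : ℂ) (2 * h), z ∈ Metric.ball (0 : ℂ) (4 * h) ∧ z ≠ 0 := by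
    intro z hz
    rw [Metric.mem_ball, dist_eq_norm] at hz
    constructor
    · rw [Metric.mem_ball, dist_zero_right]
      calc ‖z‖ = ‖(z - 2 * h) + 2 * h‖ := by ring_nf
        _ ≤ ‖z - 2 * h‖ + ‖(2 * h : ℂ)‖ := norm_add_le _ _
        _ < 2 * h + 2 * h := by
          have : ‖(2 * h : ℂ)‖ = 2 * h := by
            rw [norm_mul, Complex.norm_real, Real.norm_of_nonneg hh.le]; simp
          linarith
        _ = 4 * h := by ring
    · rintro rfl
      have : ‖(0 - 2 * h : ℂ)‖ = 2 * h := by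
        rw [zero_sub, norm_neg, norm_mul, Complex.norm_real, Real.norm_of_nonneg hh.le]; simp
      linarith
  have hd : DifferentiableOn ℂ g (Metric.ball (2 * h : ℂ) (2 * h)) := fun z hz =>
    (hg z (hsub z hz).1 (hsub z hz).2).differentiableWithinAt
  obtain ⟨G, hG⟩ := hd.isExactOn_ball
  have hs2 : (√2 : ℝ) * √2 = 2 := Real.mul_self_sqrt (by norm_num)
  have hs0 : 0 < √2 := by positivity
  have hnsq : ∀ z : ℂ, Complex.normSq (z - 2 * h) < (2 * h) ^ 2 →
      z ∈ Metric.ball (2 * h : ℂ) (2 * h) := by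
    intro z hz
    rw [Metric.mem_ball, dist_eq_norm]
    rw [Complex.normSq_eq_norm_sq] at hz
    exact lt_of_pow_lt_pow_left₀ 2 (by positivity) hz
  have hside : ∀ y ∈ Set.Icc (-h) h, ((h : ℂ) + y * Complex.I) ∈ Metric.ball (2 * h : ℂ) (2 * h) := by
    intro y hy
    apply hnsq
    simp [Complex.normSq_apply]
    nlinarith [hy.1, hy.2]
  have harc : ∀ θ ∈ Set.Icc (-(π / 4)) (π / 4),
      ((√2 : ℂ) * h * Complex.exp (θ * Complex.I)) ∈ Metric.ball (2 * h : ℂ) (2 * h) := by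
    intro θ hθ
    apply hnsq
    have hc : √2 / 2 ≤ Real.cos θ := by
      rw [← Real.cos_pi_div_four, ← Real.cos_abs θ]
      apply Real.cos_le_cos_of_nonneg_of_le_pi (abs_nonneg _) (by linarith [Real.pi_pos])
      exact abs_le.2 ⟨by linarith [hθ.1], hθ.2⟩
    have hsc := Real.sin_sq_add_cos_sq θ
    rw [Complex.exp_mul_I]
    simp [Complex.normSq_apply, Complex.cos_ofReal_re, Complex.sin_ofReal_re]
    have h1 : (1 : ℝ) ≤ √2 * Real.cos θ := by nlinarith
    have h2 : (√2 * h * Real.cos θ - 2 * h) * (√2 * h * Real.cos θ - 2 * h) +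
        √2 * h * Real.sin θ * (√2 * h * Real.sin θ)
        = h ^ 2 * ((√2 * √2) * (Real.sin θ ^ 2 + Real.cos θ ^ 2) + 4 - 4 * (√2 * Real.cos θ)) := by ring
    rw [h2, hsc, hs2]
    have : 0 < h ^ 2 := by positivity
    nlinarith
  have e1 : ∫ y in (-h)..h, Complex.I * g (h + y * Complex.I)
      = G (h + h * Complex.I) - G (h + (-h : ℝ) * Complex.I) := by
    apply intervalIntegral.integral_eq_sub_of_hasDerivAt
      (f := fun y : ℝ => G ((h : ℂ) + y * Complex.I))
    · intro y hy
      rw [Set.uIcc_of_le (by linarith)] at hy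
      have h1 := hG _ (hside y hy)
      have h2 : HasDerivAt (fun y : ℝ => (h : ℂ) + y * Complex.I) Complex.I y := by
        simpa using ((hasDerivAt_id y).ofReal_comp.mul_const Complex.I).const_add (h : ℂ)
      exact (h1.scomp y h2).congr_deriv (by simp)
    · apply ContinuousOn.intervalIntegrable
      rw [Set.uIcc_of_le (by linarith)]
      exact continuousOn_const.mul (hd.continuousOn.comp (by fun_prop) hside)
  have e2 : ∫ θ in (-(π / 4))..(π / 4), (Complex.I * (√2 * h * Complex.exp (θ * Complex.I))) *
        g (√2 * h * Complex.exp (θ * Complex.I)) =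
      G (√2 * h * Complex.exp ((π / 4 : ℝ) * Complex.I)) -
        G (√2 * h * Complex.exp ((-(π / 4) : ℝ) * Complex.I)) := by
    have hpp := Real.pi_pos
    apply intervalIntegral.integral_eq_sub_of_hasDerivAt
      (f := fun θ : ℝ => G (√2 * h * Complex.exp (θ * Complex.I)))
    · intro θ hθ
      rw [Set.uIcc_of_le (by linarith)] at hθ
      have h1 := hG _ (harc θ hθ)
      have h2 : HasDerivAt (fun θ : ℝ => (√2 : ℂ) * h * Complex.exp (θ * Complex.I))
          (√2 * h * (Complex.exp (θ * Complex.I) * Complex.I)) θ := by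
        have : HasDerivAt (fun y : ℝ => (y : ℂ) * Complex.I) Complex.I θ := by
          simpa using ((hasDerivAt_id θ).ofReal_comp.mul_const Complex.I)
        exact (this.cexp).const_mul _
      exact (h1.scomp θ h2).congr_deriv (by simp only [smul_eq_mul]; ring)
    · apply ContinuousOn.intervalIntegrable
      rw [Set.uIcc_of_le (by linarith)]
      exact ContinuousOn.mul (by fun_prop) (hd.continuousOn.comp (by fun_prop) harc)
  rw [e1, e2]
  have hss : (√2 : ℂ) * √2 = 2 := by exact_mod_cast congrArg (fun x : ℝ => (x : ℂ)) hs2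
  have p1 : (√2 : ℂ) * h * Complex.exp ((π / 4 : ℝ) * Complex.I) = h + h * Complex.I := by
    rw [Complex.exp_mul_I, ← Complex.ofReal_cos, ← Complex.ofReal_sin, Real.cos_pi_div_four,
      Real.sin_pi_div_four]
    push_cast
    linear_combination (h / 2 + h / 2 * Complex.I) * hss
  have p2 : (√2 : ℂ) * h * Complex.exp ((-(π / 4) : ℝ) * Complex.I) = h + (-h : ℝ) * Complex.I := by
    rw [Complex.exp_mul_I, ← Complex.ofReal_cos, ← Complex.ofReal_sin, Real.cos_neg, Real.sin_neg,
      Real.cos_pi_div_four, Real.sin_pi_div_four]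
    push_cast
    linear_combination (h / 2 - h / 2 * Complex.I) * hss
  rw [p1, p2]

/-- The integral over the boundary of a square equals the integral over the circumscribed circle,
written with the parametrization `α ↦ -i r e^{iα}`. -/
lemma integral_square_eq_circle {g : ℂ → ℂ} {h : ℝ} (hh : 0 < h)
    (hg : ∀ z ∈ Metric.ball (0 : ℂ) (4 * h), z ≠ 0 → DifferentiableAt ℂ g z) :
    (∫ x in (-h)..h, g (x + (-h : ℝ) * Complex.I)) - (∫ x in (-h)..h, g (x + h * Complex.I)) +
      Complex.I * (∫ y in (-h)..h, g (h + y * Complex.I)) -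
      Complex.I * (∫ y in (-h)..h, g ((-h : ℝ) + y * Complex.I)) =
    ∫ α in (-π)..π, (√2 * h * Complex.exp (α * Complex.I)) *
        g (-Complex.I * (√2 * h * Complex.exp (α * Complex.I))) := by
  set K : ℝ → ℂ := fun θ => (Complex.I * (√2 * h * Complex.exp (θ * Complex.I))) *
        g (√2 * h * Complex.exp (θ * Complex.I)) with hK
  have hrot : ∀ e : ℂ, ‖e‖ = 1 → ∫ y in (-h)..h, Complex.I * (e * g (e * (h + y * Complex.I))) =
      ∫ θ in (-(π / 4))..(π / 4), (Complex.I * (√2 * h * Complex.exp (θ * Complex.I))) *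
        (e * g (e * (√2 * h * Complex.exp (θ * Complex.I)))) := by
    intro e he
    have he0 : e ≠ 0 := by rintro rfl; simp at he
    refine integral_side_eq_arc (g := fun z => e * g (e * z)) hh fun z hz hz0 => ?_
    refine DifferentiableAt.const_mul ?_ _
    refine DifferentiableAt.fun_comp' z (hg (e * z) ?_ (mul_ne_zero he0 hz0)) (by fun_prop)
    simpa [he] using hz
  have hrotθ : ∀ φ : ℝ, ∫ θ in (-(π / 4))..(π / 4),
      (Complex.I * (√2 * h * Complex.exp (θ * Complex.I))) *
        (Complex.exp (φ * Complex.I) * g (Complex.exp (φ * Complex.I) *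
          (√2 * h * Complex.exp (θ * Complex.I)))) = ∫ θ in (-(π / 4) + φ)..(π / 4 + φ), K θ := by
    intro φ
    rw [← intervalIntegral.integral_comp_add_right]
    congr 1; ext θ
    simp only [hK]
    push_cast
    rw [add_mul, Complex.exp_add]
    have : Complex.exp (φ * Complex.I) * (√2 * h * Complex.exp (θ * Complex.I)) =
      √2 * h * (Complex.exp (θ * Complex.I) * Complex.exp (φ * Complex.I)) := by ring
    rw [this]; ring
  have hKc : Continuous K := by
    have hgc : ContinuousOn g (Metric.ball (0 : ℂ) (4 * h) \ {0}) := fun z hz =>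
      (hg z hz.1 hz.2).continuousAt.continuousWithinAt
    refine Continuous.mul (by fun_prop) ?_
    refine hgc.comp_continuous (by fun_prop) fun θ => ⟨?_, ?_⟩
    · rw [Metric.mem_ball, dist_zero_right, norm_mul, Complex.norm_exp_ofReal_mul_I, norm_mul,
        Complex.norm_real, Complex.norm_real, Real.norm_of_nonneg hh.le,
        Real.norm_of_nonneg (by positivity)]
      have : √2 < 4 := by rw [Real.sqrt_lt' (by norm_num)]; norm_num
      nlinarith
    · simp [hh.ne', Complex.exp_ne_zero]
  have hKi : ∀ a b, IntervalIntegrable K volume a b := fun a b => hKc.intervalIntegrable a b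
  have hKp : Function.Periodic K (2 * π) := by
    intro θ
    simp only [hK]
    have : Complex.exp ((θ + 2 * π : ℝ) * Complex.I) = Complex.exp (θ * Complex.I) := by
      push_cast
      rw [add_mul, Complex.exp_add, Complex.exp_two_pi_mul_I, mul_one]
    rw [this]
  have s0 := (hrot _ (Complex.norm_exp_ofReal_mul_I 0)).trans (hrotθ 0)
  have s1 := (hrot _ (Complex.norm_exp_ofReal_mul_I (π / 2))).trans (hrotθ (π / 2))
  have s2 := (hrot _ (Complex.norm_exp_ofReal_mul_I π)).trans (hrotθ π)
  have s3 := (hrot _ (Complex.norm_exp_ofReal_mul_I (-(π / 2)))).trans (hrotθ (-(π / 2)))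
  have v0 : Complex.exp ((0 : ℝ) * Complex.I) = 1 := by simp
  have v1 : Complex.exp ((π / 2 : ℝ) * Complex.I) = Complex.I := by
    push_cast; exact Complex.exp_pi_div_two_mul_I
  have v2 : Complex.exp ((π : ℝ) * Complex.I) = -1 := Complex.exp_pi_mul_I
  have v3 : Complex.exp ((-(π / 2) : ℝ) * Complex.I) = -Complex.I := by
    push_cast; rw [neg_mul, Complex.exp_neg, Complex.exp_pi_div_two_mul_I, Complex.inv_I]
  rw [v0] at s0; rw [v1] at s1; rw [v2] at s2; rw [v3] at s3
  have t0 : ∫ y in (-h)..h, Complex.I * (1 * g (1 * (h + y * Complex.I))) =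
      Complex.I * ∫ y in (-h)..h, g (h + y * Complex.I) := by
    rw [← intervalIntegral.integral_const_mul]; simp
  have t1 : ∫ y in (-h)..h, Complex.I * (Complex.I * g (Complex.I * (h + y * Complex.I))) =
      - ∫ y in (-h)..h, g (y + h * Complex.I) := by
    rw [← intervalIntegral.integral_neg]
    have := intervalIntegral.integral_comp_neg (a := -h) (b := h)
      (fun x : ℝ => -g (x + h * Complex.I))
    rw [neg_neg] at this
    rw [← this]
    congr 1; ext y
    rw [← mul_assoc, Complex.I_mul_I, neg_one_mul]
    congr 2
    push_cast
    linear_combination (y : ℂ) * Complex.I_mul_I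
  have t2 : ∫ y in (-h)..h, Complex.I * (-1 * g (-1 * (h + y * Complex.I))) =
      - (Complex.I * ∫ y in (-h)..h, g ((-h : ℝ) + y * Complex.I)) := by
    rw [← intervalIntegral.integral_const_mul, ← intervalIntegral.integral_neg]
    have := intervalIntegral.integral_comp_neg (a := -h) (b := h)
      (fun x : ℝ => -(Complex.I * g ((-h : ℝ) + x * Complex.I)))
    rw [neg_neg] at this
    rw [← this]
    congr 1; ext y
    rw [neg_one_mul, mul_neg]
    congr 3
    push_cast
    ring
  have t3 : ∫ y in (-h)..h, Complex.I * (-Complex.I * g (-Complex.I * (h + y * Complex.I))) =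
      ∫ y in (-h)..h, g (y + (-h : ℝ) * Complex.I) := by
    congr 1; ext y
    have : -Complex.I * (h + y * Complex.I) = y + (-h : ℝ) * Complex.I := by
      push_cast
      linear_combination -(y : ℂ) * Complex.I_mul_I
    rw [this]
    linear_combination -g (y + (-h : ℝ) * Complex.I) * Complex.I_mul_I
  rw [t0] at s0; rw [t1] at s1; rw [t2] at s2; rw [t3] at s3
  have hsum : (∫ θ in (-(π / 4) + -(π / 2))..(π / 4 + -(π / 2)), K θ) +
      (∫ θ in (-(π / 4) + 0)..(π / 4 + 0), K θ) + (∫ θ in (-(π / 4) + π / 2)..(π / 4 + π / 2), K θ) +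
      (∫ θ in (-(π / 4) + π)..(π / 4 + π), K θ) =
      ∫ θ in (-(π / 4) + -(π / 2))..(-(π / 4) + -(π / 2)) + 2 * π, K θ := by
    have a1 : π / 4 + -(π / 2) = -(π / 4) + 0 := by ring
    have a2 : π / 4 + 0 = -(π / 4) + π / 2 := by ring
    have a3 : π / 4 + π / 2 = -(π / 4) + π := by ring
    have a4 : π / 4 + π = (-(π / 4) + -(π / 2)) + 2 * π := by ring
    rw [a1, a2, a3, a4, intervalIntegral.integral_add_adjacent_intervals (hKi _ _) (hKi _ _),
      intervalIntegral.integral_add_adjacent_intervals (hKi _ _) (hKi _ _),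
      intervalIntegral.integral_add_adjacent_intervals (hKi _ _) (hKi _ _)]
  have hfin : ∫ θ in (-π - π / 2)..(-π - π / 2) + 2 * π, K θ =
      ∫ α in (-π)..π, (√2 * h * Complex.exp (α * Complex.I)) *
        g (-Complex.I * (√2 * h * Complex.exp (α * Complex.I))) := by
    have := intervalIntegral.integral_comp_sub_right (a := -π) (b := π) K (π / 2)
    have hb : (-π - π / 2) + 2 * π = π - π / 2 := by ring
    rw [hb, ← this]
    congr 1; ext α
    simp only [hK]
    have : Complex.exp ((α - π / 2 : ℝ) * Complex.I) = -Complex.I * Complex.exp (α * Complex.I) := by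
      rw [← v3, ← Complex.exp_add]; congr 1; push_cast; ring
    rw [this]
    have e2 : (√2 : ℂ) * h * (-Complex.I * Complex.exp (α * Complex.I)) =
      -Complex.I * (√2 * h * Complex.exp (α * Complex.I)) := by ring
    rw [e2]
    linear_combination -((√2 * h * Complex.exp (α * Complex.I)) *
      g (-Complex.I * (√2 * h * Complex.exp (α * Complex.I)))) * Complex.I_mul_I
  rw [← hfin, ← hKp.intervalIntegral_add_eq (-(π / 4) + -(π / 2)) (-π - π / 2), ← hsum, ← s0, ← s1,
    ← s2, ← s3]
  ring

/-- Cauchy's theorem on a rectangle with a square hole centred at `p * I`. -/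
lemma integral_rect_sub_square {g : ℂ → ℂ} {p H h T : ℝ} (hh : 0 < h) (hp : 4 * h ≤ p)
    (hH : p + 4 * h ≤ H) (hT : h < T)
    (hg : ∀ z : ℂ, 0 ≤ z.im → z.im ≤ H → z ≠ p * Complex.I → DifferentiableAt ℂ g z) :
    (∫ x in (-T)..T, g x) - (∫ x in (-T)..T, g (x + H * Complex.I)) +
      Complex.I * (∫ y in (0)..H, g (T + y * Complex.I)) -
      Complex.I * (∫ y in (0)..H, g ((-T : ℝ) + y * Complex.I)) =
    ∫ α in (-π)..π, (√2 * h * Complex.exp (α * Complex.I)) *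
        g (p * Complex.I + -Complex.I * (√2 * h * Complex.exp (α * Complex.I))) := by
  rw [← integral_square_eq_circle (g := fun z => g (p * Complex.I + z)) hh]
  swap
  · intro z hz hz0
    rw [Metric.mem_ball, dist_zero_right] at hz
    have him := abs_le.1 ((Complex.abs_im_le_norm z).trans hz.le)
    refine DifferentiableAt.fun_comp' z (hg _ ?_ ?_ ?_) (by fun_prop)
    · simp; linarith
    · simp; linarith
    · simpa using hz0
  have hgI : ∀ a b y : ℝ, 0 ≤ y → y ≤ H → (∀ x ∈ Set.uIcc a b, x ≠ 0 ∨ y ≠ p) →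
      IntervalIntegrable (fun x : ℝ => g (x + y * Complex.I)) volume a b := by
    intro a b y hy0 hyH hne
    apply ContinuousOn.intervalIntegrable
    intro x hx
    refine ContinuousAt.continuousWithinAt ?_
    refine ContinuousAt.comp' (g := g) (DifferentiableAt.continuousAt (𝕜 := ℂ)
      (hg _ (by simpa using hy0) (by simpa using hyH) ?_)) (by fun_prop)
    intro h1
    have hre := congrArg Complex.re h1
    have him := congrArg Complex.im h1
    simp at hre him
    rcases hne x hx with h | h
    · exact h hre
    · exact h him
  have hgV : ∀ a b x : ℝ, 0 ≤ a → a ≤ b → b ≤ H → x ≠ 0 →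
      IntervalIntegrable (fun y : ℝ => g (x + y * Complex.I)) volume a b := by
    intro a b x ha hab hb hne
    apply ContinuousOn.intervalIntegrable
    intro y hy
    rw [Set.uIcc_of_le hab] at hy
    refine ContinuousAt.continuousWithinAt ?_
    refine ContinuousAt.comp' (g := g) (DifferentiableAt.continuousAt (𝕜 := ℂ)
      (hg _ (by simpa using ha.trans hy.1) (by simpa using hy.2.trans hb) ?_)) (by fun_prop)
    intro h1
    have hre := congrArg Complex.re h1
    simp at hre
    exact hne hre
  have hrect : ∀ a b c d : ℝ, a ≤ b → c ≤ d → 0 ≤ c → d ≤ H →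
      (∀ x ∈ Set.Icc a b, ∀ y ∈ Set.Icc c d, x ≠ 0 ∨ y ≠ p) →
      (∫ x in a..b, g (x + c * Complex.I)) - (∫ x in a..b, g (x + d * Complex.I)) +
      Complex.I * (∫ y in c..d, g (b + y * Complex.I)) -
      Complex.I * (∫ y in c..d, g (a + y * Complex.I)) = 0 := by
    intro a b c d hab hcd hc hd hne
    have := Complex.integral_boundary_rect_eq_zero_of_differentiableOn g (a + c * Complex.I)
      (b + d * Complex.I) ?_
    · simpa using this
    · intro z hz
      simp [Complex.mem_reProdIm, Set.uIcc_of_le hab, Set.uIcc_of_le hcd] at hz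
      refine (hg z (hc.trans hz.2.1) (hz.2.2.trans hd) ?_).differentiableWithinAt
      rintro rfl
      simp at hz
      rcases hne 0 hz.1 p hz.2 with h | h <;> exact h rfl
  have r1 := hrect (-T) (-h) 0 H (by linarith) (by linarith) le_rfl le_rfl
    (fun x hx y _ => Or.inl (by linarith [hx.2] : x < 0).ne)
  have r2 := hrect h T 0 H (by linarith) (by linarith) le_rfl le_rfl
    (fun x hx y _ => Or.inl (by linarith [hx.1] : 0 < x).ne')
  have r3 := hrect (-h) h 0 (p - h) (by linarith) (by linarith) le_rfl (by linarith)
    (fun x _ y hy => Or.inr (by linarith [hy.2] : y < p).ne)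
  have r4 := hrect (-h) h (p + h) H (by linarith) (by linarith) (by linarith) le_rfl
    (fun x _ y hy => Or.inr (by linarith [hy.1] : p < y).ne')
  have hsplit : ∀ y : ℝ, 0 ≤ y → y ≤ H → y ≠ p → ∫ x in (-T)..T, g (x + y * Complex.I) =
      (∫ x in (-T)..(-h), g (x + y * Complex.I)) + (∫ x in (-h)..h, g (x + y * Complex.I)) +
      (∫ x in h..T, g (x + y * Complex.I)) := by
    intro y h0 h1 h2
    rw [intervalIntegral.integral_add_adjacent_intervals, intervalIntegral.integral_add_adjacent_intervals]
    all_goals exact hgI _ _ _ h0 h1 fun _ _ => Or.inr h2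
  have hsplitV : ∀ x : ℝ, x ≠ 0 → ∫ y in (0)..H, g (x + y * Complex.I) =
      (∫ y in (0)..(p - h), g (x + y * Complex.I)) +
      (∫ y in (p - h)..(p + h), g (x + y * Complex.I)) +
      (∫ y in (p + h)..H, g (x + y * Complex.I)) := by
    intro x hx
    rw [intervalIntegral.integral_add_adjacent_intervals, intervalIntegral.integral_add_adjacent_intervals]
    all_goals exact hgV _ _ _ (by linarith) (by linarith) (by linarith) hx
  have b0 := hsplit 0 le_rfl (by linarith) (by linarith)
  have bH := hsplit H (by linarith) le_rfl (by linarith)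
  have v1 := hsplitV h hh.ne'
  have v2 := hsplitV (-h) (by linarith)
  have c1 : ∫ x in (-h)..h, g (p * Complex.I + (x + (-h : ℝ) * Complex.I)) =
      ∫ x in (-h)..h, g (x + (p - h : ℝ) * Complex.I) := by
    congr 1; ext x; congr 1; push_cast; ring
  have c2 : ∫ x in (-h)..h, g (p * Complex.I + (x + h * Complex.I)) =
      ∫ x in (-h)..h, g (x + (p + h : ℝ) * Complex.I) := by
    congr 1; ext x; congr 1; push_cast; ring
  have c3 : ∀ w : ℝ, ∫ y in (-h)..h, g (p * Complex.I + (w + y * Complex.I)) =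
      ∫ y in (p - h)..(p + h), g (w + y * Complex.I) := by
    intro w
    have := intervalIntegral.integral_comp_add_left (a := -h) (b := h)
      (fun y : ℝ => g (w + y * Complex.I)) p
    rw [sub_eq_add_neg, ← this]
    congr 1; ext x; congr 1; push_cast; ring
  rw [c1, c2, c3, c3]
  have z0 : ∀ a b : ℝ, ∫ x in a..b, g (x + (0 : ℝ) * Complex.I) = ∫ x in a..b, g x := by
    intro a b; simp
  rw [v1] at r2
  rw [v2] at r1
  rw [← z0, b0, bH]
  linear_combination r1 + r2 + r3 + r4

/-- Shifting the line of integration upwards past an isolated singularity at `p * I`. -/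
lemma integral_eq_integral_add_circle {g : ℂ → ℂ} {p H h : ℝ} (hh : 0 < h) (hp : 4 * h ≤ p)
    (hH : p + 4 * h ≤ H)
    (hg : ∀ z : ℂ, 0 ≤ z.im → z.im ≤ H → z ≠ p * Complex.I → DifferentiableAt ℂ g z)
    (hi0 : Integrable (fun x : ℝ => g x)) (hi1 : Integrable (fun x : ℝ => g (x + H * Complex.I)))
    {B : ℝ → ℝ} {T₀ : ℝ} (hB : Filter.Tendsto B Filter.atTop (nhds 0))
    (hgB : ∀ x y : ℝ, T₀ ≤ |x| → 0 ≤ y → y ≤ H → ‖g (x + y * Complex.I)‖ ≤ B |x|) :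
    ∫ x : ℝ, g x = (∫ x : ℝ, g (x + H * Complex.I)) +
      ∫ α in (-π)..π, (√2 * h * Complex.exp (α * Complex.I)) *
        g (p * Complex.I + -Complex.I * (√2 * h * Complex.exp (α * Complex.I))) := by
  have hH0 : 0 ≤ H := by linarith
  have l0 := intervalIntegral_tendsto_integral hi0 Filter.tendsto_neg_atTop_atBot Filter.tendsto_id
  have l1 := intervalIntegral_tendsto_integral hi1 Filter.tendsto_neg_atTop_atBot Filter.tendsto_id
  have hV : ∀ s : ℝ, |s| = 1 → Filter.Tendsto
      (fun T : ℝ => Complex.I * ∫ y in (0)..H, g ((s * T : ℝ) + y * Complex.I))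
      Filter.atTop (nhds 0) := by
    intro s hs
    rw [tendsto_zero_iff_norm_tendsto_zero]
    have hBH : Filter.Tendsto (fun T => B T * H) Filter.atTop (nhds 0) := by
      simpa using hB.mul_const H
    refine tendsto_of_tendsto_of_tendsto_of_le_of_le' tendsto_const_nhds hBH
      (Filter.Eventually.of_forall fun _ => norm_nonneg _) ?_
    filter_upwards [Filter.eventually_ge_atTop (max T₀ 0)] with T hT
    have hT0 : 0 ≤ T := (le_max_right _ _).trans hT
    have hab : |s * T| = T := by rw [abs_mul, hs, one_mul, abs_of_nonneg hT0]
    rw [norm_mul, Complex.norm_I, one_mul]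
    have := intervalIntegral.norm_integral_le_of_norm_le_const (a := 0) (b := H) (C := B T)
      (f := fun y : ℝ => g ((s * T : ℝ) + y * Complex.I)) ?_
    · simpa [abs_of_nonneg hH0] using this
    · intro y hy
      rw [Set.uIoc_of_le hH0] at hy
      have := hgB (s * T) y (by rw [hab]; exact (le_max_left _ _).trans hT) hy.1.le hy.2
      rwa [hab] at this
  have v1 := hV 1 (by simp)
  have v2 := hV (-1) (by simp)
  have htot := ((l0.sub l1).add v1).sub v2
  rw [add_zero, sub_zero] at htot
  have hconst := htot.congr' (f₂ := fun _ => ∫ α in (-π)..π,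
    (√2 * h * Complex.exp (α * Complex.I)) *
        g (p * Complex.I + -Complex.I * (√2 * h * Complex.exp (α * Complex.I)))) ?_
  · have := tendsto_nhds_unique hconst tendsto_const_nhds
    linear_combination this
  · filter_upwards [Filter.eventually_gt_atTop h] with T hT
    rw [← integral_rect_sub_square hh hp hH hT hg]
    simp

lemma integrable_exp_neg_mul_abs {b : ℝ} (hb : 0 < b) :
    Integrable (fun u : ℝ => Real.exp (-(b * |u|))) := by
  rw [← integrableOn_univ, ← Set.Iic_union_Ioi (a := (0 : ℝ)), integrableOn_union]
  constructor
  · refine (integrableOn_exp_mul_Iic hb 0).congr_fun (fun u hu => ?_) measurableSet_Iic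
    rw [abs_of_nonpos hu]; simp
  · refine (integrableOn_exp_mul_Ioi (neg_lt_zero.2 hb) 0).congr_fun (fun u hu => ?_)
      measurableSet_Ioi
    rw [abs_of_pos hu]; simp

lemma integral_cexp_neg_abs_mul {z : ℂ} (hz : 0 < z.re) (r : ℝ) :
    ∫ u : ℝ, Complex.exp (-(|u| * z)) * Complex.exp (Complex.I * u * r) =
      2 * z / (z ^ 2 + r ^ 2) := by
  have e1 : ∀ u ∈ Set.Iic (0 : ℝ), Complex.exp (-(|u| * z)) * Complex.exp (Complex.I * u * r) =
      Complex.exp ((z + r * Complex.I) * u) := by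
    intro u hu
    rw [abs_of_nonpos hu, ← Complex.exp_add]; congr 1; push_cast; ring
  have e2 : ∀ u ∈ Set.Ioi (0 : ℝ), Complex.exp (-(|u| * z)) * Complex.exp (Complex.I * u * r) =
      Complex.exp ((-z + r * Complex.I) * u) := by
    intro u hu
    rw [abs_of_pos hu, ← Complex.exp_add]; congr 1; ring
  have h1 : 0 < (z + r * Complex.I).re := by simpa using hz
  have h2 : (-z + r * Complex.I).re < 0 := by simpa using hz
  have i1 := (integrableOn_exp_mul_complex_Iic h1 0).congr_fun (fun u hu => (e1 u hu).symm)
    measurableSet_Iic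
  have i2 := (integrableOn_exp_mul_complex_Ioi h2 0).congr_fun (fun u hu => (e2 u hu).symm)
    measurableSet_Ioi
  rw [← setIntegral_univ, ← Set.Iic_union_Ioi (a := (0 : ℝ)),
    setIntegral_union (Set.Iic_disjoint_Ioi le_rfl) measurableSet_Ioi i1 i2,
    setIntegral_congr_fun measurableSet_Iic e1, setIntegral_congr_fun measurableSet_Ioi e2,
    integral_exp_mul_complex_Iic h1, integral_exp_mul_complex_Ioi h2]
  have n1 : z + r * Complex.I ≠ 0 := fun h => by rw [h] at h1; simp at h1
  have n2 : -z + r * Complex.I ≠ 0 := fun h => by rw [h] at h2; simp at h2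
  have n3 : z ^ 2 + (r : ℂ) ^ 2 = -((z + r * Complex.I) * (-z + r * Complex.I)) := by
    linear_combination (r : ℂ) ^ 2 * Complex.I_sq
  rw [n3]
  simp
  field_simp
  ring

/-- Fourier inversion with the normalization `ĝ(u) = ∫ g(x) e^{iux} dx`. -/
lemma fourier_inversion_exp {g : ℝ → ℂ} (hc : Continuous g) (hi : Integrable g)
    (hi' : Integrable fun u : ℝ => ∫ x : ℝ, g x * Complex.exp (Complex.I * x * u)) (x : ℝ) :
    ∫ u : ℝ, (∫ y : ℝ, g y * Complex.exp (Complex.I * y * u)) * Complex.exp (Complex.I * u * (-x : ℝ))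
      = 2 * π * g x := by
  set G : ℝ → ℂ := fun u => ∫ y : ℝ, g y * Complex.exp (Complex.I * y * u) with hG
  have hF : FourierTransform.fourier g = fun w => G (-(2 * π) * w) := by
    ext w
    rw [Real.fourier_real_eq_integral_exp_smul]
    simp only [hG]
    congr 1; ext y
    rw [smul_eq_mul, mul_comm]
    congr 2
    push_cast; ring
  have hpi : -(2 * π) ≠ 0 := by simp [Real.pi_ne_zero]
  have hFi : Integrable (FourierTransform.fourier g) := by
    rw [hF]; exact (integrable_comp_mul_left_iff G hpi).2 hi'
  have := congrFun (hc.fourierInv_fourier_eq hi hFi) x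
  rw [← this, Real.fourierInv_eq', hF]
  have h2 := Measure.integral_comp_mul_left
    (fun u => G u * Complex.exp (Complex.I * u * (-x : ℝ))) (-(2 * π))
  have h3 : ∫ v : ℝ, Complex.exp (((2 * π * inner ℝ v x : ℝ) : ℂ) * Complex.I) • G (-(2 * π) * v) =
      ∫ v : ℝ, G (-(2 * π) * v) * Complex.exp (Complex.I * (-(2 * π) * v : ℝ) * (-x : ℝ)) := by
    congr 1; ext v
    rw [smul_eq_mul, mul_comm]
    congr 2
    simp
    ring
  rw [h3, h2]
  rw [abs_inv, abs_neg, abs_of_pos Real.two_pi_pos, Complex.real_smul, ← mul_assoc]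
  push_cast
  rw [mul_inv_cancel₀, one_mul]
  simp [Real.pi_ne_zero]

section Laplace

variable {X : Type*} [MeasurableSpace X] {m : Measure X} {a z : X → ℂ} {c : ℝ}

lemma norm_cexp_neg_abs_mul_le {z : ℂ} (hz : c ≤ z.re) (u : ℝ) :
    ‖Complex.exp (-(|u| * z))‖ ≤ Real.exp (-(c * |u|)) := by
  rw [Complex.norm_exp]
  apply Real.exp_le_exp.2
  simp
  nlinarith [abs_nonneg u]

lemma continuous_laplace (ha : Integrable a m) (hz : AEStronglyMeasurable z m) (hc : 0 < c)
    (hzc : ∀ x, c ≤ (z x).re) :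
    Continuous fun u : ℝ => ∫ x, a x * Complex.exp (-(|u| * z x)) ∂m := by
  refine continuous_of_dominated (bound := fun x => ‖a x‖) (fun u => ?_) (fun u => ?_) ha.norm ?_
  · exact ha.1.mul (Complex.continuous_exp.comp_aestronglyMeasurable (hz.const_mul _).neg)
  · refine Filter.Eventually.of_forall fun x => ?_
    rw [norm_mul]
    refine mul_le_of_le_one_right (norm_nonneg _) ((norm_cexp_neg_abs_mul_le (hzc x) u).trans ?_)
    exact Real.exp_le_one_iff.2 (neg_nonpos.2 (by positivity))
  · exact Filter.Eventually.of_forall fun x => by fun_prop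

lemma integrable_laplace_prod (ha : Integrable a m) (hz : AEStronglyMeasurable z m) (hc : 0 < c)
    (hzc : ∀ x, c ≤ (z x).re) (r : ℝ) :
    Integrable (fun p : ℝ × X => a p.2 * Complex.exp (-(|p.1| * z p.2)) *
      Complex.exp (Complex.I * p.1 * r)) (volume.prod m) := by
  have h0 := (integrable_exp_neg_mul_abs hc).mul_prod ha.norm
  refine h0.mono' ?_ (Filter.Eventually.of_forall fun p => ?_)
  · refine (ha.1.comp_snd.mul (Complex.continuous_exp.comp_aestronglyMeasurable
      (AEStronglyMeasurable.neg ?_))).mul ?_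
    · exact AEStronglyMeasurable.mul (by fun_prop) hz.comp_snd
    · fun_prop
  · have : ‖Complex.exp (Complex.I * p.1 * r)‖ = 1 := by
      rw [mul_assoc, ← Complex.ofReal_mul, Complex.norm_exp_I_mul_ofReal]
    rw [norm_mul, this, mul_one, norm_mul, mul_comm]
    exact mul_le_mul_of_nonneg_right (norm_cexp_neg_abs_mul_le (hzc p.2) _) (norm_nonneg _)

lemma integrable_laplace [SFinite m] (ha : Integrable a m) (hz : AEStronglyMeasurable z m) (hc : 0 < c)
    (hzc : ∀ x, c ≤ (z x).re) :
    Integrable fun u : ℝ => ∫ x, a x * Complex.exp (-(|u| * z x)) ∂m := by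
  have := (integrable_laplace_prod ha hz hc hzc 0).integral_prod_left
  simpa using this

lemma fourier_laplace [SFinite m] (ha : Integrable a m) (hz : AEStronglyMeasurable z m) (hc : 0 < c)
    (hzc : ∀ x, c ≤ (z x).re) (r : ℝ) :
    ∫ u : ℝ, (∫ x, a x * Complex.exp (-(|u| * z x)) ∂m) * Complex.exp (Complex.I * u * r) =
      ∫ x, a x * (2 * z x / (z x ^ 2 + r ^ 2)) ∂m := by
  simp_rw [← integral_mul_const]
  rw [integral_integral_swap (integrable_laplace_prod ha hz hc hzc r)]
  congr 1; ext x
  rw [← integral_cexp_neg_abs_mul (hc.trans_le (hzc x)), ← integral_const_mul]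
  simp_rw [mul_assoc]

/-- If the Fourier transform of an even function is a superposition of exponentials, the function
is the corresponding superposition of resolvents. -/
lemma eq_integral_resolvent [SFinite m] {f : ℝ → ℂ} (hf : Continuous f) (hfi : Integrable f)
    (hfe : ∀ r, f (-r) = f r) (ha : Integrable a m) (hz : AEStronglyMeasurable z m) (hc : 0 < c)
    (hzc : ∀ x, c ≤ (z x).re)
    (hfa : ∀ u : ℝ, 0 ≤ u → ∫ r : ℝ, f r * Complex.exp (Complex.I * r * u) =
      ∫ x, a x * Complex.exp (-(u * z x)) ∂m) (r : ℝ) :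
    π * f r = ∫ x, a x * (z x / (z x ^ 2 + r ^ 2)) ∂m := by
  have hall : (fun u : ℝ => ∫ r : ℝ, f r * Complex.exp (Complex.I * r * u)) =
      fun u : ℝ => ∫ x, a x * Complex.exp (-(|u| * z x)) ∂m := by
    ext u
    rw [← hfa _ (abs_nonneg u)]
    rcases le_total 0 u with hu | hu
    · rw [abs_of_nonneg hu]
    · rw [abs_of_nonpos hu, ← integral_neg_eq_self]
      congr 1; ext r
      rw [hfe]; congr 2; push_cast; ring
  have h1 := fourier_inversion_exp hf hfi (by rw [hall]; exact integrable_laplace ha hz hc hzc) r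
  simp only [funext_iff] at hall
  simp_rw [hall] at h1
  rw [fourier_laplace ha hz hc hzc] at h1
  have h2 : ∫ x, a x * (2 * z x / (z x ^ 2 + ((-r : ℝ) : ℂ) ^ 2)) ∂m =
      2 * ∫ x, a x * (z x / (z x ^ 2 + r ^ 2)) ∂m := by
    rw [← integral_const_mul]; congr 1; ext x
    push_cast; ring
  rw [h2] at h1
  linear_combination -h1 / 2

/-- Converse of `eq_integral_resolvent`. -/
lemma fourier_eq_of_eq_integral_resolvent [SFinite m] {h : ℝ → ℂ} (hhi : Integrable h) (ha : Integrable a m)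
    (hz : AEStronglyMeasurable z m) (hc : 0 < c) (hzc : ∀ x, c ≤ (z x).re)
    (hh : ∀ r : ℝ, π * h r = ∫ x, a x * (z x / (z x ^ 2 + r ^ 2)) ∂m) {u : ℝ} (hu : 0 ≤ u) :
    ∫ r : ℝ, h r * Complex.exp (Complex.I * r * u) = ∫ x, a x * Complex.exp (-(u * z x)) ∂m := by
  have hall : (fun r : ℝ => ∫ u : ℝ, (∫ x, a x * Complex.exp (-(|u| * z x)) ∂m) *
      Complex.exp (Complex.I * u * r)) = fun r => 2 * π * h r := by
    ext r
    rw [fourier_laplace ha hz hc hzc, mul_assoc, hh, ← integral_const_mul]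
    congr 1; ext x; ring
  have h1 := fourier_inversion_exp (continuous_laplace ha hz hc hzc)
    (integrable_laplace ha hz hc hzc) (by rw [hall]; exact hhi.const_mul _) (-u)
  simp only [funext_iff] at hall
  simp_rw [hall] at h1
  rw [abs_neg, abs_of_nonneg hu, neg_neg] at h1
  have hpi : (2 * π : ℂ) ≠ 0 := by simp [Real.pi_ne_zero]
  apply mul_left_cancel₀ hpi
  rw [← h1, ← integral_const_mul]
  simp_rw [mul_assoc]

end Laplace

/-- The square root `√(z² + ρ²)` occurring in the reduction to one dimension. -/
noncomputable def nuRoot (z : ℂ) (ρ : ℝ) : ℂ := Complex.sqrt (z ^ 2 + (ρ : ℂ) ^ 2)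

lemma nuRoot_sq (z : ℂ) (ρ : ℝ) : nuRoot z ρ ^ 2 = z ^ 2 + (ρ : ℂ) ^ 2 := by
  unfold nuRoot Complex.sqrt
  exact Complex.cpow_ofNat_inv_pow _ 2

lemma nuRoot_re_nonneg (z : ℂ) (ρ : ℝ) : 0 ≤ (nuRoot z ρ).re := by
  unfold nuRoot Complex.sqrt
  rw [Complex.cpow_inv_two_re]
  positivity

lemma nuRoot_re_im (z : ℂ) (ρ : ℝ) :
    (nuRoot z ρ).re ^ 2 - (nuRoot z ρ).im ^ 2 = z.re ^ 2 - z.im ^ 2 + ρ ^ 2 ∧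
      (nuRoot z ρ).re * (nuRoot z ρ).im = z.re * z.im := by
  have h := nuRoot_sq z ρ
  have h1 := congrArg Complex.re h
  have h2 := congrArg Complex.im h
  simp [pow_two] at h1 h2
  constructor <;> linarith

lemma re_le_nuRoot_re {z : ℂ} (hz : 0 < z.re) (ρ : ℝ) : z.re ≤ (nuRoot z ρ).re := by
  obtain ⟨h1, h2⟩ := nuRoot_re_im z ρ
  have h0 := nuRoot_re_nonneg z ρ
  set p := (nuRoot z ρ).re
  set q := (nuRoot z ρ).im
  by_contra! hlt
  have hq : z.im ^ 2 ≤ q ^ 2 := by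
    by_contra! h
    have : (p * q) ^ 2 = z.re ^ 2 * z.im ^ 2 := by rw [h2]; ring
    have h3 : p ^ 2 ≤ z.re ^ 2 := by nlinarith
    have : p ^ 2 * q ^ 2 < z.re ^ 2 * z.im ^ 2 := by
      calc p ^ 2 * q ^ 2 ≤ z.re ^ 2 * q ^ 2 := by gcongr
        _ < z.re ^ 2 * z.im ^ 2 := by gcongr
    nlinarith
  nlinarith [sq_nonneg ρ]

lemma sub_le_nuRoot_re (z : ℂ) (ρ : ℝ) : ρ - |z.im| ≤ (nuRoot z ρ).re := by
  obtain ⟨h1, -⟩ := nuRoot_re_im z ρ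
  have h0 := nuRoot_re_nonneg z ρ
  by_contra! hlt
  have h2 : (nuRoot z ρ).re ^ 2 < (ρ - |z.im|) ^ 2 := by gcongr
  nlinarith [sq_abs z.im, abs_nonneg z.im, sq_nonneg (nuRoot z ρ).im]

lemma norm_nuRoot_le (z : ℂ) {ρ : ℝ} (hρ : 0 ≤ ρ) : ‖nuRoot z ρ‖ ≤ ‖z‖ + ρ := by
  have h : ‖nuRoot z ρ‖ ^ 2 ≤ (‖z‖ + ρ) ^ 2 := by
    rw [← norm_pow, nuRoot_sq]
    refine (norm_add_le _ _).trans ?_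
    rw [norm_pow, norm_pow, Complex.norm_real, Real.norm_of_nonneg hρ]
    nlinarith [norm_nonneg z]
  exact le_of_sq_le_sq h (by positivity)

lemma Measurable.nuRoot {X : Type*} [MeasurableSpace X] {z : X → ℂ} {ρ : X → ℝ} (hz : Measurable z)
    (hρ : Measurable ρ) : Measurable fun x => nuRoot (z x) (ρ x) := by
  unfold _root_.nuRoot Complex.sqrt
  exact ((hz.pow_const 2).add ((Complex.measurable_ofReal.comp hρ).pow_const 2)).pow_const _

lemma pow_le_mul_exp (k : ℕ) {β : ℝ} (hβ : 0 < β) :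
    ∃ C : ℝ, 0 < C ∧ ∀ x : ℝ, 0 ≤ x → (1 + x) ^ k ≤ C * Real.exp (β * x) := by
  refine ⟨k.factorial / β ^ k * Real.exp β, by positivity, fun x hx => ?_⟩
  have h := Real.pow_div_factorial_le_exp (x := β * (1 + x)) (by positivity) k
  rw [div_le_iff₀ (by positivity), mul_pow] at h
  have : k.factorial / β ^ k * Real.exp β * Real.exp (β * x) =
      Real.exp (β * (1 + x)) * k.factorial / β ^ k := by
    rw [mul_add, mul_one, Real.exp_add]; ring
  rw [this, le_div_iff₀ (by positivity)]
  linarith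

lemma integrable_pow_mul_exp_neg_norm {E : Type*} [NormedAddCommGroup E] [InnerProductSpace ℝ E]
    [FiniteDimensional ℝ E] [MeasurableSpace E] [BorelSpace E] (k : ℕ) {β : ℝ} (hβ : 0 < β) :
    Integrable fun v : E => (1 + ‖v‖) ^ k * Real.exp (-(β * ‖v‖)) := by
  set r := Module.finrank ℝ E + 1 with hr
  obtain ⟨C, hC, h⟩ := pow_le_mul_exp (k + r) hβ
  have hi := (integrable_one_add_norm (E := E) (μ := volume) (r := (r : ℝ)) (by simp [hr])).const_mul C
  refine hi.mono' (by fun_prop) (Filter.Eventually.of_forall fun v => ?_)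
  rw [Real.norm_of_nonneg (by positivity), Real.rpow_neg (by positivity), Real.rpow_natCast,
    Real.exp_neg, ← div_eq_mul_inv, ← div_eq_mul_inv, div_le_div_iff₀ (by positivity) (by positivity),
    ← pow_add]
  exact h _ (norm_nonneg v)

lemma norm_kernel_le (k : ℕ) {β c : ℝ} (hβ : 0 < β) (hc : 0 < c) :
    ∃ C : ℝ, 0 < C ∧ ∀ (z : ℂ) (ρ s : ℝ), c ≤ z.re → 0 ≤ ρ → β ≤ s →
      ‖z / nuRoot z ρ * (Complex.I * nuRoot z ρ) ^ k * Complex.exp (-(s * nuRoot z ρ))‖ ≤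
        C * Real.exp (-((s - β) * c)) * Real.exp (2 * β * ‖z‖) *
          ((1 + ρ) ^ k * Real.exp (-(β * ρ))) := by
  obtain ⟨C, hC, h⟩ := pow_le_mul_exp (k + 1) hβ
  refine ⟨C / c, by positivity, fun z ρ s hz hρ hs => ?_⟩
  have hz0 : 0 < z.re := hc.trans_le hz
  have h1 := re_le_nuRoot_re hz0 ρ
  have h2 := sub_le_nuRoot_re z ρ
  have h3 := norm_nuRoot_le z hρ
  set ν := nuRoot z ρ
  have hνc : c ≤ ‖ν‖ := hz.trans (h1.trans (Complex.re_le_norm ν))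
  have him : |z.im| ≤ ‖z‖ := Complex.abs_im_le_norm z
  rw [norm_mul, norm_mul, norm_div, norm_pow, norm_mul, Complex.norm_I, one_mul, Complex.norm_exp]
  have e1 : ‖z‖ / ‖ν‖ ≤ (1 + ‖z‖) / c := by
    gcongr
    linarith
  have e2 : ‖ν‖ ^ k ≤ (1 + ‖z‖) ^ k * (1 + ρ) ^ k := by
    rw [← mul_pow]
    gcongr
    nlinarith [mul_nonneg (norm_nonneg z) hρ]
  have e3 : Real.exp (-(s * ν)).re ≤
      Real.exp (-((s - β) * c)) * (Real.exp (β * ‖z‖) * Real.exp (-(β * ρ))) := by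
    rw [← Real.exp_add, ← Real.exp_add]
    apply Real.exp_le_exp.2
    simp
    nlinarith
  calc ‖z‖ / ‖ν‖ * ‖ν‖ ^ k * Real.exp (-(s * ν)).re
      ≤ ((1 + ‖z‖) / c) * ((1 + ‖z‖) ^ k * (1 + ρ) ^ k) *
        (Real.exp (-((s - β) * c)) * (Real.exp (β * ‖z‖) * Real.exp (-(β * ρ)))) := by gcongr
    _ = (1 + ‖z‖) ^ (k + 1) / c * (1 + ρ) ^ k *
        (Real.exp (-((s - β) * c)) * (Real.exp (β * ‖z‖) * Real.exp (-(β * ρ)))) := by ring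
    _ ≤ (C * Real.exp (β * ‖z‖)) / c * (1 + ρ) ^ k *
        (Real.exp (-((s - β) * c)) * (Real.exp (β * ‖z‖) * Real.exp (-(β * ρ)))) := by
      gcongr
      exact h _ (norm_nonneg z)
    _ = _ := by
      have : Real.exp (2 * β * ‖z‖) = Real.exp (β * ‖z‖) * Real.exp (β * ‖z‖) := by
        rw [← Real.exp_add]; congr 1; ring
      rw [this]; ring

section Slices

variable {X : Type*} [MeasurableSpace X] {m : Measure X} {a z : X → ℂ} {c β : ℝ}

lemma integrable_mul_of_exp (ha : AEStronglyMeasurable a m) {w : X → ℂ}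
    (hw : AEStronglyMeasurable w m) {C : ℝ} (hi : Integrable (fun x => ‖a x‖ * Real.exp (2 * β * ‖z x‖)) m)
    (hb : ∀ x, ‖w x‖ ≤ C * Real.exp (2 * β * ‖z x‖)) : Integrable (fun x => a x * w x) m := by
  refine (hi.const_mul C).mono' (ha.mul hw) (Filter.Eventually.of_forall fun x => ?_)
  rw [norm_mul]
  calc ‖a x‖ * ‖w x‖ ≤ ‖a x‖ * (C * Real.exp (2 * β * ‖z x‖)) := by gcongr; exact hb x
    _ = _ := by ring

lemma measurable_kernel (hz : Measurable z) (k : ℕ) (ρ s : ℝ) :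
    Measurable fun x => z x / nuRoot (z x) ρ * (Complex.I * nuRoot (z x) ρ) ^ k *
      Complex.exp (-(s * nuRoot (z x) ρ)) := by
  have hν : Measurable fun x => nuRoot (z x) ρ :=
    hz.nuRoot measurable_const
  exact ((hz.div hν).mul ((hν.const_mul _).pow_const k)).mul (hν.const_mul _).neg.cexp

lemma norm_comp_sqrt_le {f : ℝ → ℂ} {C b : ℝ} (hb : 0 < b)
    (hfC : ∀ r, 0 ≤ r → ‖f r‖ ≤ C * Real.exp (-(b * r))) (ρ t : ℝ) (hC : 0 ≤ C) :
    ‖f (√(t ^ 2 + ρ ^ 2))‖ ≤ C * (Real.exp (-(b / 2 * |t|)) * Real.exp (-(b / 2 * |ρ|))) := by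
  refine (hfC _ (Real.sqrt_nonneg _)).trans ?_
  rw [← Real.exp_add]
  gcongr
  have h1 : |t| ≤ √(t ^ 2 + ρ ^ 2) := Real.abs_le_sqrt (by nlinarith)
  have h2 : |ρ| ≤ √(t ^ 2 + ρ ^ 2) := Real.abs_le_sqrt (by nlinarith)
  nlinarith

lemma hasDerivAt_fourier_mul_pow {h : ℝ → ℂ} (hh : Continuous h) (k : ℕ)
    (h0 : Integrable fun t : ℝ => ‖h t * (t : ℂ) ^ k‖)
    (h1 : Integrable fun t : ℝ => ‖h t * (t : ℂ) ^ (k + 1)‖) (s : ℝ) :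
    HasDerivAt (fun s : ℝ => ∫ t : ℝ, h t * t ^ k * Complex.exp (Complex.I * t * s))
      (∫ t : ℝ, h t * t ^ k * (Complex.exp (Complex.I * t * s) * (Complex.I * t))) s := by
  refine (hasDerivAt_integral_of_dominated_loc_of_deriv_le (s := Set.univ)
    (bound := fun t : ℝ => ‖h t * (t : ℂ) ^ (k + 1)‖)
    (F' := fun (s : ℝ) (t : ℝ) => h t * t ^ k * (Complex.exp (Complex.I * t * s) * (Complex.I * t)))
    Filter.univ_mem ?_ ?_ ?_ ?_ h1 ?_).2
  · exact Filter.Eventually.of_forall fun s =>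
      (Continuous.aestronglyMeasurable (by fun_prop))
  · refine h0.mono' (Continuous.aestronglyMeasurable (by fun_prop))
      (Filter.Eventually.of_forall fun t => ?_)
    rw [norm_mul, mul_assoc Complex.I, ← Complex.ofReal_mul, Complex.norm_exp_I_mul_ofReal, mul_one]
  · exact Continuous.aestronglyMeasurable (by fun_prop)
  · refine Filter.Eventually.of_forall fun t s _ => le_of_eq ?_
    rw [norm_mul, norm_mul (Complex.exp _), mul_assoc Complex.I, ← Complex.ofReal_mul,
      Complex.norm_exp_I_mul_ofReal, one_mul, norm_mul Complex.I, Complex.norm_I, one_mul,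
      ← norm_mul, pow_succ, mul_assoc]
  · refine Filter.Eventually.of_forall fun t s _ => ?_
    have : HasDerivAt (fun s : ℝ => Complex.I * t * s) (Complex.I * t) s := by
      simpa using ((hasDerivAt_id s).ofReal_comp.const_mul (Complex.I * t))
    exact this.cexp.const_mul _

lemma hasDerivAt_laplace {b ν : X → ℂ} (hb : AEStronglyMeasurable b m) (hν : Measurable ν)
    (hν0 : ∀ x, 0 ≤ (ν x).re) {s : ℝ} (hs : β < s)
    (h0 : Integrable (fun x => ‖b x * Complex.exp (-(β * ν x))‖) m)
    (h1 : Integrable (fun x => ‖b x * ν x * Complex.exp (-(β * ν x))‖) m) :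
    HasDerivAt (fun s : ℝ => ∫ x, b x * Complex.exp (-(s * ν x)) ∂m)
      (∫ x, b x * (Complex.exp (-(s * ν x)) * (-ν x)) ∂m) s := by
  have hle : ∀ (s : ℝ) x, β < s → ‖Complex.exp (-(s * ν x))‖ ≤ ‖Complex.exp (-(β * ν x))‖ := by
    intro s x hs
    rw [Complex.norm_exp, Complex.norm_exp]
    apply Real.exp_le_exp.2
    simp only [Complex.neg_re, Complex.re_ofReal_mul]
    nlinarith [hν0 x]
  have hmeas : ∀ s : ℝ, AEStronglyMeasurable (fun x => b x * Complex.exp (-(s * ν x))) m :=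
    fun s => hb.mul (hν.const_mul _).neg.cexp.aestronglyMeasurable
  refine (hasDerivAt_integral_of_dominated_loc_of_deriv_le (s := Set.Ioi β)
    (bound := fun x => ‖b x * ν x * Complex.exp (-(β * ν x))‖)
    (F' := fun (s : ℝ) x => b x * (Complex.exp (-(s * ν x)) * (-ν x)))
    (Ioi_mem_nhds hs) ?_ ?_ ?_ ?_ h1 ?_).2
  · exact Filter.Eventually.of_forall hmeas
  · refine h0.mono' (hmeas s) (Filter.Eventually.of_forall fun x => ?_)
    rw [norm_mul, norm_mul]
    gcongr
    exact hle s x hs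
  · exact hb.mul ((hν.const_mul _).neg.cexp.mul hν.neg).aestronglyMeasurable
  · refine Filter.Eventually.of_forall fun x s hs => ?_
    simp only [norm_mul, norm_neg]
    rw [mul_comm ‖Complex.exp _‖, ← mul_assoc]
    gcongr
    exact hle s x hs
  · refine Filter.Eventually.of_forall fun x s _ => ?_
    have : HasDerivAt (fun s : ℝ => -(s * ν x)) (-ν x) s := by
      simpa using ((hasDerivAt_id s).ofReal_comp.mul_const (ν x)).fun_neg
    exact this.cexp.const_mul _

lemma integral_pow_eq {h : ℝ → ℂ} (hh : Continuous h) {b ν : X → ℂ}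
    (hki : ∀ k : ℕ, Integrable fun t : ℝ => ‖h t * (t : ℂ) ^ k‖)
    (hb : AEStronglyMeasurable b m) (hν : Measurable ν) (hν0 : ∀ x, 0 ≤ (ν x).re)
    (hbi : ∀ k : ℕ, Integrable (fun x => ‖b x * (Complex.I * ν x) ^ k *
      Complex.exp (-(β * ν x))‖) m)
    (h0 : ∀ s : ℝ, β < s → ∫ t : ℝ, h t * Complex.exp (Complex.I * t * s) =
      ∫ x, b x * Complex.exp (-(s * ν x)) ∂m) (k : ℕ) {s : ℝ} (hs : β < s) :
    ∫ t : ℝ, h t * t ^ k * Complex.exp (Complex.I * t * s) =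
      ∫ x, b x * (Complex.I * ν x) ^ k * Complex.exp (-(s * ν x)) ∂m := by
  induction k generalizing s with
  | zero => simpa using h0 s hs
  | succ k ih =>
    have hR := hasDerivAt_laplace (b := fun x => b x * (Complex.I * ν x) ^ k)
      (hb.mul ((hν.const_mul _).pow_const k).aestronglyMeasurable) hν hν0 hs (hbi k) (by
        refine (hbi (k + 1)).congr (Filter.Eventually.of_forall fun x => ?_)
        simp only [norm_mul, norm_pow, Complex.norm_I, pow_succ]
        ring)
    have heq := (hasDerivAt_fourier_mul_pow hh k (hki _) (hki _) s).unique
      (hR.congr_of_eventuallyEq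
        (Filter.eventually_of_mem (Ioi_mem_nhds hs) fun s hs => ih hs))
    have e1 : ∀ t : ℝ, h t * t ^ (k + 1) * Complex.exp (Complex.I * t * s) =
        -Complex.I * (h t * t ^ k * (Complex.exp (Complex.I * t * s) * (Complex.I * t))) := by
      intro t
      linear_combination (h t * t ^ k * Complex.exp (Complex.I * t * s) * t) * Complex.I_mul_I
    have e2 : ∀ x, b x * (Complex.I * ν x) ^ (k + 1) * Complex.exp (-(s * ν x)) =
        -Complex.I * (b x * (Complex.I * ν x) ^ k *
          (Complex.exp (-(s * ν x)) * (-ν x))) := by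
      intro x; ring
    simp_rw [e1, e2]
    rw [integral_const_mul, integral_const_mul, heq]

/-- Fourier transform of a one-dimensional slice of a radial function. -/
lemma integral_slice [SFinite m] {f : ℝ → ℂ} (hf : Continuous f) (hfe : ∀ r, f (-r) = f r) {C b : ℝ}
    (hb : 0 < b) (hfC : ∀ r, 0 ≤ r → ‖f r‖ ≤ C * Real.exp (-(b * r)))
    (ha : AEStronglyMeasurable a m) (hz : Measurable z) (hc : 0 < c) (hzc : ∀ x, c ≤ (z x).re)
    (hβ : 0 < β) (hi : Integrable (fun x => ‖a x‖ * Real.exp (2 * β * ‖z x‖)) m)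
    (hfa : ∀ u : ℝ, 0 ≤ u → ∫ r : ℝ, f r * Complex.exp (Complex.I * r * u) =
      ∫ x, a x * Complex.exp (-(u * z x)) ∂m) {ρ : ℝ} (hρ : 0 ≤ ρ) (k : ℕ) {s : ℝ} (hs : β < s) :
    ∫ t : ℝ, f (√(t ^ 2 + ρ ^ 2)) * t ^ k * Complex.exp (Complex.I * t * s) =
      ∫ x, a x * (z x / nuRoot (z x) ρ * (Complex.I * nuRoot (z x) ρ) ^ k *
        Complex.exp (-(s * nuRoot (z x) ρ))) ∂m := by
  have hC : 0 ≤ C := by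
    have := (norm_nonneg _).trans (hfC 0 le_rfl); simpa using this
  have hcont : Continuous fun t : ℝ => f (√(t ^ 2 + ρ ^ 2)) := hf.comp (by fun_prop)
  have hbd : ∀ t, ‖f (√(t ^ 2 + ρ ^ 2))‖ ≤ C * Real.exp (-(b / 2 * |t|)) := by
    intro t
    refine (norm_comp_sqrt_le hb hfC ρ t hC).trans ?_
    gcongr
    refine mul_le_of_le_one_right (by positivity) (Real.exp_le_one_iff.2 ?_)
    have := abs_nonneg ρ
    nlinarith
  have hki : ∀ k : ℕ, Integrable fun t : ℝ => ‖f (√(t ^ 2 + ρ ^ 2)) * (t : ℂ) ^ k‖ := by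
    intro k
    refine ((integrable_pow_mul_exp_neg_norm (E := ℝ) k (half_pos hb)).const_mul C).mono'
      (Continuous.aestronglyMeasurable (by fun_prop)) (Filter.Eventually.of_forall fun t => ?_)
    rw [norm_norm, norm_mul, norm_pow, Complex.norm_real, mul_left_comm,
      mul_comm ‖f _‖]
    have := hbd t
    rw [Real.norm_eq_abs]
    gcongr
    linarith [abs_nonneg t]
  have hai : Integrable a m := by
    have := integrable_mul_of_exp (C := 1) (w := fun _ => 1) ha (by fun_prop) hi (fun x => ?_)
    · simpa using this
    · simp; positivity
  have hfi : Integrable f := by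
    refine ((integrable_exp_neg_mul_abs hb).const_mul C).mono' hf.aestronglyMeasurable
      (Filter.Eventually.of_forall fun t => ?_)
    rcases le_total 0 t with ht | ht
    · rw [abs_of_nonneg ht]; exact hfC t ht
    · rw [abs_of_nonpos ht, ← hfe]; exact hfC _ (neg_nonneg.2 ht)
  have hνm : Measurable fun x => nuRoot (z x) ρ :=
    hz.nuRoot measurable_const
  have hνc : ∀ x, c ≤ (nuRoot (z x) ρ).re := fun x =>
    (hzc x).trans (re_le_nuRoot_re (hc.trans_le (hzc x)) ρ)
  have hν0 : ∀ x, nuRoot (z x) ρ ≠ 0 := fun x h0 => by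
    have := hνc x; rw [h0] at this; simp at this; linarith
  have hres := eq_integral_resolvent hf hfi hfe hai hz.aestronglyMeasurable hc hzc hfa
  have hai' : Integrable (fun x => a x * (z x / nuRoot (z x) ρ)) m := by
    obtain ⟨C', hC', h1⟩ := pow_le_mul_exp 1 (β := 2 * β) (by positivity)
    refine integrable_mul_of_exp (C := C' / c) (β := β) (z := z) ha
      (hz.div hνm).aestronglyMeasurable hi fun x => ?_
    have : c ≤ ‖nuRoot (z x) ρ‖ := (hνc x).trans (Complex.re_le_norm _)
    rw [norm_div, div_mul_eq_mul_div]
    gcongr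
    have := h1 _ (norm_nonneg (z x))
    linarith
  have h0 : ∀ u : ℝ, 0 ≤ u → ∫ t : ℝ, f (√(t ^ 2 + ρ ^ 2)) * Complex.exp (Complex.I * t * u) =
      ∫ x, a x * (z x / nuRoot (z x) ρ) * Complex.exp (-(u * nuRoot (z x) ρ)) ∂m := by
    intro u hu
    have hh0 : Integrable fun t : ℝ => f (√(t ^ 2 + ρ ^ 2)) := by
      have := hki 0
      simp only [pow_zero, mul_one] at this
      exact (integrable_norm_iff hcont.aestronglyMeasurable).1 this
    refine fourier_eq_of_eq_integral_resolvent hh0 hai' hνm.aestronglyMeasurable hc hνc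
      (fun r => ?_) hu
    rw [hres]
    congr 1; ext x
    rw [nuRoot_sq, ← Complex.ofReal_pow, Real.sq_sqrt (by positivity)]
    push_cast
    rw [mul_assoc, div_mul_div_cancel₀ (hν0 x)]
    rw [add_assoc, add_comm ((r : ℂ) ^ 2)]
  rw [integral_pow_eq (β := β) hcont hki hai'.aestronglyMeasurable hνm
    (fun x => hc.le.trans (hνc x)) (fun k => ?_) (fun s hs => h0 s (hβ.trans hs).le) k hs]
  · simp only [mul_assoc]
  · obtain ⟨C₁, hC₁, hk1⟩ := norm_kernel_le k hβ hc
    have := (integrable_mul_of_exp (C := C₁ * ((1 + ρ) ^ k * Real.exp (-(β * ρ)))) (β := β) (z := z)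
          ha (measurable_kernel hz k ρ β).aestronglyMeasurable hi fun x => ?_).norm
    · simpa only [mul_assoc] using this
    · refine (hk1 (z x) ρ β (hzc x) hρ le_rfl).trans (le_of_eq ?_)
      simp
      ring

end Slices

/-- Splitting off the first coordinate of a Euclidean vector. -/
noncomputable def euclideanConsEquiv (d : ℕ) :
    ℝ × EuclideanSpace ℝ (Fin d) ≃ᵐ EuclideanSpace ℝ (Fin (d + 1)) :=
  ((MeasurableEquiv.refl ℝ).prodCongr (MeasurableEquiv.toLp 2 (Fin d → ℝ)).symm).trans
    ((MeasurableEquiv.piFinSuccAbove (fun _ => ℝ) 0).symm.trans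
      (MeasurableEquiv.toLp 2 (Fin (d + 1) → ℝ)))

lemma measurePreserving_euclideanConsEquiv (d : ℕ) :
    MeasurePreserving (euclideanConsEquiv d) := by
  have h1 := (MeasurePreserving.id (volume : Measure ℝ)).prod
    (EuclideanSpace.volume_preserving_symm_measurableEquiv_toLp (Fin d))
  have h2 := (volume_preserving_piFinSuccAbove (fun _ : Fin (d + 1) => ℝ) 0).symm
  have h3 := (EuclideanSpace.volume_preserving_symm_measurableEquiv_toLp (Fin (d + 1))).symm
  exact h3.comp (h2.comp h1)

lemma euclideanConsEquiv_apply_zero {d : ℕ} (p : ℝ × EuclideanSpace ℝ (Fin d)) :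
    euclideanConsEquiv d p 0 = p.1 := rfl

lemma euclideanConsEquiv_apply_succ {d : ℕ} (p : ℝ × EuclideanSpace ℝ (Fin d)) (i : Fin d) :
    euclideanConsEquiv d p i.succ = p.2 i := rfl

lemma norm_euclideanConsEquiv {d : ℕ} (p : ℝ × EuclideanSpace ℝ (Fin d)) :
    ‖euclideanConsEquiv d p‖ = √(p.1 ^ 2 + ‖p.2‖ ^ 2) := by
  rw [EuclideanSpace.norm_eq, EuclideanSpace.norm_sq_eq, Fin.sum_univ_succ]
  simp [euclideanConsEquiv_apply_zero, euclideanConsEquiv_apply_succ]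

lemma integral_euclidean_succ {f : ℝ → ℂ} (hf : Continuous f) {C b : ℝ} (hC : 0 ≤ C) (hb : 0 < b)
    (hfC : ∀ r, 0 ≤ r → ‖f r‖ ≤ C * Real.exp (-(b * r))) (d k : ℕ) (s : ℝ) :
    ∫ lam : EuclideanSpace ℝ (Fin (d + 1)),
        f ‖lam‖ * (lam 0 : ℂ) ^ k * Complex.exp (Complex.I * lam 0 * s) =
      ∫ v : EuclideanSpace ℝ (Fin d), ∫ t : ℝ,
        f (√(t ^ 2 + ‖v‖ ^ 2)) * t ^ k * Complex.exp (Complex.I * t * s) := by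
  rw [← (measurePreserving_euclideanConsEquiv d).integral_comp
    (euclideanConsEquiv d).measurableEmbedding]
  simp only [norm_euclideanConsEquiv, euclideanConsEquiv_apply_zero]
  rw [Measure.volume_eq_prod]
  refine integral_prod_symm _ ?_
  have h1 := integrable_pow_mul_exp_neg_norm (E := ℝ) k (half_pos hb)
  have h2 := integrable_pow_mul_exp_neg_norm (E := EuclideanSpace ℝ (Fin d)) 0 (half_pos hb)
  refine ((h1.mul_prod h2).const_mul C).mono' (Continuous.aestronglyMeasurable (by fun_prop))
    (Filter.Eventually.of_forall fun p => ?_)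
  rw [norm_mul, norm_mul, mul_assoc Complex.I, ← Complex.ofReal_mul, Complex.norm_exp_I_mul_ofReal,
    mul_one, norm_pow, Complex.norm_real, pow_zero, one_mul, Real.norm_eq_abs]
  have h := norm_comp_sqrt_le hb hfC ‖p.2‖ p.1 hC
  rw [abs_norm] at h
  calc _ ≤ (C * (Real.exp (-(b / 2 * |p.1|)) * Real.exp (-(b / 2 * ‖p.2‖)))) * (1 + |p.1|) ^ k := by
        gcongr
        linarith [abs_nonneg p.1]
    _ = _ := by ring

/-- The integral over the directions orthogonal to the first coordinate. -/
noncomputable def innerInt (d k : ℕ) (s : ℝ) (z : ℂ) : ℂ :=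
  ∫ v : EuclideanSpace ℝ (Fin d), z / nuRoot z ‖v‖ * (Complex.I * nuRoot z ‖v‖) ^ k *
    Complex.exp (-(s * nuRoot z ‖v‖))

lemma norm_innerInt_le (d k : ℕ) {β c : ℝ} (hβ : 0 < β) (hc : 0 < c) :
    ∃ C : ℝ, 0 < C ∧ ∀ (z : ℂ) (s : ℝ), c ≤ z.re → β ≤ s →
      ‖innerInt d k s z‖ ≤ C * Real.exp (-((s - β) * c)) * Real.exp (2 * β * ‖z‖) := by
  obtain ⟨C, hC, h⟩ := norm_kernel_le k hβ hc
  have hi := integrable_pow_mul_exp_neg_norm (E := EuclideanSpace ℝ (Fin d)) k hβ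
  set J := ∫ v : EuclideanSpace ℝ (Fin d), (1 + ‖v‖) ^ k * Real.exp (-(β * ‖v‖)) with hJ
  have hJ0 : 0 ≤ J := integral_nonneg fun v => by positivity
  refine ⟨C * (J + 1), by positivity, fun z s hz hs => ?_⟩
  refine (norm_integral_le_of_norm_le (hi.const_mul (C * Real.exp (-((s - β) * c)) *
    Real.exp (2 * β * ‖z‖))) (Filter.Eventually.of_forall fun v =>
      h z ‖v‖ s hz (norm_nonneg v) hs)).trans ?_
  rw [integral_const_mul, ← hJ]
  calc _ = C * J * Real.exp (-((s - β) * c)) * Real.exp (2 * β * ‖z‖) := by ring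
    _ ≤ _ := by gcongr; linarith

section Radial

variable {X : Type*} [MeasurableSpace X] {m : Measure X} {a z : X → ℂ} {c β : ℝ}

lemma integrable_kernel_prod [SFinite m] (ha : AEStronglyMeasurable a m) (hz : Measurable z)
    (hc : 0 < c) (hzc : ∀ x, c ≤ (z x).re) (hβ : 0 < β)
    (hi : Integrable (fun x => ‖a x‖ * Real.exp (2 * β * ‖z x‖)) m) (d k : ℕ) {s : ℝ} (hs : β ≤ s) :
    Integrable (fun p : EuclideanSpace ℝ (Fin d) × X => a p.2 * (z p.2 / nuRoot (z p.2) ‖p.1‖ *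
      (Complex.I * nuRoot (z p.2) ‖p.1‖) ^ k * Complex.exp (-(s * nuRoot (z p.2) ‖p.1‖))))
      (volume.prod m) := by
  obtain ⟨C, hC, h⟩ := norm_kernel_le k hβ hc
  have hz2 : Measurable fun p : EuclideanSpace ℝ (Fin d) × X => z p.2 := hz.comp measurable_snd
  have hν : Measurable fun p : EuclideanSpace ℝ (Fin d) × X => nuRoot (z p.2) ‖p.1‖ :=
    hz2.nuRoot measurable_fst.norm
  have hv := integrable_pow_mul_exp_neg_norm (E := EuclideanSpace ℝ (Fin d)) k hβ
  refine ((hv.mul_prod hi).const_mul (C * Real.exp (-((s - β) * c)))).mono'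
    (ha.comp_snd.mul (((hz2.div hν).mul ((hν.const_mul _).pow_const k)).mul
      (hν.const_mul _).neg.cexp).aestronglyMeasurable) (Filter.Eventually.of_forall fun p => ?_)
  rw [norm_mul]
  refine (mul_le_mul_of_nonneg_left (h (z p.2) ‖p.1‖ s (hzc _) (norm_nonneg _) hs)
    (norm_nonneg _)).trans (le_of_eq ?_)
  ring

lemma integrable_mul_innerInt [SFinite m] (ha : AEStronglyMeasurable a m) (hz : Measurable z)
    (hc : 0 < c) (hzc : ∀ x, c ≤ (z x).re) (hβ : 0 < β)
    (hi : Integrable (fun x => ‖a x‖ * Real.exp (2 * β * ‖z x‖)) m) (d k : ℕ) {s : ℝ} (hs : β ≤ s) :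
    Integrable (fun x => a x * innerInt d k s (z x)) m := by
  have := (integrable_kernel_prod ha hz hc hzc hβ hi d k hs).integral_prod_right
  refine this.congr (Filter.Eventually.of_forall fun x => ?_)
  simp only [innerInt]
  rw [integral_const_mul]

/-- Fourier transform of a radial function on `ℝ^(d+1)` obtained from its one-dimensional
Fourier transform. -/
lemma integral_radial [SFinite m] {f : ℝ → ℂ} (hf : Continuous f) (hfe : ∀ r, f (-r) = f r) {C b : ℝ}
    (hb : 0 < b) (hfC : ∀ r, 0 ≤ r → ‖f r‖ ≤ C * Real.exp (-(b * r)))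
    (ha : AEStronglyMeasurable a m) (hz : Measurable z) (hc : 0 < c) (hzc : ∀ x, c ≤ (z x).re)
    (hβ : 0 < β) (hi : Integrable (fun x => ‖a x‖ * Real.exp (2 * β * ‖z x‖)) m)
    (hfa : ∀ u : ℝ, 0 ≤ u → ∫ r : ℝ, f r * Complex.exp (Complex.I * r * u) =
      ∫ x, a x * Complex.exp (-(u * z x)) ∂m) (d k : ℕ) {s : ℝ} (hs : β < s) :
    ∫ lam : EuclideanSpace ℝ (Fin (d + 1)),
        f ‖lam‖ * (lam 0 : ℂ) ^ k * Complex.exp (Complex.I * lam 0 * s) =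
      ∫ x, a x * innerInt d k s (z x) ∂m := by
  have hC : 0 ≤ C := by
    have := (norm_nonneg _).trans (hfC 0 le_rfl); simpa using this
  rw [integral_euclidean_succ hf hC hb hfC]
  simp_rw [integral_slice hf hfe hb hfC ha hz hc hzc hβ hi hfa (norm_nonneg _) k hs]
  rw [integral_integral_swap (integrable_kernel_prod ha hz hc hzc hβ hi d k hs.le)]
  simp_rw [integral_const_mul, innerInt]

end Radial

lemma measurableEmbedding_sumInl {X Y : Type*} [MeasurableSpace X] [MeasurableSpace Y] :
    MeasurableEmbedding (Sum.inl : X → X ⊕ Y) :=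
  ⟨Sum.inl_injective, measurable_inl, fun _ hs => hs.inl_image⟩

lemma measurableEmbedding_sumInr {X Y : Type*} [MeasurableSpace X] [MeasurableSpace Y] :
    MeasurableEmbedding (Sum.inr : Y → X ⊕ Y) :=
  ⟨Sum.inr_injective, measurable_inr, fun _ hs => hs.inr_image⟩

lemma integral_radial_add {X Y : Type*} [MeasurableSpace X] [MeasurableSpace Y] {m : Measure X}
    {m' : Measure Y} [SFinite m] [SFinite m'] {f : ℝ → ℂ} (hf : Continuous f)
    (hfe : ∀ r, f (-r) = f r) {C b : ℝ}
    (hb : 0 < b) (hfC : ∀ r, 0 ≤ r → ‖f r‖ ≤ C * Real.exp (-(b * r)))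
    {a z : X → ℂ} {a' z' : Y → ℂ} {c β : ℝ} (hc : 0 < c) (hβ : 0 < β)
    (ha : Measurable a) (hz : Measurable z) (hzc : ∀ x, c ≤ (z x).re)
    (hi : Integrable (fun x => ‖a x‖ * Real.exp (2 * β * ‖z x‖)) m)
    (ha' : Measurable a') (hz' : Measurable z') (hzc' : ∀ x, c ≤ (z' x).re)
    (hi' : Integrable (fun x => ‖a' x‖ * Real.exp (2 * β * ‖z' x‖)) m')
    (hfa : ∀ u : ℝ, 0 ≤ u → ∫ r : ℝ, f r * Complex.exp (Complex.I * r * u) =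
      (∫ x, a x * Complex.exp (-(u * z x)) ∂m) + ∫ x, a' x * Complex.exp (-(u * z' x)) ∂m')
    (d k : ℕ) {s : ℝ} (hs : β < s) :
    ∫ lam : EuclideanSpace ℝ (Fin (d + 1)),
        f ‖lam‖ * (lam 0 : ℂ) ^ k * Complex.exp (Complex.I * lam 0 * s) =
      (∫ x, a x * innerInt d k s (z x) ∂m) + ∫ x, a' x * innerInt d k s (z' x) ∂m' := by
  set M : Measure (X ⊕ Y) := m.map Sum.inl + m'.map Sum.inr with hM
  have hA : Measurable (Sum.elim a a') := measurable_fun_sum ha ha'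
  have hZ : Measurable (Sum.elim z z') := measurable_fun_sum hz hz'
  have hint : ∀ {E : Type} [NormedAddCommGroup E] (g : X ⊕ Y → E),
      Integrable (fun x => g (Sum.inl x)) m → Integrable (fun x => g (Sum.inr x)) m' →
      Integrable g M := fun g h h' =>
    integrable_add_measure.2 ⟨(measurableEmbedding_sumInl.integrable_map_iff).2 h,
      (measurableEmbedding_sumInr.integrable_map_iff).2 h'⟩
  have hadd : ∀ g : X ⊕ Y → ℂ, Integrable g M →
      ∫ x, g x ∂M = (∫ x, g (Sum.inl x) ∂m) + ∫ x, g (Sum.inr x) ∂m' := fun g hg => by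
    obtain ⟨h1, h2⟩ := integrable_add_measure.1 hg
    rw [hM, integral_add_measure h1 h2, measurableEmbedding_sumInl.integral_map,
      measurableEmbedding_sumInr.integral_map]
  have hZc : ∀ x, c ≤ (Sum.elim z z' x).re := by rintro (x | x); exacts [hzc x, hzc' x]
  have hI : Integrable (fun x => ‖Sum.elim a a' x‖ * Real.exp (2 * β * ‖Sum.elim z z' x‖)) M :=
    hint _ hi hi'
  rw [integral_radial hf hfe hb hfC hA.aestronglyMeasurable hZ hc hZc hβ hI (fun u hu => ?_) d k hs,
    hadd _ (integrable_mul_innerInt hA.aestronglyMeasurable hZ hc hZc hβ hI d k hs.le)]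
  · rfl
  · rw [hfa u hu, hadd]
    · rfl
    · refine integrable_mul_of_exp (C := 1) (β := β) (z := Sum.elim z z') hA.aestronglyMeasurable
        (hZ.const_mul _).neg.cexp.aestronglyMeasurable hI fun x => ?_
      rw [Complex.norm_exp, one_mul]
      refine Real.exp_le_exp.2 ?_
      simp only [Complex.neg_re, Complex.re_ofReal_mul]
      have := hZc x
      have h1 : 0 ≤ (Sum.elim z z' x).re := hc.le.trans this
      have : 0 ≤ β * ‖Sum.elim z z' x‖ := by positivity
      nlinarith [mul_nonneg hu h1]

/-- The entire function `sinh ζ / ζ`. -/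
noncomputable def sinhc (ζ : ℂ) : ℂ := dslope Complex.sinh 0 ζ

lemma mul_sinhc (ζ : ℂ) : ζ * sinhc ζ = Complex.sinh ζ := by
  have := sub_smul_dslope Complex.sinh 0 ζ
  simpa [sinhc] using this

lemma sinhc_of_ne {ζ : ℂ} (h : ζ ≠ 0) : sinhc ζ = Complex.sinh ζ / ζ := by
  rw [← mul_sinhc, mul_div_cancel_left₀ _ h]

lemma sinhc_zero : sinhc 0 = 1 := by
  simp [sinhc, dslope_same]

lemma sinhc_neg (ζ : ℂ) : sinhc (-ζ) = sinhc ζ := by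
  rcases eq_or_ne ζ 0 with rfl | h
  · simp
  · rw [sinhc_of_ne h, sinhc_of_ne (neg_ne_zero.2 h), Complex.sinh_neg, neg_div_neg_eq]

lemma differentiable_sinhc : Differentiable ℂ sinhc := by
  have := (Complex.differentiableOn_dslope (c := 0) (f := Complex.sinh) (s := Set.univ)
    Filter.univ_mem).2 Complex.differentiable_sinh.differentiableOn
  exact differentiableOn_univ.1 this

lemma norm_sinh_sq (x y : ℝ) :
    ‖Complex.sinh (x + y * Complex.I)‖ ^ 2 = Real.sinh x ^ 2 + Real.sin y ^ 2 := by
  rw [Complex.sinh_add, Complex.sinh_mul_I, Complex.cosh_mul_I, ← Complex.ofReal_sinh,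
    ← Complex.ofReal_cosh, ← Complex.ofReal_sin, ← Complex.ofReal_cos, Complex.sq_norm,
    Complex.normSq_apply]
  simp [Complex.sinh_ofReal_re, Complex.sin_ofReal_re, Complex.cos_ofReal_re]
  have h3 := Real.cosh_sq x
  have h4 := Real.sin_sq_add_cos_sq y
  linear_combination (Real.sin y ^ 2) * h3 + (Real.sinh x ^ 2) * h4

lemma norm_cosh_sq (x y : ℝ) :
    ‖Complex.cosh (x + y * Complex.I)‖ ^ 2 = Real.sinh x ^ 2 + Real.cos y ^ 2 := by
  rw [Complex.cosh_add, Complex.sinh_mul_I, Complex.cosh_mul_I, ← Complex.ofReal_sinh,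
    ← Complex.ofReal_cosh, ← Complex.ofReal_sin, ← Complex.ofReal_cos, Complex.sq_norm,
    Complex.normSq_apply]
  simp [Complex.sinh_ofReal_re, Complex.sin_ofReal_re, Complex.cos_ofReal_re]
  have h3 := Real.cosh_sq x
  have h4 := Real.sin_sq_add_cos_sq y
  linear_combination (Real.cos y ^ 2) * h3 + (Real.sinh x ^ 2) * h4

lemma re_mul_cosh_mul_conj_sinh (x y : ℝ) :
    (((x + y * Complex.I) * Complex.cosh (x + y * Complex.I)) *
      (starRingEnd ℂ) (Complex.sinh (x + y * Complex.I))).re =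
      x * (Real.sinh x * Real.cosh x) + y * (Real.sin y * Real.cos y) := by
  rw [Complex.sinh_add, Complex.cosh_add, Complex.sinh_mul_I, Complex.cosh_mul_I,
    ← Complex.ofReal_sinh, ← Complex.ofReal_cosh, ← Complex.ofReal_sin, ← Complex.ofReal_cos]
  simp [Complex.sinh_ofReal_re, Complex.sin_ofReal_re, Complex.cos_ofReal_re]
  have h1 := Real.cosh_sq x
  have h2 := Real.sin_sq_add_cos_sq y
  linear_combination (x * Real.sinh x * Real.cosh x) * h2 + (y * Real.sin y * Real.cos y) * h1

lemma sinhc_ne_zero {x y : ℝ} (h0 : 0 ≤ y) (h1 : y < 2 * π) (h : (x + y * Complex.I : ℂ) ≠ π * Complex.I) :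
    sinhc (x + y * Complex.I) ≠ 0 := by
  intro hs
  rcases eq_or_ne (x + y * Complex.I : ℂ) 0 with h2 | h2
  · rw [h2, sinhc_zero] at hs
    exact one_ne_zero hs
  have hsinh : Complex.sinh (x + y * Complex.I) = 0 := by rw [← mul_sinhc, hs, mul_zero]
  have h3 := norm_sinh_sq x y
  rw [hsinh, norm_zero] at h3
  have hx : Real.sinh x = 0 := by nlinarith [sq_nonneg (Real.sinh x), sq_nonneg (Real.sin y)]
  have hy : Real.sin y = 0 := by nlinarith [sq_nonneg (Real.sinh x), sq_nonneg (Real.sin y)]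
  rw [Real.sinh_eq_zero] at hx
  subst hx
  rcases lt_trichotomy y π with hlt | heq | hgt
  · rcases h0.eq_or_lt with h0 | h0
    · exact h2 (by simp [← h0])
    · exact (Real.sin_pos_of_pos_of_lt_pi h0 hlt).ne' hy
  · exact h (by simp [heq])
  · have := Real.sin_pos_of_pos_of_lt_pi (x := y - π) (by linarith) (by linarith)
    rw [Real.sin_sub_pi, hy] at this
    simp at this

/-- The radial profile `exp(-R ζ coth ζ) (ζ / sinh ζ)^N (cosh ζ)^k`. -/
noncomputable def profile (R : ℝ) (N k : ℕ) (ζ : ℂ) : ℂ :=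
  Complex.exp (-(R * (Complex.cosh ζ / sinhc ζ))) / sinhc ζ ^ N * Complex.cosh ζ ^ k

lemma profile_neg (R : ℝ) (N k : ℕ) (ζ : ℂ) : profile R N k (-ζ) = profile R N k ζ := by
  simp [profile, sinhc_neg]

lemma differentiableAt_profile (R : ℝ) (N k : ℕ) {ζ : ℂ} (h : sinhc ζ ≠ 0) :
    DifferentiableAt ℂ (profile R N k) ζ := by
  have h1 : DifferentiableAt ℂ sinhc ζ := differentiable_sinhc ζ
  have h2 : DifferentiableAt ℂ Complex.cosh ζ := Complex.differentiable_cosh ζ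
  exact (((h2.div h1 h).const_mul _).neg.cexp.div (h1.pow N) (pow_ne_zero _ h)).mul (h2.pow k)

lemma norm_profile_le {R : ℝ} (hR : 0 ≤ R) (N k : ℕ) {x y : ℝ} (h0 : 0 ≤ y) (h1 : y < 2 * π)
    (h : (x + y * Complex.I : ℂ) ≠ π * Complex.I)
    (hre : 0 ≤ x * (Real.sinh x * Real.cosh x) + y * (Real.sin y * Real.cos y)) :
    ‖profile R N k (x + y * Complex.I)‖ ≤
      ‖sinhc (x + y * Complex.I)‖⁻¹ ^ N * ‖Complex.cosh (x + y * Complex.I)‖ ^ k := by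
  have hs := sinhc_ne_zero h0 h1 h
  set ζ : ℂ := x + y * Complex.I with hζ
  have hre' : 0 ≤ (Complex.cosh ζ / sinhc ζ).re := by
    rcases eq_or_ne ζ 0 with hz | hz
    · rw [hz, sinhc_zero]; simp
    have h3 : Complex.cosh ζ / sinhc ζ = ((Complex.normSq (Complex.sinh ζ))⁻¹ : ℝ) *
        (ζ * Complex.cosh ζ * (starRingEnd ℂ) (Complex.sinh ζ)) := by
      rw [sinhc_of_ne hz, div_div_eq_mul_div, div_eq_mul_inv, Complex.inv_def]
      ring
    rw [h3, Complex.re_ofReal_mul, re_mul_cosh_mul_conj_sinh]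
    have := Complex.normSq_nonneg (Complex.sinh ζ)
    positivity
  rw [profile, norm_mul, norm_div, norm_pow, norm_pow, inv_pow, div_eq_mul_inv]
  gcongr
  refine mul_le_of_le_one_left (by positivity) ?_
  rw [Complex.norm_exp, Real.exp_le_one_iff, Complex.neg_re, Complex.re_ofReal_mul]
  have := mul_nonneg hR hre'
  linarith

lemma cosh_le_exp_abs (x : ℝ) : Real.cosh x ≤ Real.exp |x| := by
  rw [← Real.cosh_abs, Real.cosh_eq]
  have : Real.exp (-|x|) ≤ Real.exp |x| := Real.exp_le_exp.2 (by linarith [abs_nonneg x])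
  linarith

lemma exp_abs_le_two_mul_cosh (x : ℝ) : Real.exp |x| ≤ 2 * Real.cosh x := by
  rw [← Real.cosh_abs, Real.cosh_eq]
  linarith [Real.exp_pos (-|x|)]

lemma exp_abs_le_four_mul_abs_sinh {x : ℝ} (hx : 2 ≤ |x|) : Real.exp |x| ≤ 4 * |Real.sinh x| := by
  rw [Real.abs_sinh, Real.sinh_eq]
  have h1 : Real.exp (-|x|) ≤ 1 := Real.exp_le_one_iff.2 (by linarith)
  have h2 := Real.add_one_le_exp |x|
  linarith

lemma exists_norm_profile_le_exp {n : ℕ} (hn : 1 ≤ n) (k : ℕ) :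
    ∃ C : ℝ, 0 < C ∧ ∀ R x y : ℝ, 0 ≤ R → 0 ≤ y → y ≤ 3 * π / 2 →
      Real.exp |x| / 4 ≤ ‖Complex.sinh (x + y * Complex.I)‖ →
      0 ≤ x * (Real.sinh x * Real.cosh x) + y * (Real.sin y * Real.cos y) →
      ‖profile R (n + k) k (x + y * Complex.I)‖ ≤ C * Real.exp (-(3 / 4 * |x|)) := by
  obtain ⟨C, hC, h⟩ := pow_le_mul_exp (n + k) (β := 1 / 4) (by norm_num)
  refine ⟨20 ^ (n + k) * C, by positivity, fun R x y hR hy0 hy1 hs hre => ?_⟩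
  have hπ := Real.pi_lt_d2
  have hs0 : 0 < ‖Complex.sinh (x + y * Complex.I)‖ := lt_of_lt_of_le (by positivity) hs
  have hne : (x + y * Complex.I : ℂ) ≠ π * Complex.I := fun he => by
    rw [he, Complex.sinh_mul_I, Complex.sin_pi] at hs0; simp at hs0
  have h0 : (x + y * Complex.I : ℂ) ≠ 0 := fun he => by
    rw [he] at hs0; simp at hs0
  refine (norm_profile_le hR (n + k) k hy0 (by linarith [Real.pi_pos]) hne hre).trans ?_
  have hζ : ‖(x + y * Complex.I : ℂ)‖ ≤ 5 * (1 + |x|) := by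
    refine (norm_add_le _ _).trans ?_
    rw [norm_mul, Complex.norm_I, Complex.norm_real, Complex.norm_real, Real.norm_eq_abs,
      Real.norm_eq_abs, abs_of_nonneg hy0]
    have := abs_nonneg x
    linarith
  have h1 : ‖sinhc (x + y * Complex.I)‖⁻¹ ≤ 20 * (1 + |x|) / Real.exp |x| := by
    rw [sinhc_of_ne h0, norm_div, inv_div]
    calc _ ≤ 5 * (1 + |x|) / (Real.exp |x| / 4) := by gcongr
      _ = _ := by field_simp; norm_num
  have h2 : ‖Complex.cosh (x + y * Complex.I)‖ ≤ Real.exp |x| := by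
    refine le_trans ?_ (cosh_le_exp_abs x)
    refine le_of_sq_le_sq ?_ (Real.cosh_pos x).le
    rw [norm_cosh_sq, Real.cosh_sq]
    linarith [Real.cos_sq_le_one y]
  calc _ ≤ (20 * (1 + |x|) / Real.exp |x|) ^ (n + k) * Real.exp |x| ^ k := by gcongr
    _ = 20 ^ (n + k) * (1 + |x|) ^ (n + k) * (Real.exp |x| ^ n)⁻¹ := by
      rw [div_pow, mul_pow, pow_add (Real.exp |x|)]
      field_simp
    _ ≤ 20 ^ (n + k) * (C * Real.exp (1 / 4 * |x|)) * (Real.exp |x| ^ 1)⁻¹ := by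
      gcongr
      · exact h _ (abs_nonneg x)
      · exact Real.one_le_exp (abs_nonneg x)
    _ = _ := by
      rw [pow_one, ← Real.exp_neg, mul_assoc, mul_assoc, mul_assoc, ← Real.exp_add]
      congr 4
      ring

lemma exists_norm_profile_le_of_two_le {n : ℕ} (hn : 1 ≤ n) (k : ℕ) :
    ∃ C : ℝ, 0 < C ∧ ∀ R x y : ℝ, 0 ≤ R → 2 ≤ |x| → 0 ≤ y → y ≤ 3 * π / 2 →
      ‖profile R (n + k) k (x + y * Complex.I)‖ ≤ C * Real.exp (-(3 / 4 * |x|)) := by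
  obtain ⟨C, hC, h⟩ := exists_norm_profile_le_exp hn k
  refine ⟨C, hC, fun R x y hR hx hy0 hy1 => h R x y hR hy0 hy1 ?_ ?_⟩
  · have h1 := exp_abs_le_four_mul_abs_sinh hx
    have h2 : |Real.sinh x| ≤ ‖Complex.sinh (x + y * Complex.I)‖ := by
      refine le_of_sq_le_sq ?_ (norm_nonneg _)
      rw [norm_sinh_sq, sq_abs]
      linarith [sq_nonneg (Real.sin y)]
    linarith
  · have h1 : x * Real.sinh x = |x| * |Real.sinh x| := by
      rw [← abs_mul, abs_of_nonneg]
      rcases le_total 0 x with hx | hx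
      · exact mul_nonneg hx (Real.sinh_nonneg_iff.2 hx)
      · exact mul_nonneg_of_nonpos_of_nonpos hx (Real.sinh_nonpos_iff.2 hx)
    have h2 : |x| ≤ |Real.sinh x| := by
      rw [Real.abs_sinh]
      exact Real.self_le_sinh_iff.2 (abs_nonneg x)
    have h3 : -(1 / 2) ≤ Real.sin y * Real.cos y := by
      nlinarith [sq_nonneg (Real.sin y + Real.cos y), Real.sin_sq_add_cos_sq y]
    have hπ := Real.pi_lt_d2
    rw [← mul_assoc, h1]
    have h4 : 4 ≤ |x| * |Real.sinh x| := by nlinarith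
    nlinarith [Real.one_le_cosh x]

lemma exists_norm_profile_line_le {n : ℕ} (hn : 1 ≤ n) (k : ℕ) :
    ∃ C : ℝ, 0 < C ∧ ∀ R x : ℝ, 0 ≤ R →
      ‖profile R (n + k) k (x + (3 * π / 2 : ℝ) * Complex.I)‖ ≤ C * Real.exp (-(3 / 4 * |x|)) := by
  obtain ⟨C, hC, h⟩ := exists_norm_profile_le_exp hn k
  have e1 : Real.sin (3 * π / 2) = -1 := by
    rw [show 3 * π / 2 = π / 2 + π by ring, Real.sin_add_pi, Real.sin_pi_div_two]
  have e2 : Real.cos (3 * π / 2) = 0 := by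
    rw [show 3 * π / 2 = π / 2 + π by ring, Real.cos_add_pi, Real.cos_pi_div_two, neg_zero]
  refine ⟨C, hC, fun R x hR => h R x _ hR (by positivity) le_rfl ?_ ?_⟩
  · have h1 := exp_abs_le_two_mul_cosh x
    have h2 : ‖Complex.sinh (x + (3 * π / 2 : ℝ) * Complex.I)‖ = Real.cosh x := by
      rw [← sq_eq_sq₀ (norm_nonneg _) (Real.cosh_pos x).le, norm_sinh_sq, e1, Real.cosh_sq]
      norm_num
    rw [h2]
    linarith [Real.cosh_pos x]
  · rw [e1, e2]
    have : 0 ≤ x * Real.sinh x := by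
      rcases le_total 0 x with hx | hx
      · exact mul_nonneg hx (Real.sinh_nonneg_iff.2 hx)
      · exact mul_nonneg_of_nonpos_of_nonpos hx (Real.sinh_nonpos_iff.2 hx)
    have := Real.cosh_pos x
    rw [← mul_assoc]
    simp only [mul_zero, add_zero]
    positivity

lemma continuous_profile_line (R : ℝ) (N k : ℕ) {y : ℝ} (h0 : 0 ≤ y) (h1 : y < 2 * π) (h : y ≠ π) :
    Continuous fun x : ℝ => profile R N k (x + y * Complex.I) := by
  refine continuous_iff_continuousAt.2 fun x => ?_
  have hne : (x + y * Complex.I : ℂ) ≠ π * Complex.I := fun he => h (by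
    have := congrArg Complex.im he; simpa using this)
  exact ContinuousAt.comp (f := fun x : ℝ => (x + y * Complex.I : ℂ))
    (differentiableAt_profile R N k (sinhc_ne_zero h0 h1 hne)).continuousAt
    (by fun_prop)

lemma exists_norm_profile_real_le {n : ℕ} (hn : 1 ≤ n) (k : ℕ) {R : ℝ} (hR : 0 ≤ R) :
    ∃ C : ℝ, 0 < C ∧ ∀ x : ℝ, ‖profile R (n + k) k x‖ ≤ C * Real.exp (-(3 / 4 * |x|)) := by
  obtain ⟨C, hC, h⟩ := exists_norm_profile_le_of_two_le hn k
  have hc := continuous_profile_line R (n + k) k (y := 0) le_rfl Real.two_pi_pos Real.pi_ne_zero.symm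
  obtain ⟨C', h'⟩ := isCompact_Icc.exists_bound_of_continuousOn (s := Set.Icc (-2 : ℝ) 2) hc.continuousOn
  refine ⟨C + |C'| * Real.exp (3 / 4 * 2), by positivity, fun x => ?_⟩
  rcases le_total 2 |x| with hx | hx
  · have := h R x 0 hR hx le_rfl (by positivity)
    simp only [Complex.ofReal_zero, zero_mul, add_zero] at this
    refine this.trans ?_
    gcongr
    exact le_add_of_nonneg_right (by positivity)
  · have := h' x (abs_le.1 hx)
    simp only [Complex.ofReal_zero, zero_mul, add_zero] at this
    rw [add_mul, mul_assoc, ← Real.exp_add]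
    have h1 : 1 ≤ Real.exp (3 / 4 * 2 + -(3 / 4 * |x|)) := Real.one_le_exp (by linarith)
    have h2 : 0 ≤ C * Real.exp (-(3 / 4 * |x|)) := by positivity
    nlinarith [le_abs_self C', abs_nonneg C']

lemma norm_cexp_I_mul_mul_le {u x y : ℝ} (hu : 0 ≤ u) (hy : 0 ≤ y) :
    ‖Complex.exp (Complex.I * (x + y * Complex.I) * u)‖ ≤ 1 := by
  rw [Complex.norm_exp, Real.exp_le_one_iff]
  simp
  positivity

lemma integral_profile_eq {n : ℕ} (hn : 1 ≤ n) (k : ℕ) {R : ℝ} (hR : 0 ≤ R) {h : ℝ} (hh : 0 < h)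
    (hp : 4 * h ≤ π / 2) {u : ℝ} (hu : 0 ≤ u) :
    ∫ r : ℝ, profile R (n + k) k r * Complex.exp (Complex.I * r * u) =
      (∫ x : ℝ, profile R (n + k) k (x + (3 * π / 2 : ℝ) * Complex.I) *
        Complex.exp (-(u * ((3 * π / 2 : ℝ) - Complex.I * x)))) +
      ∫ α in (-π)..π, (√2 * h * Complex.exp (α * Complex.I)) *
        profile R (n + k) k (π * Complex.I + -Complex.I * (√2 * h * Complex.exp (α * Complex.I))) *
        Complex.exp (-(u * (π - √2 * h * Complex.exp (α * Complex.I)))) := by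
  have hπ := Real.pi_pos
  set g : ℂ → ℂ := fun ζ => profile R (n + k) k ζ * Complex.exp (Complex.I * ζ * u) with hg
  obtain ⟨C₀, hC₀, hb0⟩ := exists_norm_profile_real_le hn k hR
  obtain ⟨C₁, hC₁, hb1⟩ := exists_norm_profile_line_le hn k
  obtain ⟨C₂, hC₂, hb2⟩ := exists_norm_profile_le_of_two_le hn k
  have hexp := integrable_exp_neg_mul_abs (b := 3 / 4) (by norm_num)
  have key := integral_eq_integral_add_circle (g := g) (p := π) (H := 3 * π / 2) hh (by linarith)
    (by linarith) (fun z h0 h1 hz => ?_) ?_ ?_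
    (B := fun x => C₂ * Real.exp (-(3 / 4 * x))) (T₀ := 2) ?_ (fun x y hx h0 h1 => ?_)
  · rw [hg] at key
    simp only at key
    rw [key]
    congr 1
    · congr 1; ext x
      congr 2
      push_cast
      linear_combination (3 * π / 2 * u : ℂ) * Complex.I_mul_I
    · congr 1; ext α
      rw [← mul_assoc _ (profile _ _ _ _)]
      congr 2
      linear_combination (π * u - √2 * h * Complex.exp (α * Complex.I) * u : ℂ) * Complex.I_mul_I
  · have hz' : (z.re + z.im * Complex.I : ℂ) = z := Complex.re_add_im z
    have := sinhc_ne_zero (x := z.re) h0 (by linarith) (by rwa [hz'])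
    rw [hz'] at this
    exact (differentiableAt_profile R (n + k) k this).mul (by fun_prop)
  · have hc := continuous_profile_line R (n + k) k (y := 0) le_rfl Real.two_pi_pos hπ.ne
    simp only [Complex.ofReal_zero, zero_mul, add_zero] at hc
    refine (hexp.const_mul C₀).mono' (hc.mul (by fun_prop)).aestronglyMeasurable
      (Filter.Eventually.of_forall fun x => ?_)
    have h1 := norm_cexp_I_mul_mul_le (x := x) hu (le_refl 0)
    simp only [Complex.ofReal_zero, zero_mul, add_zero] at h1
    rw [hg]
    simp only
    rw [norm_mul]
    exact (mul_le_of_le_one_right (norm_nonneg _) h1).trans (hb0 x)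
  · have hc := continuous_profile_line R (n + k) k (y := 3 * π / 2) (by positivity) (by linarith)
      (by linarith)
    refine (hexp.const_mul C₁).mono' (hc.mul (by fun_prop)).aestronglyMeasurable
      (Filter.Eventually.of_forall fun x => ?_)
    rw [hg]
    simp only
    rw [norm_mul]
    exact (mul_le_of_le_one_right (norm_nonneg _)
      (norm_cexp_I_mul_mul_le hu (by positivity))).trans (hb1 R x hR)
  · have h1 : Filter.Tendsto (fun x : ℝ => Real.exp (-(3 / 4 * x))) Filter.atTop (nhds 0) :=
      Real.tendsto_exp_atBot.comp (Filter.tendsto_neg_atTop_atBot.comp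
        (Filter.tendsto_id.const_mul_atTop (by norm_num)))
    simpa using h1.const_mul C₂
  · rw [hg]
    simp only
    rw [norm_mul]
    exact (mul_le_of_le_one_right (norm_nonneg _)
      (norm_cexp_I_mul_mul_le hu h0)).trans (hb2 R x y hR hx h0 h1)

/-- The contribution of the horizontal line `Im ζ = 3π/2`. -/
noncomputable def lineInt (R : ℝ) (N k d j : ℕ) (s : ℝ) : ℂ :=
  ∫ x : ℝ, profile R N k (x + (3 * π / 2 : ℝ) * Complex.I) *
    innerInt d j s ((3 * π / 2 : ℝ) - Complex.I * x)

/-- The contribution of the circle of radius `w₀` around the pole `iπ`. -/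
noncomputable def circleInt (R : ℝ) (N k d j : ℕ) (s w₀ : ℝ) : ℂ :=
  ∫ α in (-π)..π, (w₀ * Complex.exp (α * Complex.I)) *
    profile R N k (π * Complex.I + -Complex.I * (w₀ * Complex.exp (α * Complex.I))) *
    innerInt d j s (π - w₀ * Complex.exp (α * Complex.I))

lemma norm_line_le (x : ℝ) : ‖((3 * π / 2 : ℝ) - Complex.I * x : ℂ)‖ ≤ 5 + |x| := by
  refine (norm_sub_le _ _).trans ?_
  rw [norm_mul, Complex.norm_I, Complex.norm_real, Complex.norm_real, Real.norm_eq_abs,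
    Real.norm_eq_abs, abs_of_pos (by positivity)]
  linarith [Real.pi_lt_d2]

lemma re_line (x : ℝ) : ((3 * π / 2 : ℝ) - Complex.I * x : ℂ).re = 3 * π / 2 := by
  simp

lemma norm_lineInt_le {n : ℕ} (hn : 1 ≤ n) (k d j : ℕ) :
    ∃ C : ℝ, 0 < C ∧ ∀ R s : ℝ, 0 ≤ R → 1 / 4 ≤ s →
      ‖lineInt R (n + k) k d j s‖ ≤ C * Real.exp (-(3 * π / 2 * s)) := by
  obtain ⟨C₁, hC₁, hb1⟩ := exists_norm_profile_line_le hn k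
  obtain ⟨C₂, hC₂, hb2⟩ := norm_innerInt_le d j (β := 1 / 4) (c := 3 * π / 2) (by norm_num)
    (by positivity)
  have hexp := integrable_exp_neg_mul_abs (b := 1 / 4) (by norm_num)
  set J := ∫ x : ℝ, Real.exp (-(1 / 4 * |x|)) with hJ
  have hJ0 : 0 ≤ J := integral_nonneg fun x => (Real.exp_pos _).le
  refine ⟨C₁ * C₂ * Real.exp (5 / 2 + 3 * π / 8) * (J + 1), by positivity, fun R s hR hs => ?_⟩
  refine (norm_integral_le_of_norm_le (hexp.const_mul (C₁ * C₂ * Real.exp (5 / 2 + 3 * π / 8) *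
    Real.exp (-(3 * π / 2 * s)))) (Filter.Eventually.of_forall fun x => ?_)).trans ?_
  · rw [norm_mul]
    calc _ ≤ (C₁ * Real.exp (-(3 / 4 * |x|))) * (C₂ * Real.exp (-((s - 1 / 4) * (3 * π / 2))) *
          Real.exp (2 * (1 / 4) * (5 + |x|))) := by
          gcongr
          · exact hb1 R x hR
          · refine (hb2 _ s (re_line x).ge hs).trans ?_
            gcongr
            exact norm_line_le x
      _ = C₁ * C₂ * (Real.exp (-(3 / 4 * |x|)) * (Real.exp (-((s - 1 / 4) * (3 * π / 2))) *
          Real.exp (2 * (1 / 4) * (5 + |x|)))) := by ring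
      _ = C₁ * C₂ * (Real.exp (5 / 2 + 3 * π / 8) * (Real.exp (-(3 * π / 2 * s)) *
          Real.exp (-(1 / 4 * |x|)))) := by
        simp only [← Real.exp_add]
        congr 2
        ring
      _ = _ := by ring
  · rw [integral_const_mul, ← hJ]
    have : 0 ≤ C₁ * C₂ * Real.exp (5 / 2 + 3 * π / 8) * Real.exp (-(3 * π / 2 * s)) := by positivity
    nlinarith

lemma norm_circle_mk {w₀ : ℝ} (hw : 0 < w₀) (α : ℝ) :
    ‖(w₀ * Complex.exp (α * Complex.I) : ℂ)‖ = w₀ := by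
  rw [norm_mul, Complex.norm_exp_ofReal_mul_I, mul_one, Complex.norm_real, Real.norm_of_nonneg hw.le]

lemma continuous_circle_profile (R : ℝ) (N k : ℕ) {w₀ : ℝ} (hw : 0 < w₀) (hw1 : w₀ ≤ 1 / 4) :
    Continuous fun α : ℝ => (w₀ * Complex.exp (α * Complex.I)) *
      profile R N k (π * Complex.I + -Complex.I * (w₀ * Complex.exp (α * Complex.I))) := by
  have hπ3 := Real.pi_gt_three
  refine Continuous.mul (by fun_prop) (continuous_iff_continuousAt.2 fun α => ?_)
  set w : ℂ := w₀ * Complex.exp (α * Complex.I) with hwdef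
  set ζ : ℂ := π * Complex.I + -Complex.I * w with hζ
  have him : ζ.im = π - w.re := by simp [hζ]; ring
  have hre : |w.re| ≤ w₀ := (Complex.abs_re_le_norm w).trans (norm_circle_mk hw α).le
  have hre' := abs_le.1 hre
  have hne : ζ ≠ π * Complex.I := fun he => by
    have : w = 0 := by
      have h1 : -Complex.I * w = 0 := by
        rw [hζ] at he; exact add_eq_left.1 he
      simpa using h1
    have h2 := norm_circle_mk hw α
    rw [← hwdef, this, norm_zero] at h2
    linarith
  have h3 := sinhc_ne_zero (x := ζ.re) (y := ζ.im) (by rw [him]; linarith) (by rw [him]; linarith)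
    (by rwa [Complex.re_add_im])
  rw [Complex.re_add_im] at h3
  exact ContinuousAt.comp (f := fun α : ℝ => (π * Complex.I + -Complex.I *
    (w₀ * Complex.exp (α * Complex.I)) : ℂ)) (differentiableAt_profile R N k h3).continuousAt
    (by fun_prop)

lemma intervalIntegrable_circle (R : ℝ) (N k d j : ℕ) {w₀ : ℝ} (hw : 0 < w₀) (hw1 : w₀ ≤ 1 / 4)
    {s : ℝ} (hs : 1 / 4 ≤ s) :
    IntervalIntegrable (fun α : ℝ => (w₀ * Complex.exp (α * Complex.I)) *
      profile R N k (π * Complex.I + -Complex.I * (w₀ * Complex.exp (α * Complex.I))) *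
      innerInt d j s (π - w₀ * Complex.exp (α * Complex.I))) volume (-π) π := by
  have hcirc := continuous_circle_profile R N k hw hw1
  rw [intervalIntegrable_iff_integrableOn_Ioc_of_le (by linarith [Real.pi_pos])]
  refine integrable_mul_innerInt (m := (volume : Measure ℝ).restrict (Set.Ioc (-π) π))
    (c := 1) (β := 1 / 4) (z := fun α : ℝ => π - w₀ * Complex.exp (α * Complex.I))
    hcirc.aestronglyMeasurable (Continuous.measurable (by fun_prop)) one_pos (fun α => ?_)
    (by norm_num) ?_ d j hs
  · have h2 := abs_le.1 ((Complex.abs_re_le_norm _).trans (norm_circle_mk hw α).le)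
    rw [Complex.sub_re, Complex.ofReal_re]
    linarith [Real.pi_gt_three]
  · exact (Continuous.integrableOn_Icc (by fun_prop)).mono_set Set.Ioc_subset_Icc_self

lemma integral_profile_radial {n : ℕ} (hn : 1 ≤ n) (k d j : ℕ) {R : ℝ} (hR : 0 ≤ R) {w₀ : ℝ}
    (hw : 0 < w₀) (hw1 : w₀ ≤ 1 / 4) {s : ℝ} (hs : 1 / 4 < s) :
    ∫ lam : EuclideanSpace ℝ (Fin (d + 1)),
        profile R (n + k) k ‖lam‖ * (lam 0 : ℂ) ^ j * Complex.exp (Complex.I * lam 0 * s) =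
      lineInt R (n + k) k d j s + circleInt R (n + k) k d j s w₀ := by
  have hπ := Real.pi_pos
  have hπ3 := Real.pi_gt_three
  obtain ⟨C₀, hC₀, hb0⟩ := exists_norm_profile_real_le hn k hR
  obtain ⟨C₁, hC₁, hb1⟩ := exists_norm_profile_line_le hn k
  have hc := continuous_profile_line R (n + k) k (y := 0) le_rfl Real.two_pi_pos hπ.ne
  simp only [Complex.ofReal_zero, zero_mul, add_zero] at hc
  have hcl := continuous_profile_line R (n + k) k (y := 3 * π / 2) (by positivity) (by linarith)
      (by linarith)
  have hs2 : 1 ≤ √2 := Real.one_le_sqrt.2 (by norm_num)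
  have hw2 : √2 * (w₀ / √2) = w₀ := by field_simp
  have hnw := norm_circle_mk hw
  have hcirc := continuous_circle_profile R (n + k) k hw hw1
  have key := integral_radial_add (f := fun r : ℝ => profile R (n + k) k r) hc
    (fun r => by rw [Complex.ofReal_neg, profile_neg]) (C := C₀) (b := 3 / 4) (by norm_num)
    (fun r hr => by have := hb0 r; rwa [abs_of_nonneg hr] at this)
    (m := (volume : Measure ℝ)) (m' := (volume : Measure ℝ).restrict (Set.Ioc (-π) π))
    (a := fun x : ℝ => profile R (n + k) k (x + (3 * π / 2 : ℝ) * Complex.I))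
    (z := fun x : ℝ => (3 * π / 2 : ℝ) - Complex.I * x)
    (a' := fun α : ℝ => (w₀ * Complex.exp (α * Complex.I)) *
      profile R (n + k) k (π * Complex.I + -Complex.I * (w₀ * Complex.exp (α * Complex.I))))
    (z' := fun α : ℝ => π - w₀ * Complex.exp (α * Complex.I))
    (c := 1) (β := 1 / 4) one_pos (by norm_num) hcl.measurable
    (Continuous.measurable (by fun_prop)) (fun x => by rw [re_line]; linarith) ?_
    hcirc.measurable (Continuous.measurable (by fun_prop)) (fun α => ?_) ?_ (fun u hu => ?_) d j hs
  · rw [key, lineInt, circleInt, intervalIntegral.integral_of_le (by linarith)]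
  · refine ((integrable_exp_neg_mul_abs (b := 1 / 4) (by norm_num)).const_mul
      (C₁ * Real.exp (5 / 2))).mono' (Continuous.aestronglyMeasurable (by fun_prop))
      (Filter.Eventually.of_forall fun x => ?_)
    rw [norm_mul, norm_norm, Real.norm_of_nonneg (Real.exp_pos _).le]
    calc _ ≤ (C₁ * Real.exp (-(3 / 4 * |x|))) * Real.exp (2 * (1 / 4) * (5 + |x|)) := by
          gcongr
          · exact hb1 R x hR
          · exact norm_line_le x
      _ = _ := by
        rw [mul_assoc C₁, mul_assoc C₁, ← Real.exp_add, ← Real.exp_add]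
        congr 2
        ring
  · have h1 := (Complex.abs_re_le_norm _).trans (hnw α).le
    have h2 := abs_le.1 h1
    rw [Complex.sub_re, Complex.ofReal_re]
    linarith
  · exact (Continuous.integrableOn_Icc (by fun_prop)).mono_set Set.Ioc_subset_Icc_self
  · have := integral_profile_eq hn k hR (h := w₀ / √2) (by positivity) (by
      have : w₀ / √2 ≤ w₀ := div_le_self hw.le hs2
      linarith) hu
    rw [this, intervalIntegral.integral_of_le (by linarith)]
    have hw3 : (√2 * (w₀ / √2 : ℝ) : ℂ) = w₀ := by rw [← Complex.ofReal_mul, hw2]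
    simp only [hw3]

lemma pT_integrand_eq (n k₁ k₂ d : ℕ) (R s : ℝ) (lam : EuclideanSpace ℝ (Fin (d + 1))) :
    (if lam = 0 then (if k₂ = 0 then Complex.exp (-(R : ℂ)) else 0)
      else Complex.exp (Complex.I * s * lam 0 -
          ((R * ‖lam‖ * Real.cosh ‖lam‖ / Real.sinh ‖lam‖ : ℝ) : ℂ)) *
        ((‖lam‖ : ℂ) ^ (n + k₁) * ((Real.cosh ‖lam‖ : ℝ) : ℂ) ^ k₁ /
          ((Real.sinh ‖lam‖ : ℝ) : ℂ) ^ (n + k₁)) * (lam 0 : ℂ) ^ k₂) =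
      profile R (n + k₁) k₁ ‖lam‖ * (lam 0 : ℂ) ^ k₂ * Complex.exp (Complex.I * lam 0 * s) := by
  split_ifs with h h'
  · simp [h, h', profile, sinhc_zero]
  · simp [h, h']
  · have h0 : (‖lam‖ : ℂ) ≠ 0 := by simpa using h
    have e : Complex.I * s * lam 0 - ((R * ‖lam‖ * Real.cosh ‖lam‖ / Real.sinh ‖lam‖ : ℝ) : ℂ) =
        -(R * (Complex.cosh ‖lam‖ / (Complex.sinh ‖lam‖ / ‖lam‖))) + Complex.I * lam 0 * s := by
      push_cast
      rw [div_div_eq_mul_div]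
      ring
    rw [e, Complex.exp_add, profile, sinhc_of_ne h0, div_pow, div_div_eq_mul_div,
      Complex.ofReal_sinh, Complex.ofReal_cosh]
    simp only [div_eq_mul_inv, mul_inv, inv_inv]
    ring

lemma pT_eq {n k₁ k₂ d : ℕ} (hn : 1 ≤ n) (hm : 0 < d + 1)
    (x : EuclideanSpace ℝ (Fin (2 * n))) (t : EuclideanSpace ℝ (Fin (d + 1))) {w₀ : ℝ}
    (hw : 0 < w₀) (hw1 : w₀ ≤ 1 / 4) (hs : 1 / 4 < ‖t‖) :
    pT n (d + 1) k₁ k₂ hm x t =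
      (-1 : ℂ) ^ k₁ * Complex.I ^ k₂ / ((4 * (π : ℂ)) ^ n * (2 * (π : ℂ)) ^ (d + 1)) *
        (lineInt (‖x‖ ^ 2 / 4) (n + k₁) k₁ d k₂ ‖t‖ +
          circleInt (‖x‖ ^ 2 / 4) (n + k₁) k₁ d k₂ ‖t‖ w₀) := by
  rw [pT, ← integral_profile_radial hn k₁ d k₂ (by positivity) hw hw1 hs]
  congr 1
  refine integral_congr_ae (Filter.Eventually.of_forall fun lam => ?_)
  exact pT_integrand_eq n k₁ k₂ d (‖x‖ ^ 2 / 4) ‖t‖ lam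

lemma norm_cexp_sub_cexp_le {a b : ℂ} {M : ℝ} (ha : a.re ≤ M) (hb : b.re ≤ M) :
    ‖Complex.exp a - Complex.exp b‖ ≤ Real.exp M * ‖a - b‖ := by
  refine (convex_halfSpace_re_le M).norm_image_sub_le_of_norm_hasDerivWithin_le
    (f := Complex.exp) (f' := Complex.exp)
    (fun z _ => (Complex.hasDerivAt_exp z).hasDerivWithinAt) (fun z hz => ?_) hb ha
  rw [Complex.norm_exp]
  exact Real.exp_le_exp.2 hz

lemma norm_pow_sub_pow_le_mul {a b : ℂ} {M : ℝ} (hM : 1 ≤ M) (ha : ‖a‖ ≤ M) (hb : ‖b‖ ≤ M) (k : ℕ) :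
    ‖a ^ k - b ^ k‖ ≤ k * M ^ k * ‖a - b‖ := by
  induction k with
  | zero => simp
  | succ k ih =>
    have e : a ^ (k + 1) - b ^ (k + 1) = a * (a ^ k - b ^ k) + (a - b) * b ^ k := by ring
    have hb' : ‖b‖ ^ k ≤ M ^ (k + 1) :=
      (pow_le_pow_left₀ (norm_nonneg _) hb k).trans (pow_le_pow_right₀ hM k.le_succ)
    rw [e]
    refine (norm_add_le _ _).trans ?_
    rw [norm_mul, norm_mul, norm_pow]
    push_cast
    calc _ ≤ M * (k * M ^ k * ‖a - b‖) + ‖a - b‖ * M ^ (k + 1) := by gcongr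
      _ = _ := by ring

/-- Basic estimates for `√((π - w)² + ρ²)` with `w` small. -/
lemma nuRoot_pi_sub {w : ℂ} (hw : ‖w‖ ≤ 1 / 4) {ρ : ℝ} (hρ : 0 ≤ ρ) :
    2 ≤ (nuRoot (π - w) ρ).re ∧ 4 + ρ / 2 ≤ (nuRoot (π - w) ρ + (π - w)).re ∧
      ‖nuRoot (π - w) ρ + (π - w)‖ ≤ 2 * (4 + ρ / 2) ∧ ‖nuRoot (π - w) ρ‖ ≤ 4 + ρ ∧
      ‖nuRoot (π - w) ρ - (π - w)‖ ≤ ρ ^ 2 := by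
  have hπ := Real.pi_gt_d2
  have hπ' := Real.pi_lt_d2
  have h1 := Complex.abs_re_le_norm w
  have h2 := Complex.abs_im_le_norm w
  rw [abs_le] at h1
  have e1 : ((π : ℂ) - w).re = π - w.re := by simp
  have e2 : ((π : ℂ) - w).im = -w.im := by simp
  have hμ : 2.88 ≤ ((π : ℂ) - w).re := by rw [e1]; linarith
  have hμn : ‖(π : ℂ) - w‖ ≤ 3.5 := by
    refine (norm_sub_le _ _).trans ?_
    rw [Complex.norm_real, Real.norm_of_nonneg Real.pi_pos.le]; linarith
  have hν1 := re_le_nuRoot_re (by linarith : 0 < ((π : ℂ) - w).re) ρ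
  have hν2 := sub_le_nuRoot_re ((π : ℂ) - w) ρ
  have hν3 := norm_nuRoot_le ((π : ℂ) - w) hρ
  have hν4 := nuRoot_sq ((π : ℂ) - w) ρ
  rw [e2, abs_neg] at hν2
  set ν := nuRoot ((π : ℂ) - w) ρ
  set μ := (π : ℂ) - w
  have h5 : 4 + ρ / 2 ≤ (ν + μ).re := by rw [Complex.add_re]; linarith
  refine ⟨by linarith, h5, (norm_add_le _ _).trans (by linarith), by linarith, ?_⟩
  have e : (ν - μ) * (ν + μ) = (ρ : ℂ) ^ 2 := by linear_combination hν4
  have h6 := congrArg norm e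
  rw [norm_mul, norm_pow, Complex.norm_real, Real.norm_of_nonneg hρ] at h6
  have h7 : 1 ≤ ‖ν + μ‖ := by linarith [Complex.re_le_norm (ν + μ)]
  nlinarith [norm_nonneg (ν - μ)]

lemma half_sub_le_re_div {z : ℂ} {x ρ : ℝ} (hx : 0 ≤ x) (hρ : 0 ≤ ρ) (hρx : ρ ≤ x)
    (h1 : 4 + ρ / 2 ≤ z.re) (h2 : ‖z‖ ≤ 2 * (4 + ρ / 2)) :
    (x - 8) / 4 ≤ ((x : ℂ) ^ 2 / z).re := by
  have hz : 0 < ‖z‖ := by linarith [Complex.re_le_norm z]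
  have e : ((x : ℂ) ^ 2 / z).re = x ^ 2 * z.re / ‖z‖ ^ 2 := by
    rw [div_eq_mul_inv, ← Complex.ofReal_pow, Complex.re_ofReal_mul, Complex.inv_re,
      Complex.normSq_eq_norm_sq]
    ring
  rw [e, le_div_iff₀ (by positivity)]
  have h3 : ‖z‖ ^ 2 ≤ 2 * z.re * (8 + x) := by
    have : ‖z‖ ≤ 8 + x := by linarith
    nlinarith
  by_cases hx8 : x ≤ 8
  · have : 0 ≤ x ^ 2 * z.re := by have : 0 ≤ z.re := by linarith
                                  positivity
    nlinarith [sq_nonneg ‖z‖]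
  · push Not at hx8
    have h0 : 0 ≤ z.re := by linarith
    have : (x - 8) / 4 * ‖z‖ ^ 2 ≤ (x - 8) / 4 * (2 * z.re * (8 + x)) := by gcongr
    nlinarith

lemma exists_norm_kernel_sub_le (k : ℕ) : ∃ C : ℝ, 0 < C ∧ ∀ (w : ℂ) (s x : ℝ), ‖w‖ ≤ 1 / 4 →
    1 ≤ s → 0 ≤ x →
    ‖Complex.exp (s * (π - w)) * ((π - w) / nuRoot (π - w) (x / √s) *
        (Complex.I * nuRoot (π - w) (x / √s)) ^ k *
        Complex.exp (-(s * nuRoot (π - w) (x / √s)))) -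
      (Complex.I * π) ^ k * Complex.exp (-(x ^ 2 / (2 * π) : ℝ))‖ ≤
      C * (‖w‖ + 1 / s) * ((1 + x) ^ (k + 4) * Real.exp (-(1 / 4 * x))) := by
  have hπ := Real.pi_gt_d2
  have hπ' := Real.pi_lt_d2
  refine ⟨Real.exp 2 * (2 * 4 ^ k + (4 ^ k + k * 4 ^ k)), by positivity,
    fun w s x hw hs hx => ?_⟩
  have hs0 : 0 < s := by linarith
  have hsq : 1 ≤ √s := Real.one_le_sqrt.2 hs
  have hρ : 0 ≤ x / √s := by positivity
  have hρx : x / √s ≤ x := div_le_self hx hsq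
  have hρ2 : (x / √s) ^ 2 = x ^ 2 * (1 / s) := by
    rw [div_pow, Real.sq_sqrt hs0.le]; ring
  have hρs : (s : ℂ) * ((x / √s : ℝ) : ℂ) ^ 2 = (x : ℂ) ^ 2 := by
    rw [← Complex.ofReal_pow, hρ2]; push_cast
    have : (s : ℂ) ≠ 0 := by exact_mod_cast hs0.ne'
    field_simp
  obtain ⟨hν1, hν2, hν3, hν4, hν5⟩ := nuRoot_pi_sub hw hρ
  have hνsq := nuRoot_sq ((π : ℂ) - w) (x / √s)
  rw [hρ2] at hν5
  set ρ := x / √s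
  set ν := nuRoot ((π : ℂ) - w) ρ
  set ε := ‖w‖ + 1 / s with hε
  have hε0 : 0 ≤ ε := by positivity
  have hν0 : ν ≠ 0 := fun h => by rw [h] at hν1; norm_num at hν1
  have hνμ0 : ν + (π - w) ≠ 0 := fun h => by
    rw [h] at hν2; simp at hν2; linarith
  set q := (x : ℂ) ^ 2 / (ν + (π - w)) with hq
  have hqs : (s : ℂ) * (ν - (π - w)) = q := by
    rw [hq, eq_div_iff hνμ0, ← hρs]
    linear_combination (s : ℂ) * hνsq
  have hqre := half_sub_le_re_div hx hρ hρx hν2 hν3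
  have hgre : (x - 8) / 4 ≤ x ^ 2 / (2 * π) := by
    rw [le_div_iff₀ (by positivity)]
    by_cases hx8 : x ≤ 8
    · nlinarith [sq_nonneg x]
    · push Not at hx8
      nlinarith
  have hw1 : ‖w‖ ≤ ε := by rw [hε]; linarith [show 0 ≤ 1 / s by positivity]
  have hs1 : 1 / s ≤ ε := by rw [hε]; linarith [norm_nonneg w]
  have hX : 1 ≤ 1 + x := by linarith
  -- distance of `ν` to `π`
  have hνπ : ‖ν - π‖ ≤ (1 + x) ^ 2 * ε := by
    calc ‖ν - π‖ = ‖(ν - (π - w)) + (-w)‖ := by congr 1; ring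
      _ ≤ x ^ 2 * (1 / s) + ‖w‖ := by
        refine (norm_add_le _ _).trans ?_
        rw [norm_neg]; gcongr
      _ ≤ _ := by rw [hε]; nlinarith [norm_nonneg w, show 0 ≤ 1 / s by positivity]
  have hqq : ‖-q - -(((x ^ 2 / (2 * π) : ℝ)) : ℂ)‖ ≤ (1 + x) ^ 4 * ε := by
    have e : -q - -(((x ^ 2 / (2 * π) : ℝ)) : ℂ) =
        (x : ℂ) ^ 2 * ((ν - π) + -w) / (2 * π * (ν + (π - w))) := by
      have : (π : ℂ) ≠ 0 := by exact_mod_cast Real.pi_ne_zero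
      rw [hq]; push_cast; field_simp; ring
    have h1 : 2 ≤ ‖2 * (π : ℂ) * (ν + (π - w))‖ := by
      rw [norm_mul, norm_mul, Complex.norm_real, Real.norm_of_nonneg Real.pi_pos.le]
      have := Complex.re_le_norm (ν + (π - w))
      norm_num
      nlinarith
    rw [e, norm_div, norm_mul, norm_pow, Complex.norm_real, Real.norm_of_nonneg hx,
      div_le_iff₀ (by linarith)]
    have h2 : ‖ν - π + -w‖ ≤ (1 + x) ^ 2 * ε * 2 := by
      refine (norm_add_le _ _).trans ?_
      rw [norm_neg]
      nlinarith [show 1 ≤ (1 + x) ^ 2 by nlinarith]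
    calc x ^ 2 * ‖ν - π + -w‖ ≤ (1 + x) ^ 2 * ((1 + x) ^ 2 * ε * 2) := by gcongr; linarith
      _ = (1 + x) ^ 4 * ε * 2 := by ring
      _ ≤ _ := by gcongr
  have hExp : ‖Complex.exp (-q) - Complex.exp (-((x ^ 2 / (2 * π) : ℝ)))‖ ≤
      Real.exp 2 * Real.exp (-(1 / 4 * x)) * ((1 + x) ^ 4 * ε) := by
    refine (norm_cexp_sub_cexp_le (M := 2 + -(1 / 4 * x)) ?_ ?_).trans ?_
    · rw [Complex.neg_re]; linarith
    · rw [Complex.neg_re, Complex.ofReal_re]; linarith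
    · rw [Real.exp_add]; gcongr
  have hG : ‖Complex.exp (-((x ^ 2 / (2 * π) : ℝ)))‖ ≤ Real.exp 2 * Real.exp (-(1 / 4 * x)) := by
    rw [Complex.norm_exp, ← Real.exp_add, Complex.neg_re, Complex.ofReal_re]
    gcongr; linarith
  have hνn : ‖ν‖ ≤ 4 * (1 + x) := by linarith
  have hratio : ‖(π - w) / ν - 1‖ ≤ (1 + x) ^ 2 * ε := by
    have e : (π - w) / ν - 1 = -(ν - (π - w)) / ν := by field_simp; ring
    rw [e, norm_div, norm_neg, div_le_iff₀ (norm_pos_iff.2 hν0)]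
    have := Complex.re_le_norm ν
    calc _ ≤ x ^ 2 * (1 / s) := hν5
      _ ≤ (1 + x) ^ 2 * ε * 1 := by rw [mul_one]; gcongr; linarith
      _ ≤ _ := by gcongr; linarith
  have hB : ‖(π - w) / ν * (Complex.I * ν) ^ k - (Complex.I * π) ^ k‖ ≤
      (4 ^ k + k * 4 ^ k) * (1 + x) ^ (k + 2) * ε := by
    have e : (π - w) / ν * (Complex.I * ν) ^ k - (Complex.I * π) ^ k =
      ((π - w) / ν - 1) * (Complex.I * ν) ^ k + ((Complex.I * ν) ^ k - (Complex.I * π) ^ k) := by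
      ring
    have h1 := norm_pow_sub_pow_le_mul (a := Complex.I * ν) (b := Complex.I * π) (M := 4 * (1 + x))
      (by linarith) (by simpa using hνn)
      (by rw [norm_mul, Complex.norm_I, Complex.norm_real, Real.norm_of_nonneg Real.pi_pos.le]
          linarith) k
    rw [← mul_sub, norm_mul, Complex.norm_I, one_mul] at h1
    rw [e]
    refine (norm_add_le _ _).trans ?_
    rw [norm_mul, norm_pow, norm_mul, Complex.norm_I, one_mul]
    calc _ ≤ ((1 + x) ^ 2 * ε) * (4 * (1 + x)) ^ k +
          k * (4 * (1 + x)) ^ k * ((1 + x) ^ 2 * ε) := by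
            gcongr
            exact h1.trans (by gcongr)
      _ = _ := by rw [mul_pow, pow_add]; ring
  have hBn : ‖(π - w) / ν * (Complex.I * ν) ^ k‖ ≤ 2 * 4 ^ k * (1 + x) ^ k := by
    rw [norm_mul, norm_div, norm_pow, norm_mul, Complex.norm_I, one_mul]
    have h1 : ‖(π : ℂ) - w‖ ≤ 4 := by
      refine (norm_sub_le _ _).trans ?_
      rw [Complex.norm_real, Real.norm_of_nonneg Real.pi_pos.le]; linarith
    have h2 : ‖(π : ℂ) - w‖ / ‖ν‖ ≤ 2 := by
      rw [div_le_iff₀ (norm_pos_iff.2 hν0)]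
      linarith [Complex.re_le_norm ν]
    calc _ ≤ 2 * (4 * (1 + x)) ^ k := by gcongr
      _ = _ := by rw [mul_pow]; ring
  have e0 : Complex.exp (s * (π - w)) * ((π - w) / ν * (Complex.I * ν) ^ k *
      Complex.exp (-(s * ν))) - (Complex.I * π) ^ k * Complex.exp (-(x ^ 2 / (2 * π) : ℝ)) =
      (π - w) / ν * (Complex.I * ν) ^ k *
        (Complex.exp (-q) - Complex.exp (-((x ^ 2 / (2 * π) : ℝ)))) +
      ((π - w) / ν * (Complex.I * ν) ^ k - (Complex.I * π) ^ k) *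
        Complex.exp (-((x ^ 2 / (2 * π) : ℝ))) := by
    have : Complex.exp (-q) = Complex.exp (s * (π - w)) * Complex.exp (-(s * ν)) := by
      rw [← Complex.exp_add, ← hqs]; congr 1; ring
    rw [this]; ring
  rw [e0]
  refine (norm_add_le _ _).trans ?_
  rw [norm_mul, norm_mul _ (Complex.exp (-((x ^ 2 / (2 * π) : ℝ))))]
  calc _ ≤ 2 * 4 ^ k * (1 + x) ^ k * (Real.exp 2 * Real.exp (-(1 / 4 * x)) * ((1 + x) ^ 4 * ε)) +
        ((4 ^ k + k * 4 ^ k) * (1 + x) ^ (k + 2) * ε) *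
          (Real.exp 2 * Real.exp (-(1 / 4 * x))) := by gcongr
    _ ≤ 2 * 4 ^ k * (1 + x) ^ k * (Real.exp 2 * Real.exp (-(1 / 4 * x)) * ((1 + x) ^ 4 * ε)) +
        ((4 ^ k + k * 4 ^ k) * (1 + x) ^ (k + 4) * ε) *
          (Real.exp 2 * Real.exp (-(1 / 4 * x))) := by
      gcongr
      norm_num
    _ = _ := by ring

/-- Leading asymptotics of the integral over the remaining central directions. -/
lemma exists_norm_innerInt_sub_le (d k : ℕ) : ∃ C : ℝ, 0 < C ∧ ∀ (w : ℂ) (s : ℝ), ‖w‖ ≤ 1 / 4 →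
    1 ≤ s → ‖(√s : ℂ) ^ d * (Complex.exp (s * (π - w)) * innerInt d k s (π - w)) -
      (Complex.I * π) ^ k * ((√2 * π : ℝ) : ℂ) ^ d‖ ≤ C * (‖w‖ + 1 / s) := by
  obtain ⟨C, hC, h⟩ := exists_norm_kernel_sub_le k
  have hi := integrable_pow_mul_exp_neg_norm (E := EuclideanSpace ℝ (Fin d)) (k + 4)
    (β := 1 / 4) (by norm_num)
  set J := ∫ v : EuclideanSpace ℝ (Fin d), (1 + ‖v‖) ^ (k + 4) * Real.exp (-(1 / 4 * ‖v‖)) with hJ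
  have hJ0 : 0 ≤ J := integral_nonneg fun v => by positivity
  refine ⟨C * (J + 1), by positivity, fun w s hw hs => ?_⟩
  have hs0 : 0 < s := by linarith
  set F : EuclideanSpace ℝ (Fin d) → ℂ := fun v =>
    (π - w) / nuRoot (π - w) (‖v‖ / √s) * (Complex.I * nuRoot (π - w) (‖v‖ / √s)) ^ k *
        Complex.exp (-(s * nuRoot (π - w) (‖v‖ / √s))) with hF
  set G : EuclideanSpace ℝ (Fin d) → ℂ := fun v => Complex.exp (-(‖v‖ ^ 2 / (2 * π) : ℝ)) with hG
  have hFm : Measurable F := by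
    have hν : Measurable fun v : EuclideanSpace ℝ (Fin d) => nuRoot (π - w) (‖v‖ / √s) :=
      Measurable.nuRoot measurable_const (measurable_norm.div_const _)
    exact ((measurable_const.div hν).mul ((hν.const_mul _).pow_const _)).mul
      ((hν.const_mul _).neg.cexp)
  have hGr : ∀ v, G v = ((Real.exp (-(1 / (2 * π)) * ‖v‖ ^ 2) : ℝ) : ℂ) := by
    intro v
    rw [hG, Complex.ofReal_exp]
    push_cast
    congr 1; ring
  have hGint : ∫ v, G v = ((√2 * π : ℝ) : ℂ) ^ d := by
    simp_rw [hGr]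
    rw [integral_complex_ofReal, GaussianFourier.integral_rexp_neg_mul_sq_norm (by positivity),
      ← Complex.ofReal_pow, finrank_euclideanSpace_fin]
    congr 1
    have : π / (1 / (2 * π)) = (√2 * π) ^ (2 : ℝ) := by
      rw [Real.rpow_two, mul_pow, Real.sq_sqrt (by norm_num)]; field_simp
    rw [this, ← Real.rpow_mul (by positivity), ← Real.rpow_natCast]
    congr 1; ring
  have hGi : Integrable G := by
    simp_rw [show G = fun v => ((Real.exp (-(1 / (2 * π)) * ‖v‖ ^ 2) : ℝ) : ℂ) from funext hGr]
    refine Integrable.ofReal ?_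
    by_contra hn
    have h1 := GaussianFourier.integral_rexp_neg_mul_sq_norm (V := EuclideanSpace ℝ (Fin d))
      (b := 1 / (2 * π)) (by positivity)
    replace h1 := h1.symm.trans (integral_undef hn)
    have : 0 < (π / (1 / (2 * π))) ^
      ((Module.finrank ℝ (EuclideanSpace ℝ (Fin d)) : ℝ) / 2) := by positivity
    linarith
  have hle : ∀ v, ‖Complex.exp (s * (π - w)) * F v - (Complex.I * π) ^ k * G v‖ ≤
      C * (‖w‖ + 1 / s) * ((1 + ‖v‖) ^ (k + 4) * Real.exp (-(1 / 4 * ‖v‖))) := fun v =>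
    h w s ‖v‖ hw hs (norm_nonneg v)
  have hdi : Integrable fun v => Complex.exp (s * (π - w)) * F v - (Complex.I * π) ^ k * G v :=
    (hi.const_mul (C * (‖w‖ + 1 / s))).mono'
      ((hFm.const_mul _).aestronglyMeasurable.sub (hGi.aestronglyMeasurable.const_mul _))
      (Filter.Eventually.of_forall hle)
  have hsc : (√s : ℂ) ^ d * innerInt d k s (π - w) = ∫ v, F v := by
    have := Measure.integral_comp_inv_smul_of_nonneg (volume : Measure (EuclideanSpace ℝ (Fin d)))
      (fun v => (π - w) / nuRoot (π - w) ‖v‖ * (Complex.I * nuRoot (π - w) ‖v‖) ^ k *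
        Complex.exp (-(s * nuRoot (π - w) ‖v‖))) (Real.sqrt_nonneg s)
    rw [finrank_euclideanSpace_fin, Complex.real_smul] at this
    rw [innerInt, ← Complex.ofReal_pow, ← this]
    refine integral_congr_ae (Filter.Eventually.of_forall fun v => ?_)
    simp only [hF, norm_smul, norm_inv, Real.norm_of_nonneg (Real.sqrt_nonneg s)]
    rw [inv_mul_eq_div]
  have hval : (√s : ℂ) ^ d * (Complex.exp (s * (π - w)) * innerInt d k s (π - w)) -
      (Complex.I * π) ^ k * ((√2 * π : ℝ) : ℂ) ^ d =
      ∫ v, (Complex.exp (s * (π - w)) * F v - (Complex.I * π) ^ k * G v) := by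
    have h1 := integral_add hdi (hGi.const_mul ((Complex.I * π) ^ k))
    simp only [sub_add_cancel] at h1
    rw [integral_const_mul, integral_const_mul, hGint, ← hsc] at h1
    linear_combination h1
  rw [hval]
  refine (norm_integral_le_of_norm_le (hi.const_mul _) (Filter.Eventually.of_forall hle)).trans ?_
  rw [integral_const_mul, ← hJ]
  have : 0 ≤ C * (‖w‖ + 1 / s) := by positivity
  nlinarith

lemma exists_norm_image_sub_le {f : ℂ → ℂ} {r r' : ℝ} (hf : DifferentiableOn ℂ f (Metric.ball 0 r))
    (hr : r' < r) : ∃ C : ℝ, 0 < C ∧ ∀ a ∈ Metric.closedBall (0 : ℂ) r',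
      ∀ b ∈ Metric.closedBall (0 : ℂ) r', ‖f b - f a‖ ≤ C * ‖b - a‖ := by
  have hsub : Metric.closedBall (0 : ℂ) r' ⊆ Metric.ball 0 r := Metric.closedBall_subset_ball hr
  have hc : ContinuousOn (deriv f) (Metric.closedBall (0 : ℂ) r') :=
    ((hf.deriv Metric.isOpen_ball).continuousOn).mono hsub
  obtain ⟨C, hC⟩ := (isCompact_closedBall (0 : ℂ) r').exists_bound_of_continuousOn hc
  refine ⟨max C 1, by positivity, fun a ha b hb => ?_⟩
  refine (convex_closedBall (0 : ℂ) r').norm_image_sub_le_of_norm_hasDerivWithin_le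
    (f' := deriv f) (fun z hz => ?_) (fun z hz => (hC z hz).trans (le_max_left _ _)) ha hb
  exact ((hf.differentiableAt (Metric.isOpen_ball.mem_nhds (hsub hz))).hasDerivAt).hasDerivWithinAt

lemma exists_norm_taylor_le {f : ℂ → ℂ} {r r' : ℝ} (hf : DifferentiableOn ℂ f (Metric.ball 0 r))
    (hr : r' < r) : ∃ C : ℝ, 0 < C ∧ ∀ a ∈ Metric.closedBall (0 : ℂ) r',
      ∀ b ∈ Metric.closedBall (0 : ℂ) r',
        ‖f b - f a - deriv f a * (b - a)‖ ≤ C * ‖b - a‖ ^ 2 := by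
  have hsub : Metric.closedBall (0 : ℂ) r' ⊆ Metric.ball 0 r := Metric.closedBall_subset_ball hr
  obtain ⟨C, hC, h⟩ := exists_norm_image_sub_le (hf.deriv Metric.isOpen_ball) hr
  refine ⟨C, hC, fun a ha b hb => ?_⟩
  have hseg : segment ℝ a b ⊆ Metric.closedBall (0 : ℂ) r' :=
    (convex_closedBall (0 : ℂ) r').segment_subset ha hb
  have := (convex_segment a b).norm_image_sub_le_of_norm_hasDerivWithin_le
    (f := fun z => f z - deriv f a * z) (f' := fun z => deriv f z - deriv f a)
    (C := C * ‖b - a‖) (fun z hz => ?_) (fun z hz => ?_) (left_mem_segment ℝ a b)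
    (right_mem_segment ℝ a b)
  · refine le_trans (le_of_eq ?_) (this.trans (le_of_eq (by ring)))
    congr 1; ring
  · have h1 := (hf.differentiableAt (Metric.isOpen_ball.mem_nhds (hsub (hseg hz)))).hasDerivAt
    have h2 := h1.sub ((hasDerivAt_id z).const_mul (deriv f a))
    rw [mul_one] at h2
    exact h2.hasDerivWithinAt
  · refine (h a ha z (hseg hz)).trans ?_
    gcongr
    obtain ⟨t, ⟨ht0, ht1⟩, rfl⟩ := (segment_eq_image' ℝ a b ▸ hz)
    rw [add_sub_cancel_left, norm_smul, Real.norm_of_nonneg ht0]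
    exact mul_le_of_le_one_left (norm_nonneg _) ht1

/-- The entire function `sin w / w`. -/
noncomputable def csinc (w : ℂ) : ℂ := sinhc (Complex.I * w)

lemma csinc_zero : csinc 0 = 1 := by simp [csinc, sinhc_zero]

lemma mul_csinc (w : ℂ) : w * csinc w = Complex.sin w := by
  have h := mul_sinhc (Complex.I * w)
  rw [mul_comm Complex.I w, Complex.sinh_mul_I, mul_comm w Complex.I] at h
  have h1 : Complex.I * (w * csinc w - Complex.sin w) = 0 := by
    rw [csinc]; linear_combination h
  exact sub_eq_zero.1 ((mul_eq_zero.1 h1).resolve_left Complex.I_ne_zero)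

lemma differentiable_csinc : Differentiable ℂ csinc :=
  differentiable_sinhc.comp (differentiable_id.const_mul _)

lemma csinc_ne_zero {w : ℂ} (hw : ‖w‖ < 1) : csinc w ≠ 0 := by
  have key : ∀ w : ℂ, ‖w‖ < 1 → 0 ≤ w.re → csinc w ≠ 0 := by
    intro w hw h0
    have hle := (le_abs_self _).trans (Complex.abs_re_le_norm w)
    have e : Complex.I * w = ((-w.im : ℝ) : ℂ) + (w.re : ℂ) * Complex.I := by
      apply Complex.ext <;> simp
    rw [csinc, e]
    refine sinhc_ne_zero h0 (by linarith [Real.pi_gt_three]) fun h => ?_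
    have := congrArg Complex.im h
    simp at this
    linarith [Real.pi_gt_three]
  rcases le_total 0 w.re with h | h
  · exact key w hw h
  · have := key (-w) (by rwa [norm_neg]) (by simpa using h)
    rwa [csinc, mul_neg, sinhc_neg] at this

/-- The function `w cot w`, extended continuously to the origin. -/
noncomputable def mulCot (w : ℂ) : ℂ := Complex.cos w / csinc w

lemma differentiableOn_mulCot : DifferentiableOn ℂ mulCot (Metric.ball 0 1) := fun w hw =>
  ((Complex.differentiable_cos w).div (differentiable_csinc w)
    (csinc_ne_zero (by simpa using hw))).differentiableWithinAt

/-- The regular part of `(π - w) cot w` at the origin. -/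
noncomputable def cotRem (w : ℂ) : ℂ := π * dslope mulCot 0 w - mulCot w

lemma differentiableOn_cotRem : DifferentiableOn ℂ cotRem (Metric.ball 0 1) :=
  (((Complex.differentiableOn_dslope (Metric.ball_mem_nhds 0 one_pos)).2
    differentiableOn_mulCot).const_mul _).sub differentiableOn_mulCot

lemma cotRem_eq {w : ℂ} (hw : w ≠ 0) :
    π / w + cotRem w = (π - w) * (Complex.cos w / Complex.sin w) := by
  have h0 : mulCot 0 = 1 := by simp [mulCot, csinc_zero]
  rw [cotRem, dslope_of_ne _ hw, slope_def_field, h0, sub_zero, mulCot, ← mul_csinc w]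
  by_cases hs : csinc w = 0
  · simp [hs]; ring
  · field_simp
    ring

lemma hasDerivAt_cotRem {w : ℂ} (hw : w ≠ 0) (hw1 : ‖w‖ < 1) :
    HasDerivAt cotRem (-(Complex.cos w / Complex.sin w) - (π - w) / Complex.sin w ^ 2 + π / w ^ 2)
      w := by
  have hs : Complex.sin w ≠ 0 := by
    rw [← mul_csinc]; exact mul_ne_zero hw (csinc_ne_zero hw1)
  have h1 : HasDerivAt (fun w => (π - w) * (Complex.cos w / Complex.sin w) - π / w)
      (-(Complex.cos w / Complex.sin w) - (π - w) / Complex.sin w ^ 2 + π / w ^ 2) w := by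
    have := (((hasDerivAt_id w).const_sub (π : ℂ)).mul
      ((Complex.hasDerivAt_cos w).div (Complex.hasDerivAt_sin w) hs)).sub
      ((hasDerivAt_inv hw).const_mul (π : ℂ))
    refine this.congr_deriv ?_
    have h2 := Complex.sin_sq_add_cos_sq w
    simp only [id, Pi.div_apply]
    field_simp
    linear_combination (-(π - w)) * w ^ 2 * h2
  refine h1.congr_of_eventuallyEq ?_
  filter_upwards [isOpen_ne.mem_nhds hw] with z hz
  rw [← cotRem_eq hz]; ring

/-- The regular amplitude multiplying `w ^ (-N)`. -/
noncomputable def amplitude (N k : ℕ) (w : ℂ) : ℂ := ((π - w) / csinc w) ^ N * Complex.cos w ^ k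

lemma amplitude_zero (N k : ℕ) : amplitude N k 0 = π ^ N := by simp [amplitude, csinc_zero]

lemma differentiableOn_amplitude (N k : ℕ) :
    DifferentiableOn ℂ (amplitude N k) (Metric.ball 0 1) := fun w hw =>
  (((((differentiableAt_id.const_sub (π : ℂ)).div (differentiable_csinc w)
    (csinc_ne_zero (by simpa using hw))).pow N).mul
    ((Complex.differentiable_cos w).pow k))).differentiableWithinAt

lemma profile_pi_sub (R : ℝ) (N k : ℕ) {w : ℂ} (hw : w ≠ 0) (hw1 : ‖w‖ < 1) :
    profile R N k (π * Complex.I + -Complex.I * w) =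
      (-1) ^ k * Complex.exp (R * (π / w + cotRem w)) * (amplitude N k w / w ^ N) := by
  have e : (π : ℂ) * Complex.I + -Complex.I * w = (π - w) * Complex.I := by ring
  have hne : (π : ℂ) - w ≠ 0 := fun h => by
    have : ‖(π : ℂ)‖ < 1 := by rwa [sub_eq_zero.1 h]
    rw [Complex.norm_real, Real.norm_of_nonneg Real.pi_pos.le] at this
    linarith [Real.pi_gt_three]
  have hs := csinc_ne_zero hw1
  have hsinhc : sinhc ((π - w) * Complex.I) = Complex.sin w / (π - w) := by
    rw [sinhc_of_ne (mul_ne_zero hne Complex.I_ne_zero), Complex.sinh_mul_I, Complex.sin_pi_sub]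
    field_simp
  rw [e, profile, hsinhc, Complex.cosh_mul_I, Complex.cos_pi_sub, cotRem_eq hw, amplitude,
    ← mul_csinc w]
  have e2 : -(R * (-Complex.cos w / (w * csinc w / (π - w)))) =
      R * ((π - w) * (Complex.cos w / (w * csinc w))) := by
    field_simp
  rw [e2, neg_pow (Complex.cos w), div_pow, div_pow, mul_pow]
  field_simp

lemma sq_div_five_le_one_sub_cos {α : ℝ} (h : |α| ≤ π) : α ^ 2 / 5 ≤ 1 - Real.cos α := by
  have h1 := Real.cos_le_one_sub_mul_cos_sq h
  have h2 : 1 / 5 ≤ 2 / π ^ 2 := by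
    rw [div_le_div_iff₀ (by norm_num) (by positivity)]
    nlinarith [Real.pi_lt_d2, Real.pi_pos]
  nlinarith [sq_nonneg α]

lemma abs_one_sub_cos_sub_le (α : ℝ) : |1 - Real.cos α - α ^ 2 / 2| ≤ α ^ 4 := by
  rcases le_or_gt |α| 1 with h | h
  · have := Real.cos_bound h
    rw [abs_sub_comm] at this
    have e : 1 - α ^ 2 / 2 - Real.cos α = 1 - Real.cos α - α ^ 2 / 2 := by ring
    rw [e, Even.pow_abs (by decide)] at this
    nlinarith [show 0 ≤ α ^ 4 by positivity]
  · have h1 := Real.one_sub_sq_div_two_le_cos (x := α)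
    have h2 := Real.cos_le_one α
    have h3 : 1 ≤ α ^ 2 := by rw [← sq_abs]; nlinarith
    rw [abs_le]
    constructor <;> nlinarith

lemma norm_cexp_I_sub_le (x : ℝ) : ‖Complex.exp (Complex.I * x) - 1 - Complex.I * x‖ ≤ 3 * x ^ 2 := by
  have e : ‖Complex.I * (x : ℂ)‖ = |x| := by simp
  rcases le_or_gt |x| 1 with h | h
  · have := Complex.norm_exp_sub_one_sub_id_le (x := Complex.I * x) (by rwa [e])
    rw [e, sq_abs] at this
    nlinarith [sq_nonneg x]
  · have h1 : ‖Complex.exp (Complex.I * x)‖ = 1 := by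
      rw [mul_comm]; exact Complex.norm_exp_ofReal_mul_I x
    calc _ ≤ ‖Complex.exp (Complex.I * x)‖ + ‖(1 : ℂ)‖ + ‖Complex.I * (x : ℂ)‖ :=
          (norm_sub_le _ _).trans (by gcongr; exact norm_sub_le _ _)
      _ = 2 + |x| := by rw [h1, e, norm_one]; norm_num
      _ ≤ _ := by rw [← sq_abs]; nlinarith

lemma norm_cexp_neg_sub_le {κ α : ℝ} (hκ : 0 < κ) (hα : |α| ≤ π) :
    ‖Complex.exp (-(κ * (1 - Real.cos α) : ℝ)) - Complex.exp (-(κ * α ^ 2 / 2 : ℝ))‖ ≤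
      κ * α ^ 4 * Real.exp (-(κ * α ^ 2 / 5)) := by
  have h := sq_div_five_le_one_sub_cos hα
  refine (norm_cexp_sub_cexp_le (M := -(κ * α ^ 2 / 5)) ?_ ?_).trans ?_
  · rw [Complex.neg_re, Complex.ofReal_re]; nlinarith
  · rw [Complex.neg_re, Complex.ofReal_re]; nlinarith [show 0 ≤ κ * α ^ 2 by positivity]
  · rw [mul_comm (κ * α ^ 4)]
    gcongr
    have e : (-((κ * (1 - Real.cos α) : ℝ) : ℂ) - -((κ * α ^ 2 / 2 : ℝ) : ℂ)) =
      ((-(κ * (1 - Real.cos α - α ^ 2 / 2)) : ℝ) : ℂ) := by push_cast; ring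
    rw [e, Complex.norm_real, Real.norm_eq_abs, abs_neg, abs_mul, abs_of_pos hκ]
    gcongr
    exact abs_one_sub_cos_sub_le α

/-- One-dimensional Laplace asymptotics with the phase `1 - cos α`. -/
lemma exists_norm_integral_laplace_le (l : ℝ) : ∃ C : ℝ, 0 < C ∧ ∀ κ : ℝ, 0 < κ →
    ‖(∫ α in (-π)..π, Complex.exp (Complex.I * (l * α : ℝ)) *
        Complex.exp (-(κ * (1 - Real.cos α) : ℝ))) - (√(2 * π / κ) : ℂ)‖ ≤ C * (1 / κ) * √(1 / κ) := by
  obtain ⟨B, hB, hBe⟩ := pow_le_mul_exp 2 (β := 1 / 10) (by norm_num)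
  refine ⟨(3 * l ^ 2 + 1) * B * √(10 * π), by positivity, fun κ hκ => ?_⟩
  have hπ := Real.pi_pos
  set q : ℝ → ℂ := fun α => Complex.exp (-(κ * (1 - Real.cos α) : ℝ)) with hq
  set g : ℝ → ℂ := fun α => Complex.exp (-(κ * α ^ 2 / 2 : ℝ)) with hg
  set p : ℝ → ℂ := fun α => Complex.exp (Complex.I * (l * α : ℝ)) - Complex.I * (l * α : ℝ) with hp
  have hqc : Continuous q := by simp only [hq]; fun_prop
  have hpc : Continuous p := by simp only [hp]; fun_prop
  have hgr : ∀ α, g α = ((Real.exp (-(κ / 2) * α ^ 2) : ℝ) : ℂ) := fun α => by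
    simp only [hg]; rw [Complex.ofReal_exp]; push_cast; congr 1; ring
  have hgi : Integrable g := by
    simp_rw [show g = fun α => ((Real.exp (-(κ / 2) * α ^ 2) : ℝ) : ℂ) from funext hgr]
    exact (integrable_exp_neg_mul_sq (by positivity)).ofReal
  have hgint : ∫ α, g α = (√(2 * π / κ) : ℂ) := by
    simp_rw [hgr]
    rw [integral_complex_ofReal, integral_gaussian]
    rw [div_div_eq_mul_div, mul_comm π 2]
  have hodd : ∫ α in (-π)..π, Complex.I * (l * α : ℝ) * q α = 0 := by
    have h1 := intervalIntegral.integral_comp_neg (a := -π) (b := π)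
      (fun α : ℝ => Complex.I * (l * α : ℝ) * q α)
    have h2 : ∀ α : ℝ, Complex.I * (l * (-α) : ℝ) * q (-α) = -(Complex.I * (l * α : ℝ) * q α) := by
      intro α; simp only [hq, Real.cos_neg]; push_cast; ring
    simp_rw [h2] at h1
    rw [intervalIntegral.integral_neg, neg_neg] at h1
    have h3 : (2 : ℂ) * ∫ α in (-π)..π, Complex.I * (l * α : ℝ) * q α = 0 := by
      linear_combination -h1
    simpa using h3
  have hmain : ∫ α in (-π)..π, Complex.exp (Complex.I * (l * α : ℝ)) * q α =
      ∫ α, (Set.Ioc (-π) π).indicator (fun α => p α * q α) α := by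
    rw [integral_indicator measurableSet_Ioc, ← intervalIntegral.integral_of_le (by linarith)]
    have : ∀ α, p α * q α = Complex.exp (Complex.I * (l * α : ℝ)) * q α -
        Complex.I * (l * α : ℝ) * q α := fun α => by simp only [hp]; ring
    simp_rw [this]
    rw [intervalIntegral.integral_sub, hodd, sub_zero]
    · exact (Continuous.mul (by fun_prop) hqc).intervalIntegrable _ _
    · exact (Continuous.mul (by fun_prop) hqc).intervalIntegrable _ _
  have hind : Integrable ((Set.Ioc (-π) π).indicator (fun α => p α * q α)) := by
    rw [integrable_indicator_iff measurableSet_Ioc]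
    exact ((hpc.mul hqc).continuousOn.integrableOn_Icc).mono_set Set.Ioc_subset_Icc_self
  have hpt : ∀ α, ‖(Set.Ioc (-π) π).indicator (fun α => p α * q α) α - g α‖ ≤
      (3 * l ^ 2 + 1) * B * (1 / κ) * Real.exp (-(κ / 10) * α ^ 2) := by
    intro α
    have hy := hBe (κ * α ^ 2) (by positivity)
    have hpoly : (α ^ 2 + κ * α ^ 4) * Real.exp (-(κ * α ^ 2 / 5)) ≤
        B * (1 / κ) * Real.exp (-(κ / 10) * α ^ 2) := by
      have e : α ^ 2 + κ * α ^ 4 = (1 / κ) * (κ * α ^ 2 + (κ * α ^ 2) ^ 2) := by field_simp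
      have e1 : Real.exp (-(κ / 10) * α ^ 2) =
          Real.exp (1 / 10 * (κ * α ^ 2)) * Real.exp (-(κ * α ^ 2 / 5)) := by
        rw [← Real.exp_add]; congr 1; ring
      rw [e, e1]
      calc _ ≤ (1 / κ) * (B * Real.exp (1 / 10 * (κ * α ^ 2))) * Real.exp (-(κ * α ^ 2 / 5)) := by
            gcongr
            nlinarith [show 0 ≤ κ * α ^ 2 by positivity]
        _ = _ := by ring
    have hgle : ‖g α‖ ≤ Real.exp (-(κ * α ^ 2 / 5)) := by
      rw [hgr, Complex.norm_real, Real.norm_of_nonneg (Real.exp_pos _).le]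
      gcongr; nlinarith [show 0 ≤ κ * α ^ 2 by positivity]
    suffices h : ‖(Set.Ioc (-π) π).indicator (fun α => p α * q α) α - g α‖ ≤
        (3 * l ^ 2 + 1) * ((α ^ 2 + κ * α ^ 4) * Real.exp (-(κ * α ^ 2 / 5))) by
      refine h.trans ?_
      calc _ ≤ (3 * l ^ 2 + 1) * (B * (1 / κ) * Real.exp (-(κ / 10) * α ^ 2)) := by gcongr
        _ = _ := by ring
    have hk4 : 0 ≤ κ * α ^ 4 := by positivity
    by_cases hα : α ∈ Set.Ioc (-π) π
    · rw [Set.indicator_of_mem hα]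
      have hα' : |α| ≤ π := abs_le.2 ⟨hα.1.le, hα.2⟩
      have e : p α * q α - g α = (p α - 1) * q α + (q α - g α) := by ring
      have h1 : ‖p α - 1‖ ≤ 3 * (l * α) ^ 2 := by
        have := norm_cexp_I_sub_le (l * α)
        simp only [hp]
        rwa [sub_right_comm]
      have h2 : ‖q α‖ ≤ Real.exp (-(κ * α ^ 2 / 5)) := by
        simp only [hq]
        rw [Complex.norm_exp, Complex.neg_re, Complex.ofReal_re]
        gcongr
        nlinarith [sq_div_five_le_one_sub_cos hα']
      rw [e]
      refine (norm_add_le _ _).trans ?_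
      rw [norm_mul]
      calc _ ≤ 3 * (l * α) ^ 2 * Real.exp (-(κ * α ^ 2 / 5)) +
            κ * α ^ 4 * Real.exp (-(κ * α ^ 2 / 5)) := by
              gcongr
              exact norm_cexp_neg_sub_le hκ hα'
        _ ≤ _ := by
          rw [← add_mul, ← mul_assoc]
          gcongr
          nlinarith [sq_nonneg l, sq_nonneg α, mul_nonneg (sq_nonneg l) hk4]
    · rw [Set.indicator_of_notMem hα, zero_sub, norm_neg]
      have hα1 : 1 ≤ α ^ 2 := by
        by_contra! h
        have := abs_lt.1 ((sq_lt_one_iff_abs_lt_one α).1 h)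
        exact hα ⟨by linarith [Real.pi_gt_three], by linarith [Real.pi_gt_three]⟩
      refine hgle.trans ?_
      rw [← mul_assoc]
      refine le_mul_of_one_le_left (Real.exp_pos _).le ?_
      nlinarith [sq_nonneg l, mul_nonneg (sq_nonneg l) hk4]
  have hval : (∫ α in (-π)..π, Complex.exp (Complex.I * (l * α : ℝ)) * q α) - (√(2 * π / κ) : ℂ) =
      ∫ α, ((Set.Ioc (-π) π).indicator (fun α => p α * q α) α - g α) := by
    rw [integral_sub hind hgi, hmain, hgint]
  rw [hval]
  refine (norm_integral_le_of_norm_le ((integrable_exp_neg_mul_sq (b := κ / 10)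
    (by positivity)).const_mul _) (Filter.Eventually.of_forall hpt)).trans ?_
  rw [integral_const_mul, integral_gaussian]
  refine le_of_eq ?_
  have : π / (κ / 10) = 10 * π * (1 / κ) := by field_simp
  rw [this, Real.sqrt_mul (by positivity)]
  ring

/-- Perturbed version of the Laplace asymptotics. -/
lemma exists_norm_integral_sub_le (l : ℝ) (c : ℂ) : ∃ C : ℝ, 0 < C ∧ ∀ (κ η ε : ℝ)
    (F E H : ℝ → ℂ), 0 < κ → η ≤ 1 / 2 → 0 ≤ ε → 0 ≤ η → IntervalIntegrable F volume (-π) π →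
    (∀ α, F α = Complex.exp (Complex.I * (l * α : ℝ)) *
      Complex.exp (-(κ * (1 - Real.cos α) : ℝ) + E α) * H α) →
    (∀ α, ‖E α‖ ≤ η * (κ * (1 - Real.cos α))) → (∀ α, ‖H α - c‖ ≤ ε) →
    ‖(∫ α in (-π)..π, F α) - c * (√(2 * π / κ) : ℂ)‖ ≤ C * (η + ε + 1 / κ) * √(1 / κ) := by
  obtain ⟨C, hC, h⟩ := exists_norm_integral_laplace_le l
  refine ⟨(1 + 4 * ‖c‖) * √(20 * π) + ‖c‖ * C, by positivity,
    fun κ η ε F E H hκ hη hε hη0 hF hFeq hE hH => ?_⟩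
  have hπ := Real.pi_pos
  set q : ℝ → ℂ := fun α => Complex.exp (Complex.I * (l * α : ℝ)) *
    Complex.exp (-(κ * (1 - Real.cos α) : ℝ)) with hq
  have hqi : IntervalIntegrable (fun α => c * q α) volume (-π) π := by
    refine Continuous.intervalIntegrable ?_ _ _
    simp only [hq]; fun_prop
  have hpt : ∀ α, |α| ≤ π → ‖F α - c * q α‖ ≤
      (ε + 4 * ‖c‖ * η) * Real.exp (-(κ / 20) * α ^ 2) := by
    intro α hα
    set y := κ * (1 - Real.cos α) with hy
    have hcos := sq_div_five_le_one_sub_cos hα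
    have hy0 : 0 ≤ y := mul_nonneg hκ.le (by linarith [Real.cos_le_one α])
    have hre := (abs_le.1 (Complex.abs_re_le_norm (E α))).2
    have hEα := hE α
    have hre2 : (-(y : ℂ) + E α).re ≤ -(y / 2) := by
      rw [Complex.add_re, Complex.neg_re, Complex.ofReal_re]
      nlinarith
    have h1 : ‖Complex.exp (-(y : ℂ) + E α) - Complex.exp (-(y : ℂ))‖ ≤
        Real.exp (-(y / 2)) * (η * y) := by
      refine (norm_cexp_sub_cexp_le hre2 ?_).trans ?_
      · rw [Complex.neg_re, Complex.ofReal_re]; linarith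
      · gcongr
        simpa using hEα
    have h2 : ‖Complex.exp (-(y : ℂ) + E α)‖ ≤ Real.exp (-(y / 2)) := by
      rw [Complex.norm_exp]; gcongr
    have h3 : ‖Complex.exp (Complex.I * (l * α : ℝ))‖ = 1 := by
      rw [mul_comm]; exact Complex.norm_exp_ofReal_mul_I _
    have e : F α - c * q α = Complex.exp (Complex.I * (l * α : ℝ)) *
        (Complex.exp (-(y : ℂ) + E α) * (H α - c) +
          c * (Complex.exp (-(y : ℂ) + E α) - Complex.exp (-(y : ℂ)))) := by
      rw [hFeq]; simp only [hq]; ring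
    rw [e, norm_mul, h3, one_mul]
    refine (norm_add_le _ _).trans ?_
    rw [norm_mul, norm_mul]
    have h4 : Real.exp (-(y / 2)) * y ≤ 4 * Real.exp (-(y / 4)) := by
      have e1 : Real.exp (-(y / 4)) = Real.exp (-(y / 2)) * Real.exp (y / 4) := by
        rw [← Real.exp_add]; congr 1; ring
      have := Real.add_one_le_exp (y / 4)
      rw [e1]
      nlinarith [Real.exp_pos (-(y / 2))]
    have h5 : Real.exp (-(y / 2)) ≤ Real.exp (-(y / 4)) := by gcongr; linarith
    have h6 : Real.exp (-(y / 4)) ≤ Real.exp (-(κ / 20) * α ^ 2) := by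
      gcongr; rw [hy]; nlinarith
    calc _ ≤ Real.exp (-(y / 2)) * ε + ‖c‖ * (Real.exp (-(y / 2)) * (η * y)) := by
          gcongr
          exact hH α
      _ = Real.exp (-(y / 2)) * ε + ‖c‖ * η * (Real.exp (-(y / 2)) * y) := by ring
      _ ≤ Real.exp (-(y / 4)) * ε + ‖c‖ * η * (4 * Real.exp (-(y / 4))) := by gcongr
      _ = (ε + 4 * ‖c‖ * η) * Real.exp (-(y / 4)) := by ring
      _ ≤ _ := by gcongr
  have hi := integrable_exp_neg_mul_sq (b := κ / 20) (by positivity)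
  have h1 : ‖∫ α in (-π)..π, (F α - c * q α)‖ ≤ (ε + 4 * ‖c‖ * η) * (√(20 * π) * √(1 / κ)) := by
    refine (intervalIntegral.norm_integral_le_of_norm_le (by linarith)
      (Filter.Eventually.of_forall fun α hα => hpt α (abs_le.2 ⟨hα.1.le, hα.2⟩))
      (hi.const_mul _).intervalIntegrable).trans ?_
    rw [intervalIntegral.integral_const_mul, intervalIntegral.integral_of_le (by linarith)]
    gcongr
    refine (setIntegral_le_integral hi (Filter.Eventually.of_forall fun α =>
      (Real.exp_pos _).le)).trans (le_of_eq ?_)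
    rw [integral_gaussian, ← Real.sqrt_mul (by positivity)]
    congr 1; field_simp
  have h2 := h κ hκ
  have hval : (∫ α in (-π)..π, F α) - c * (√(2 * π / κ) : ℂ) =
      (∫ α in (-π)..π, (F α - c * q α)) + c * ((∫ α in (-π)..π, q α) - (√(2 * π / κ) : ℂ)) := by
    rw [intervalIntegral.integral_sub hF hqi, intervalIntegral.integral_const_mul]; ring
  rw [hval]
  refine (norm_add_le _ _).trans ?_
  rw [norm_mul c]
  have hk : 0 ≤ 1 / κ := by positivity
  have hA : ε + 4 * ‖c‖ * η ≤ (1 + 4 * ‖c‖) * (η + ε + 1 / κ) := by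
    nlinarith [norm_nonneg c, mul_nonneg (norm_nonneg c) hε, mul_nonneg (norm_nonneg c) hk]
  calc _ ≤ (1 + 4 * ‖c‖) * (η + ε + 1 / κ) * (√(20 * π) * √(1 / κ)) +
        ‖c‖ * (C * (η + ε + 1 / κ) * √(1 / κ)) := by
        refine add_le_add (h1.trans (by gcongr)) (by gcongr; refine h2.trans ?_; gcongr; linarith)
    _ = _ := by ring

lemma norm_circle_sub_sq {w₀ : ℝ} (α : ℝ) :
    ‖(w₀ * Complex.exp (α * Complex.I) - w₀ : ℂ)‖ ^ 2 = 2 * w₀ ^ 2 * (1 - Real.cos α) := by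
  rw [← Complex.normSq_eq_norm_sq, Complex.exp_mul_I, ← Complex.ofReal_cos, ← Complex.ofReal_sin,
    Complex.normSq_apply]
  simp only [Complex.sub_re, Complex.sub_im, Complex.mul_re, Complex.mul_im, Complex.add_re,
    Complex.add_im, Complex.ofReal_re, Complex.ofReal_im, Complex.I_re, Complex.I_im]
  linear_combination w₀ ^ 2 * Real.sin_sq_add_cos_sq α

/-- The factor in front of the circle integral. -/
noncomputable def circlePre (R : ℝ) (N k d : ℕ) (s w₀ : ℝ) : ℂ :=
  (-1) ^ k * Complex.exp (-(s * π) + (s * w₀ + R * (π / w₀ + cotRem w₀))) *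
    (w₀ / (w₀ : ℂ) ^ N) / (√s : ℂ) ^ d

lemma exists_norm_circleInt_sub_le (N k d j : ℕ) : ∃ C : ℝ, 0 < C ∧ ∃ r : ℝ, 0 < r ∧ r ≤ 1 / 4 ∧
    ∀ R s w₀ : ℝ, 0 < R → 1 ≤ s → 0 < w₀ → w₀ ≤ r →
      (s : ℂ) - π * R / w₀ ^ 2 + R * deriv cotRem w₀ = 0 →
      ‖circleInt R N k d j s w₀ - circlePre R N k d s w₀ *
        ((π ^ N * ((Complex.I * π) ^ j * ((√2 * π : ℝ) : ℂ) ^ d)) *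
          (√(2 * π / (2 * π * R / w₀)) : ℂ))‖ ≤
      C * ‖circlePre R N k d s w₀‖ * (w₀ + 1 / s + 1 / (2 * π * R / w₀)) *
        √(1 / (2 * π * R / w₀)) := by
  obtain ⟨Ct, hCt, ht⟩ := exists_norm_taylor_le differentiableOn_cotRem
    (show (1 / 4 : ℝ) < 1 by norm_num)
  obtain ⟨Ca, hCa, ha⟩ := exists_norm_image_sub_le (differentiableOn_amplitude N k)
    (show (1 / 4 : ℝ) < 1 by norm_num)
  obtain ⟨Ci, hCi, hi⟩ := exists_norm_innerInt_sub_le d j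
  set ci : ℂ := (Complex.I * π) ^ j * ((√2 * π : ℝ) : ℂ) ^ d with hci
  obtain ⟨C, hC, h⟩ := exists_norm_integral_sub_le (1 - N : ℝ) (π ^ N * ci)
  have hπ := Real.pi_pos
  have hπ1 := Real.pi_gt_three
  set D := Ca * (‖ci‖ + 2 * Ci) + π ^ N * Ci with hD
  have hD0 : 0 < D := by positivity
  refine ⟨C * (Ct + D + 1), by positivity, min (1 / 4) (1 / (2 * Ct)), by positivity,
    min_le_left _ _, fun R s w₀ hR hs hw hwr hsad => ?_⟩
  have hw1 : w₀ ≤ 1 / 4 := hwr.trans (min_le_left _ _)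
  have hw2 : Ct * w₀ ≤ 1 / 2 := by
    have := hwr.trans (min_le_right _ _)
    rw [le_div_iff₀ (by positivity)] at this
    linarith
  have hs0 : 0 < s := by linarith
  have hsq : (√s : ℂ) ≠ 0 := by exact_mod_cast (Real.sqrt_pos.2 hs0).ne'
  have hwc : (w₀ : ℂ) ≠ 0 := by exact_mod_cast hw.ne'
  set κ := 2 * π * R / w₀ with hκ
  have hκ0 : 0 < κ := by positivity
  set w : ℝ → ℂ := fun α => w₀ * Complex.exp (α * Complex.I) with hwdef
  have hwn : ∀ α, ‖w α‖ = w₀ := norm_circle_mk hw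
  have hwb : ∀ α, w α ∈ Metric.closedBall (0 : ℂ) (1 / 4) := fun α => by
    simpa [hwn α] using hw1
  have hw0b : (w₀ : ℂ) ∈ Metric.closedBall (0 : ℂ) (1 / 4) := by
    simpa [abs_of_pos hw] using hw1
  have hwne : ∀ α, w α ≠ 0 := fun α => mul_ne_zero hwc (Complex.exp_ne_zero _)
  set E : ℝ → ℂ := fun α => R * (cotRem (w α) - cotRem w₀ - deriv cotRem w₀ * (w α - w₀)) with hE
  set inn : ℝ → ℂ := fun α => (√s : ℂ) ^ d * (Complex.exp (s * (π - w α)) *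
    innerInt d j s (π - w α)) with hinn
  set H : ℝ → ℂ := fun α => amplitude N k (w α) * inn α with hH
  set F : ℝ → ℂ := fun α => Complex.exp (Complex.I * ((1 - N : ℝ) * α : ℝ)) *
      Complex.exp (-(κ * (1 - Real.cos α) : ℝ) + E α) * H α with hF
  set Pre := circlePre R N k d s w₀ with hPre
  have hPre0 : Pre ≠ 0 := by
    rw [hPre, circlePre]
    simp only [ne_eq, div_eq_zero_iff, mul_eq_zero, pow_eq_zero_iff', neg_eq_zero, one_ne_zero,
      Complex.exp_ne_zero, hwc, hsq, false_and, or_self, not_false_eq_true]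
  have hphase : ∀ α, R * (π / w α + cotRem (w α)) = (-(s * π) + (s * w₀ + R * (π / w₀ + cotRem w₀))) +
      (-(κ * (1 - Real.cos α) : ℝ) + E α) + s * (π - w α) := by
    intro α
    have h1 : (Real.cos α : ℂ) = (Complex.exp (α * Complex.I) + Complex.exp (-α * Complex.I)) / 2 := by
      rw [Complex.ofReal_cos, Complex.cos]
    have h2 : Complex.exp (-α * Complex.I) = (Complex.exp (α * Complex.I))⁻¹ := by
      rw [neg_mul, Complex.exp_neg]
    have h3 : (s : ℂ) = π * R / w₀ ^ 2 - R * deriv cotRem w₀ := by linear_combination hsad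
    have h4 := Complex.exp_ne_zero (α * Complex.I)
    rw [Complex.ofReal_mul κ, Complex.ofReal_sub 1, h1, h2]
    simp only [hE, hwdef, hκ]
    push_cast
    rw [h3]
    field_simp
    ring
  have hint : ∀ α, w α * profile R N k (π * Complex.I + -Complex.I * w α) *
      innerInt d j s (π - w α) = Pre * F α := by
    intro α
    rw [profile_pi_sub R N k (hwne α) (by rw [hwn]; linarith), hphase α, Complex.exp_add,
      Complex.exp_add]
    have h1 : Complex.exp (α * Complex.I) = Complex.exp (α * Complex.I) ^ N *
        Complex.exp (Complex.I * ((1 - N : ℝ) * α : ℝ)) := by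
      rw [← Complex.exp_nat_mul, ← Complex.exp_add]; congr 1; push_cast; ring
    have h2 : w α / w α ^ N = w₀ / (w₀ : ℂ) ^ N * Complex.exp (Complex.I * ((1 - N : ℝ) * α : ℝ)) := by
      have h4 := Complex.exp_ne_zero (α * Complex.I)
      simp only [hwdef]
      rw [mul_pow]
      nth_rewrite 1 [h1]
      field_simp
    simp only [hF, hH, hinn, hPre, circlePre]
    have h5 : ∀ a b c e x y : ℂ, w α * ((-1) ^ k * (a * b * c) * (x / w α ^ N)) * y =
        (-1) ^ k * (a * b * c) * x * y * (w α / w α ^ N) := fun a b c e x y => by ring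
    rw [h5 _ _ _ 0, h2]
    field_simp
  have hcirc : circleInt R N k d j s w₀ = Pre * ∫ α in (-π)..π, F α := by
    rw [circleInt, ← intervalIntegral.integral_const_mul]
    exact intervalIntegral.integral_congr fun α _ => hint α
  have hFi : IntervalIntegrable F volume (-π) π := by
    have := (intervalIntegrable_circle R N k d j hw hw1 (s := s) (by linarith)).const_mul Pre⁻¹
    refine this.congr (fun α _ => ?_)
    have := hint α
    simp only [hwdef] at this ⊢
    rw [this, inv_mul_cancel_left₀ hPre0]
  have hE1 : ∀ α, ‖E α‖ ≤ (Ct * w₀) * (κ * (1 - Real.cos α)) := by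
    intro α
    have h0 : 0 ≤ 1 - Real.cos α := by linarith [Real.cos_le_one α]
    have h1 := ht w₀ hw0b (w α) (hwb α)
    rw [norm_circle_sub_sq] at h1
    simp only [hE]
    rw [norm_mul, Complex.norm_real, Real.norm_of_nonneg hR.le]
    calc _ ≤ R * (Ct * (2 * w₀ ^ 2 * (1 - Real.cos α))) := by gcongr
      _ ≤ 2 * π * R * Ct * (1 - Real.cos α) := by
        have : R * Ct * (1 - Real.cos α) * (2 * w₀ ^ 2) ≤ R * Ct * (1 - Real.cos α) * (2 * π) := by
          gcongr; nlinarith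
        linarith
      _ = _ := by rw [hκ]; field_simp
  have hH1 : ∀ α, ‖H α - π ^ N * ci‖ ≤ D * (w₀ + 1 / s) := by
    intro α
    have h1 := ha 0 (by simp) (w α) (hwb α)
    rw [amplitude_zero, sub_zero, hwn] at h1
    have h2 := hi (w α) s (by rw [hwn]; exact hw1) hs
    rw [hwn] at h2
    have hs1 : 1 / s ≤ 1 := by rw [div_le_one hs0]; exact hs
    have hs2 : 0 ≤ 1 / s := by positivity
    have h3 : ‖inn α‖ ≤ ‖ci‖ + 2 * Ci := by
      have : ‖inn α‖ ≤ ‖inn α - ci‖ + ‖ci‖ := by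
        have := norm_add_le (inn α - ci) ci; rwa [sub_add_cancel] at this
      have : ‖inn α - ci‖ ≤ Ci * (w₀ + 1 / s) := h2
      nlinarith
    have e : H α - π ^ N * ci = (amplitude N k (w α) - π ^ N) * inn α + π ^ N * (inn α - ci) := by
      simp only [hH]; ring
    rw [e]
    refine (norm_add_le _ _).trans ?_
    rw [norm_mul (amplitude N k (w α) - π ^ N), norm_mul ((π : ℂ) ^ N), norm_pow, Complex.norm_real, Real.norm_of_nonneg hπ.le]
    calc _ ≤ Ca * w₀ * (‖ci‖ + 2 * Ci) + π ^ N * (Ci * (w₀ + 1 / s)) := by gcongr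
      _ ≤ Ca * (w₀ + 1 / s) * (‖ci‖ + 2 * Ci) + π ^ N * (Ci * (w₀ + 1 / s)) := by gcongr; linarith
      _ = _ := by rw [hD]; ring
  have hfin := h κ (Ct * w₀) (D * (w₀ + 1 / s)) F E H hκ0 hw2 (by positivity) (by positivity) hFi
    (fun α => rfl) hE1 hH1
  rw [hcirc, ← mul_sub, norm_mul]
  have hk : 0 ≤ 1 / κ := by positivity
  have hs2 : 0 ≤ 1 / s := by positivity
  calc _ ≤ ‖Pre‖ * (C * (Ct * w₀ + D * (w₀ + 1 / s) + 1 / κ) * √(1 / κ)) := by gcongr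
    _ ≤ ‖Pre‖ * (C * ((Ct + D + 1) * (w₀ + 1 / s + 1 / κ)) * √(1 / κ)) := by
      gcongr
      nlinarith [mul_nonneg hCt.le hs2, mul_nonneg hCt.le hk, mul_nonneg hD0.le hk]
    _ = _ := by ring

lemma theta_pi_sub {w : ℝ} (h0 : 0 < w) (h1 : w < π) :
    theta (π - w) = Real.cos w / Real.sin w + (π - w) / Real.sin w ^ 2 := by
  have hs := Real.sin_pos_of_pos_of_lt_pi h0 h1
  rw [theta, if_neg (by linarith), Real.sin_two_mul, Real.sin_pi_sub, Real.cos_pi_sub]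
  field_simp
  ring

lemma theta_le {r y : ℝ} (hr : 0 < r) (hr1 : r ≤ 1 / 4) (hy : 0 ≤ y) (hyr : y ≤ π - r) :
    theta y ≤ π ^ 2 + 4 * π ^ 3 / r ^ 2 := by
  have hπ := Real.pi_pos
  have hπ3 := Real.pi_gt_three
  have hp : 0 ≤ 4 * π ^ 3 / r ^ 2 := by positivity
  rcases hy.eq_or_lt with rfl | hy0
  · rw [theta, if_pos rfl]; positivity
  rw [theta, if_neg hy0.ne']
  have hsin : 0 < Real.sin y := Real.sin_pos_of_pos_of_lt_pi hy0 (by linarith)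
  rcases le_or_gt y (1 / 2) with h | h
  · have h1 := Real.sin_gt_sub_cube (x := 2 * y) (by linarith)
    have h2 := Real.mul_le_sin hy0.le (by linarith)
    have h3 : 2 * y - Real.sin (2 * y) ≤ 2 * y ^ 3 := by nlinarith [pow_pos hy0 3]
    rw [div_le_iff₀ (by positivity)]
    have h4 : (2 / π * y) ^ 2 ≤ Real.sin y ^ 2 := by gcongr
    have h5 : (2 / π * y) ^ 2 * π ^ 2 = 4 * y ^ 2 := by field_simp; ring
    have h6 : 2 * y ^ 3 ≤ 8 * y ^ 2 := by nlinarith [sq_nonneg y]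
    have h7 := mul_le_mul_of_nonneg_right h4 (sq_nonneg π)
    nlinarith [mul_nonneg hp (sq_nonneg (Real.sin y))]
  · have h2 : 2 / π * r ≤ Real.sin y := by
      rcases le_or_gt y (π / 2) with h' | h'
      · refine le_trans ?_ (Real.mul_le_sin hy0.le h'); gcongr; linarith
      · rw [← Real.sin_pi_sub]
        refine le_trans ?_ (Real.mul_le_sin (by linarith) (by linarith)); gcongr; linarith
    have h4 : (2 / π * r) ^ 2 ≤ Real.sin y ^ 2 := by gcongr
    have h5 : 4 * π ^ 3 / r ^ 2 * (2 * (2 / π * r) ^ 2) = 32 * π := by field_simp; ring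
    have h7 := mul_le_mul_of_nonneg_left h4 hp
    rw [div_le_iff₀ (by positivity)]
    nlinarith [Real.neg_one_le_sin (2 * y), mul_nonneg (sq_nonneg π) (sq_nonneg (Real.sin y))]

lemma deriv_cotRem {w : ℝ} (h0 : 0 < w) (h1 : w < 1) :
    deriv cotRem w = (π / w ^ 2 - theta (π - w) : ℝ) := by
  have hc : (w : ℂ) ≠ 0 := by exact_mod_cast h0.ne'
  have hn : ‖(w : ℂ)‖ < 1 := by rwa [Complex.norm_real, Real.norm_of_nonneg h0.le]
  rw [(hasDerivAt_cotRem hc hn).deriv, theta_pi_sub h0 (by linarith [Real.pi_gt_three])]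
  push_cast
  ring

lemma exists_abs_theta_sub_le : ∃ B : ℝ, 0 < B ∧ ∀ w : ℝ, 0 < w → w ≤ 1 / 4 →
    |π / w ^ 2 - theta (π - w)| ≤ B := by
  have hc : ContinuousOn (deriv cotRem) (Metric.closedBall (0 : ℂ) (1 / 4)) :=
    ((differentiableOn_cotRem.deriv Metric.isOpen_ball).continuousOn).mono
      (Metric.closedBall_subset_ball (by norm_num))
  obtain ⟨C, hC⟩ := (isCompact_closedBall (0 : ℂ) (1 / 4)).exists_bound_of_continuousOn hc
  refine ⟨max C 1, by positivity, fun w h0 h1 => ?_⟩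
  have := hC w (by simpa [abs_of_pos h0] using h1)
  rw [deriv_cotRem h0 (by linarith), Complex.norm_real] at this
  exact this.trans (le_max_left _ _)

/-- At the saddle point the phase equals minus a quarter of the squared distance. -/
lemma phase_saddle {s R w : ℝ} (h0 : 0 < w) (h1 : w < 1) (hs : s = R * theta (π - w)) :
    -(s * π) + (s * w + R * (π / w + cotRem w)) =
      ((-(R * ((π - w) / Real.sin w) ^ 2) : ℝ) : ℂ) := by
  have hsin := Real.sin_pos_of_pos_of_lt_pi h0 (by linarith [Real.pi_gt_three])
  have hc : (w : ℂ) ≠ 0 := by exact_mod_cast h0.ne'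
  rw [cotRem_eq hc, hs, theta_pi_sub h0 (by linarith [Real.pi_gt_three])]
  push_cast
  have : Complex.sin w ≠ 0 := by rw [← Complex.ofReal_sin]; exact_mod_cast hsin.ne'
  field_simp
  ring

/-- The coefficient of the exponential in the leading term. -/
noncomputable def leadConst (n d k₁ k₂ : ℕ) (A κ : ℝ) : ℝ :=
  π ^ (k₁ + k₂) / (4 ^ n * A ^ ((n : ℝ) + (k₁ : ℝ) - (((d + 1 : ℕ) : ℝ) + 1) / 2) *
    √(2 * π * κ ^ (d + 1)))

lemma leadConst_eq (n d k₁ k₂ : ℕ) {A κ : ℝ} (hA : 0 < A) (hκ : 0 < κ) :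
    leadConst n d k₁ k₂ A κ = π ^ (k₁ + k₂) * √A ^ (d + 2) /
      (4 ^ n * A ^ (n + k₁) * √(2 * π) * √κ ^ (d + 1)) := by
  have h1 : A ^ ((n : ℝ) + (k₁ : ℝ) - (((d + 1 : ℕ) : ℝ) + 1) / 2) =
      A ^ (n + k₁) / √A ^ (d + 2) := by
    rw [Real.rpow_sub hA, ← Nat.cast_add, Real.rpow_natCast, Real.sqrt_eq_rpow,
      ← Real.rpow_mul_natCast hA.le]
    congr 2; push_cast; ring
  have h2 : √(2 * π * κ ^ (d + 1)) = √(2 * π) * √κ ^ (d + 1) := by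
    rw [Real.sqrt_mul (by positivity)]
    congr 1
    rw [Real.sqrt_eq_iff_mul_self_eq (by positivity) (by positivity), ← mul_pow,
      Real.mul_self_sqrt hκ.le]
  have := Real.sqrt_pos.2 hA
  rw [leadConst, h1, h2]
  field_simp

lemma leadConst_mul_ratio (n d k₁ k₂ : ℕ) {A κ v s R w : ℝ} (hA : 0 < A) (hκ : 0 < κ) (hv : 0 < v)
    (hw : w = A / v ^ 2) (hs : s = κ / (2 * A)) (hR : R = A * κ / (2 * π)) :
    1 / ((4 * π) ^ n * (2 * π) ^ (d + 1)) * (w / w ^ (n + k₁) / √s ^ d) *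
      (π ^ (n + k₁) * (π ^ k₂ * (√2 * π) ^ d) * √(2 * π / (2 * π * R / w))) =
    leadConst n d k₁ k₂ A κ * ((v ^ 2) ^ (n + k₁) / v ^ 3) := by
  have hπ := Real.pi_pos
  have e1 : √s = √κ / (√2 * √A) := by
    rw [hs, Real.sqrt_div hκ.le, Real.sqrt_mul (by norm_num)]
  have e2 : √(2 * π / (2 * π * R / w)) = √(2 * π) / (√κ * v) := by
    have : 2 * π * R / w = κ * v ^ 2 := by rw [hR, hw]; field_simp
    rw [this, Real.sqrt_div (by positivity), Real.sqrt_mul hκ.le, Real.sqrt_sq hv.le]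
  rw [leadConst_eq n d k₁ k₂ hA hκ, e1, e2, hw]
  have ha := Real.sqrt_pos.2 hA
  have hb := Real.sqrt_pos.2 hκ
  have hA2 : A = √A ^ 2 := (Real.sq_sqrt hA.le).symm
  have h2 : √2 ^ 2 = 2 := Real.sq_sqrt (by norm_num)
  have h3 : √(2 * π) ^ 2 = 2 * π := Real.sq_sqrt (by positivity)
  have h5 : √2 ^ d * √2 ^ d = 2 ^ d := by rw [← mul_pow, ← sq, h2]
  set a := √A
  set c := √(2 * π)
  have hc : 0 < c := by positivity
  have h6 : (2 * π) ^ (d + 1) = √2 ^ d * √2 ^ d * π ^ d * c ^ 2 := by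
    rw [h5, h3, pow_succ, mul_pow]
  rw [h6, hA2]
  simp only [mul_pow, div_pow, pow_add]
  field_simp

lemma exists_mul_le_leadConst (n d k₁ k₂ : ℕ) : ∃ C : ℝ, 0 < C ∧ ∀ A s : ℝ, 0 < A → A ≤ 1 → 0 < s →
    2 * A * s ≤ C * (1 + s) ^ (d + 2) * leadConst n d k₁ k₂ A (2 * A * s) := by
  refine ⟨2 * (4 ^ n * √(2 * π) * √2 ^ (d + 1)), by positivity, fun A s hA hA1 hs => ?_⟩
  have ha := Real.sqrt_pos.2 hA
  have hb := Real.sqrt_pos.2 hs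
  have hs1 : √s ≤ 1 + s := by
    nlinarith [Real.sq_sqrt hs.le, sq_nonneg (√s - 1)]
  have haA : A ≤ √A := by
    nlinarith [Real.sq_sqrt hA.le, Real.sqrt_le_one.2 hA1]
  have e : √(2 * A * s) = √2 * √A * √s := by
    rw [Real.sqrt_mul (by positivity), Real.sqrt_mul (by norm_num)]
  have hπ1 : 1 ≤ π ^ (k₁ + k₂) := one_le_pow₀ (by linarith [Real.pi_gt_three])
  have hAN : A ^ (n + k₁) ≤ 1 := pow_le_one₀ hA.le hA1
  rw [leadConst_eq n d k₁ k₂ hA (by positivity), e]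
  have h1 : 2 * (4 ^ n * √(2 * π) * √2 ^ (d + 1)) * (√s ^ (d + 1) * s) *
      (π ^ (k₁ + k₂) * √A ^ (d + 2) / (4 ^ n * A ^ (n + k₁) * √(2 * π) * (√2 * √A * √s) ^ (d + 1))) =
      2 * s * √A * (π ^ (k₁ + k₂) / A ^ (n + k₁)) := by
    rw [mul_pow, mul_pow, pow_succ √A (d + 1)]
    field_simp
  have h2 : 1 ≤ π ^ (k₁ + k₂) / A ^ (n + k₁) := by
    rw [le_div_iff₀ (by positivity)]; linarith
  calc 2 * A * s ≤ 2 * s * √A * 1 := by nlinarith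
    _ ≤ 2 * s * √A * (π ^ (k₁ + k₂) / A ^ (n + k₁)) := by gcongr
    _ ≤ _ := by
      rw [← h1, pow_succ (1 + s) (d + 1)]
      gcongr
      linarith

lemma exists_ratio_le (N : ℕ) : ∃ C : ℝ, 0 < C ∧ ∀ v : ℝ, 1 / 2 ≤ v → v ≤ 2 →
    |(v ^ 2) ^ N / v ^ 3 - 1| ≤ C * |v - 1| := by
  refine ⟨8 * ((2 * N : ℕ) * 2 ^ (2 * N - 1) + (3 : ℕ) * 2 ^ (3 - 1)), by positivity,
    fun v h1 h2 => ?_⟩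
  have hv : 0 < v := by linarith
  have hp : ∀ p : ℕ, |v ^ p - 1| ≤ |v - 1| * p * 2 ^ (p - 1) := fun p => by
    have := abs_pow_sub_pow_le v 1 p
    rw [one_pow, abs_of_pos hv, abs_one] at this
    refine this.trans ?_
    gcongr
    exact max_le h2 (by norm_num)
  have e : (v ^ 2) ^ N / v ^ 3 - 1 = ((v ^ (2 * N) - 1) - (v ^ 3 - 1)) / v ^ 3 := by
    rw [← pow_mul]; field_simp; ring
  have h3 : 1 / 8 ≤ v ^ 3 := by
    have : (1 / 2 : ℝ) ^ 3 ≤ v ^ 3 := by gcongr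
    linarith
  rw [e, abs_div, abs_of_pos (pow_pos hv 3), div_le_iff₀ (by positivity)]
  have h4 := abs_sub (v ^ (2 * N) - 1) (v ^ 3 - 1)
  have h5 := hp (2 * N)
  have h6 := hp 3
  set q : ℝ := |v - 1| * (2 * N : ℕ) * 2 ^ (2 * N - 1) + |v - 1| * (3 : ℕ) * 2 ^ (3 - 1)
  have hq : 0 ≤ q := by positivity
  calc _ ≤ q := by linarith
    _ ≤ q * (8 * v ^ 3) := le_mul_of_one_le_right hq (by linarith)
    _ = _ := by ring

/-- The saddle point lies close to `π`, with `π - y ∼ πδ`. -/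
lemma exists_saddle_bounds {r : ℝ} (hr : 0 < r) (hr1 : r ≤ 1 / 4) : ∃ δ₀ : ℝ, 0 < δ₀ ∧ δ₀ ≤ 1 / (8 * π) ∧
    ∀ δ y : ℝ, 0 < δ → δ ≤ δ₀ → 0 ≤ y → y < π → theta y = 1 / (π * δ ^ 2) →
      π - y ≤ r ∧ |√(π * δ / (π - y)) - 1| ≤ δ := by
  obtain ⟨B, hB, hBb⟩ := exists_abs_theta_sub_le
  have hπ := Real.pi_pos
  have hπ3 := Real.pi_gt_three
  set M := π ^ 2 + 4 * π ^ 3 / r ^ 2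
  have hM : 0 < M := by positivity
  refine ⟨1 / (8 * π * (M + 1) * (B + 1)), by positivity, ?_, fun δ y h0 h1 hy hyπ hth => ?_⟩
  · refine one_div_le_one_div_of_le (by positivity) ?_
    nlinarith [mul_pos hπ hM, mul_pos (mul_pos hπ hM) hB, mul_pos hπ hB]
  have hq : δ * (8 * π * (M + 1) * (B + 1)) ≤ 1 := by
    rwa [le_div_iff₀ (by positivity)] at h1
  have hpM : 0 < π * M := by positivity
  have hpB : 0 < π * B := by positivity
  have hpMB : 0 < π * M * B := by positivity
  have hq' : 8 * (δ * π * M) + 8 * (δ * π * B) + 8 * (δ * π) ≤ 1 := by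
    have : 0 < δ * (π * M * B) := by positivity
    nlinarith
  have hδM : 0 < δ * π * M := by positivity
  have hδB : 0 < δ * π * B := by positivity
  have hδπ : 0 < δ * π := by positivity
  have hδ1 : δ < 1 := by nlinarith
  have hyr : π - y ≤ r := by
    by_contra! hcon
    have h := theta_le hr hr1 hy (by linarith)
    rw [hth, div_le_iff₀ (by positivity)] at h
    change 1 ≤ M * (π * δ ^ 2) at h
    nlinarith
  refine ⟨hyr, ?_⟩
  set w := π - y with hw
  have hw0 : 0 < w := by linarith
  have hb := hBb w hw0 (by linarith)
  rw [show π - w = y by rw [hw]; ring, hth] at hb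
  set v := √(π * δ / w) with hv
  have hv0 : 0 ≤ v := Real.sqrt_nonneg _
  have hv2 : v ^ 2 = π * δ / w := Real.sq_sqrt (by positivity)
  have e : v ^ 4 - 1 = (π / w ^ 2 - 1 / (π * δ ^ 2)) * (π * δ ^ 2) := by
    rw [show v ^ 4 = (v ^ 2) ^ 2 by ring, hv2]; field_simp
  have h4 : |v ^ 4 - 1| ≤ δ := by
    rw [e, abs_mul, abs_of_pos (by positivity : 0 < π * δ ^ 2)]
    calc _ ≤ B * (π * δ ^ 2) := by gcongr
      _ = δ * (δ * π * B) := by ring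
      _ ≤ δ * 1 := by gcongr; linarith
      _ = δ := mul_one δ
  have e2 : v ^ 4 - 1 = (v - 1) * (v ^ 3 + v ^ 2 + v + 1) := by ring
  rw [e2, abs_mul, abs_of_pos (by positivity : 0 < v ^ 3 + v ^ 2 + v + 1)] at h4
  exact (le_mul_of_one_le_right (abs_nonneg _) (by
    have : 0 ≤ v ^ 3 := by positivity
    nlinarith [sq_nonneg v])).trans h4

lemma mul_sign_cancel {p q i F E W x y z t : ℂ} (h1 : p * p = 1) (h2 : i * i = q) :
    (p * i * F) * (p * (E * W) * (x * (i * y * z) * t)) = q * E * (F * W * (x * (y * z) * t)) := by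
  linear_combination F * E * W * x * y * z * t * (i * i * h1 + h2)

lemma error_terms_le {A δ κ v s w : ℝ} (hδ : 0 < δ) (hκ : 2 ≤ κ) (hA : A = π * δ)
    (hv0 : 0 < v) (hv1 : -δ ≤ v - 1) (hδ8 : 8 * δ ≤ 1) (hvw : w = A / v ^ 2)
    (hsκ : s = κ / (2 * A)) : w + 1 / s + 1 / (κ * v ^ 2) ≤ 4 * π * (δ + 1 / κ) := by
  have hπ3 := Real.pi_gt_three
  have hκ0 : 0 < κ := by linarith
  have hA0 : 0 < A := by rw [hA]; positivity
  have hv3 : 3 / 4 ≤ v ^ 2 := by nlinarith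
  have h1 : w ≤ 4 / 3 * A := by
    rw [hvw, div_le_iff₀ (by positivity)]; nlinarith
  have h2 : 1 / s ≤ A := by
    rw [hsκ, one_div_div, div_le_iff₀ hκ0]; nlinarith
  have h3 : 1 / (κ * v ^ 2) ≤ 4 / 3 * (1 / κ) := by
    rw [one_div, mul_inv, one_div]
    have : (v ^ 2)⁻¹ ≤ 4 / 3 := by
      rw [inv_le_comm₀ (by positivity) (by norm_num)]; linarith
    have hk : 0 ≤ κ⁻¹ := by positivity
    nlinarith
  have hk : 0 ≤ 1 / κ := by positivity
  nlinarith

set_option maxHeartbeats 400000 in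
lemma exists_norm_kernel_sub_leading_le {n : ℕ} (hn : 1 ≤ n) (d k₁ k₂ : ℕ) :
    ∃ K : ℝ, 0 < K ∧ ∃ δ₀ : ℝ, 0 < δ₀ ∧ ∃ κ₀ : ℝ, 0 < κ₀ ∧ ∀ R s y δ κ P : ℝ,
      0 < R → 0 < s → 0 ≤ y → y < π → theta y = s / R → 0 < δ → δ ≤ δ₀ → κ₀ ≤ κ →
      R = π * δ ^ 2 * s → κ = 2 * (π * δ) * s →
      P = (-1 : ℝ) ^ k₂ * leadConst n d k₁ k₂ (π * δ) κ *
        Real.exp (-(R * (y / Real.sin y) ^ 2)) →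
      ∃ w₀ : ℝ, 0 < w₀ ∧ w₀ ≤ 1 / 4 ∧ 1 ≤ s ∧
      ‖(-1 : ℂ) ^ k₁ * Complex.I ^ k₂ / ((4 * (π : ℂ)) ^ n * (2 * (π : ℂ)) ^ (d + 1)) *
        (lineInt R (n + k₁) k₁ d k₂ s + circleInt R (n + k₁) k₁ d k₂ s w₀) - (P : ℂ)‖ ≤
        K * |P| * (δ + 1 / κ) := by
  have hπ := Real.pi_pos
  have hπ3 := Real.pi_gt_three
  obtain ⟨Cl, hCl, hl⟩ := norm_lineInt_le hn k₁ d k₂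
  obtain ⟨Cc, hCc, r, hr, hr1, hc⟩ := exists_norm_circleInt_sub_le (n + k₁) k₁ d k₂
  obtain ⟨Cq, hCq, hq⟩ := exists_mul_le_leadConst n d k₁ k₂
  obtain ⟨Ce, hCe, he⟩ := pow_le_mul_exp (d + 2) (β := π / 2) (by positivity)
  obtain ⟨Cr, hCr, hrat⟩ := exists_ratio_le (n + k₁)
  obtain ⟨δ₀, hδ₀, hδ₁, hsb⟩ := exists_saddle_bounds hr hr1
  refine ⟨Cl * (Cq * Ce) + Cc * (1 + Cr) * (4 * π) + Cr, by positivity, δ₀, hδ₀, 2, by norm_num,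
    fun R s y δ κ P hR hs hy hyπ hth hδ hδδ hκ hRs hκs hP => ?_⟩
  obtain ⟨hwr, hv⟩ := hsb δ y hδ hδδ hy hyπ (by rw [hth, hRs]; field_simp)
  have hδ8 : 8 * (π * δ) ≤ 1 := by
    have := hδδ.trans hδ₁
    rw [le_div_iff₀ (by positivity)] at this
    linarith
  have hδ8' : 8 * δ ≤ 1 := by
    linarith [mul_le_mul_of_nonneg_right (show 1 ≤ π by linarith) hδ.le]
  obtain ⟨w, hw⟩ : ∃ w, w = π - y := ⟨_, rfl⟩
  rw [← hw] at hwr hv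
  have hw0 : 0 < w := by linarith
  have hwπ : π - w = y := by rw [hw]; ring
  have hsiny : Real.sin w = Real.sin y := by rw [hw, Real.sin_pi_sub]
  obtain ⟨A, hA⟩ : ∃ A, A = π * δ := ⟨_, rfl⟩
  rw [← hA] at hv hδ8 hκs hP
  have hA0 : 0 < A := by rw [hA]; positivity
  obtain ⟨v, hvd⟩ : ∃ v, v = √(A / w) := ⟨_, rfl⟩
  rw [← hvd] at hv
  have hv1 := (abs_le.1 hv).1
  have hv2 := (abs_le.1 hv).2
  have hv0 : 0 < v := by linarith
  have hvw : w = A / v ^ 2 := by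
    rw [hvd, Real.sq_sqrt (by positivity)]; field_simp
  have hκ0 : 0 < κ := by linarith
  have hsκ : s = κ / (2 * A) := by rw [hκs]; field_simp
  have hs1 : 1 ≤ s := by
    rw [hsκ, le_div_iff₀ (by positivity)]; linarith
  have hRκ : R = A * κ / (2 * π) := by rw [hRs, hκs, hA]; field_simp
  have hκ' : 2 * π * R / w = κ * v ^ 2 := by rw [hRκ, hvw]; field_simp
  refine ⟨w, hw0, hwr.trans hr1, hs1, ?_⟩
  have hratio := hrat v (by linarith) (by linarith)
  set ρ := (v ^ 2) ^ (n + k₁) / v ^ 3 with hρ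
  have hρ0 : 0 < ρ := by positivity
  clear_value ρ
  have hratio' : |ρ - 1| ≤ Cr * δ := hratio.trans (by gcongr)
  set L := leadConst n d k₁ k₂ A κ with hL
  have hL0 : 0 < L := by rw [hL, leadConst]; positivity
  clear_value L
  set X := -(R * (y / Real.sin y) ^ 2) with hX
  clear_value X
  have hPabs : |P| = L * Real.exp X := by
    rw [hP, abs_mul, abs_mul, abs_pow, abs_neg, abs_one, one_pow, one_mul, abs_of_pos hL0,
      abs_of_pos (Real.exp_pos _)]
  set pf : ℂ := (-1 : ℂ) ^ k₁ * Complex.I ^ k₂ / ((4 * (π : ℂ)) ^ n * (2 * (π : ℂ)) ^ (d + 1))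
    with hpf
  clear_value pf
  set F : ℝ := 1 / ((4 * π) ^ n * (2 * π) ^ (d + 1)) with hF
  have hF0 : 0 < F := by positivity
  clear_value F
  have hF1 : F ≤ 1 := by
    rw [hF, div_le_one (by positivity)]
    exact one_le_mul_of_one_le_of_one_le (one_le_pow₀ (by linarith)) (one_le_pow₀ (by linarith))
  have hpfn : ‖pf‖ = F := by
    rw [hpf, norm_div, norm_mul, norm_mul, norm_pow, norm_pow, norm_pow, norm_pow, norm_mul,
      norm_mul, Complex.norm_I, norm_neg, norm_one, one_pow, one_pow, Complex.norm_real,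
      Real.norm_of_nonneg hπ.le, Complex.norm_ofNat, Complex.norm_ofNat, mul_one, hF]
  have hsad : s = R * theta (π - w) := by rw [hwπ, hth]; field_simp
  have hph := phase_saddle hw0 (by linarith) hsad
  rw [hwπ, hsiny, ← hX] at hph
  have hpre : circlePre R (n + k₁) k₁ d s w =
      (-1) ^ k₁ * ((Real.exp X * (w / w ^ (n + k₁) / √s ^ d) : ℝ) : ℂ) := by
    rw [circlePre, hph]; push_cast; ring
  have hpreN : ‖circlePre R (n + k₁) k₁ d s w‖ = Real.exp X * (w / w ^ (n + k₁) / √s ^ d) := by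
    rw [hpre, norm_mul, norm_pow, norm_neg, norm_one, one_pow, one_mul, Complex.norm_real,
      Real.norm_of_nonneg (by positivity)]
  have hlead := leadConst_mul_ratio n d k₁ k₂ hA0 hκ0 hv0 hvw hsκ hRκ
  rw [← hF, ← hL, ← hρ] at hlead
  set T := √(2 * π / (2 * π * R / w)) with hT
  clear_value T
  have hmain : pf * (circlePre R (n + k₁) k₁ d s w * ((π ^ (n + k₁) * ((Complex.I * π) ^ k₂ *
      ((√2 * π : ℝ) : ℂ) ^ d)) * (T : ℂ))) = ((P * ρ : ℝ) : ℂ) := by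
    have h1 : ((-1 : ℂ) ^ k₁) * (-1) ^ k₁ = 1 := by rw [← mul_pow]; norm_num
    have h2 : Complex.I ^ k₂ * Complex.I ^ k₂ = (-1) ^ k₂ := by
      rw [← mul_pow, Complex.I_mul_I]
    have h3 : P * ρ = (-1) ^ k₂ * Real.exp X * (L * ρ) := by rw [hP]; ring
    have h4 : pf = (-1 : ℂ) ^ k₁ * Complex.I ^ k₂ * (F : ℂ) := by
      rw [hpf, hF]; push_cast; ring
    rw [h3, ← hlead, hpre, h4, mul_pow Complex.I]
    have h5 := mul_sign_cancel (F := F) (E := (Real.exp X : ℂ))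
      (W := ((w / w ^ (n + k₁) / √s ^ d : ℝ) : ℂ)) (x := π ^ (n + k₁)) (y := (π : ℂ) ^ k₂)
      (z := ((√2 * π : ℝ) : ℂ) ^ d) (t := T) h1 h2
    rw [Complex.ofReal_mul (Real.exp X), h5]
    simp only [Complex.ofReal_mul, Complex.ofReal_pow, Complex.ofReal_neg, Complex.ofReal_one]
  have hdiff := hc R s w hR hs1 hw0 hwr (by
    rw [deriv_cotRem hw0 (by linarith), hwπ, hth]
    push_cast
    have : (R : ℂ) ≠ 0 := by exact_mod_cast hR.ne'
    field_simp
    ring)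
  rw [← hT] at hdiff
  have hT1 : √(1 / (2 * π * R / w)) ≤ T := by
    rw [hT]; gcongr; linarith
  have hone : 1 ≤ π ^ (n + k₁) * (π ^ k₂ * (√2 * π) ^ d) := by
    have : 1 ≤ √2 := Real.one_le_sqrt.2 (by norm_num)
    refine one_le_mul_of_one_le_of_one_le (one_le_pow₀ (by linarith))
      (one_le_mul_of_one_le_of_one_le (one_le_pow₀ (by linarith)) (one_le_pow₀ ?_))
    exact one_le_mul_of_one_le_of_one_le this (by linarith)
  have hρ1 : ρ ≤ 1 + Cr := by
    linarith [(abs_le.1 hratio').2, mul_le_of_le_one_right hCr.le (show δ ≤ 1 by linarith)]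
  have hcp : F * ‖circlePre R (n + k₁) k₁ d s w‖ * √(1 / (2 * π * R / w)) ≤ |P| * (1 + Cr) := by
    rw [hpreN]
    calc _ ≤ F * (Real.exp X * (w / w ^ (n + k₁) / √s ^ d)) *
          (π ^ (n + k₁) * (π ^ k₂ * (√2 * π) ^ d) * T) := by
          gcongr
          exact hT1.trans (le_mul_of_one_le_left (hT ▸ Real.sqrt_nonneg _) hone)
      _ = Real.exp X * (L * ρ) := by rw [← hlead]; ring
      _ ≤ Real.exp X * (L * (1 + Cr)) := by gcongr
      _ = _ := by rw [hPabs]; ring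
  have herr : w + 1 / s + 1 / (2 * π * R / w) ≤ 4 * π * (δ + 1 / κ) := by
    rw [hκ']
    exact error_terms_le hδ hκ hA hv0 hv1 hδ8' hvw hsκ
  have hline : F * ‖lineInt R (n + k₁) k₁ d k₂ s‖ ≤ Cl * (Cq * Ce) * |P| * (1 / κ) := by
    have h1 := hl R s hR.le (by linarith)
    have h2 := hq A s hA0 (by linarith) hs
    rw [← hκs, ← hL] at h2
    have h3 := he s hs.le
    have hXs : -(π * s) ≤ X := by
      have hsin := Real.sin_pos_of_pos_of_lt_pi hw0 (by linarith)
      have hcos : 0 < Real.cos w := Real.cos_pos_of_mem_Ioo ⟨by linarith, by linarith⟩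
      have e : X + π * s = w * s + R * (y * (Real.cos w / Real.sin w)) := by
        rw [hX, hsad, theta_pi_sub hw0 (by linarith), hwπ, ← hsiny]
        field_simp
        rw [show π = w + y by linarith]
        ring
      have : 0 ≤ w * s + R * (y * (Real.cos w / Real.sin w)) := by positivity
      linarith
    have h4 : κ * Real.exp (-(3 * π / 2 * s)) ≤ Cq * Ce * |P| := by
      calc _ ≤ Cq * (Ce * Real.exp (π / 2 * s)) * L * Real.exp (-(3 * π / 2 * s)) := by
            gcongr; exact h2.trans (by gcongr)
        _ = Cq * Ce * (L * Real.exp (-(π * s))) := by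
            rw [show -(π * s) = π / 2 * s + -(3 * π / 2 * s) by ring, Real.exp_add]; ring
        _ ≤ Cq * Ce * (L * Real.exp X) := by gcongr
        _ = _ := by rw [hPabs]
    calc _ ≤ 1 * (Cl * Real.exp (-(3 * π / 2 * s))) := by gcongr
      _ = Cl * (κ * Real.exp (-(3 * π / 2 * s))) * (1 / κ) := by field_simp
      _ ≤ Cl * (Cq * Ce * |P|) * (1 / κ) := by gcongr
      _ = _ := by ring
  set li := lineInt R (n + k₁) k₁ d k₂ s
  clear_value li
  set ce := circleInt R (n + k₁) k₁ d k₂ s w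
  set ma := circlePre R (n + k₁) k₁ d s w * ((π ^ (n + k₁) * ((Complex.I * π) ^ k₂ *
      ((√2 * π : ℝ) : ℂ) ^ d)) * (T : ℂ)) with hma
  clear_value ma ce
  have esplit : pf * (li + ce) - P = pf * li + pf * (ce - ma) + ((P * (ρ - 1) : ℝ) : ℂ) := by
    have : ((P * (ρ - 1) : ℝ) : ℂ) = ((P * ρ : ℝ) : ℂ) - P := by push_cast; ring
    rw [this, ← hmain]; ring
  rw [esplit]
  refine (norm_add₃_le).trans ?_
  rw [norm_mul, norm_mul, hpfn, Complex.norm_real, Real.norm_eq_abs, abs_mul]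
  have hk : 0 ≤ 1 / κ := by positivity
  have hP0 : 0 ≤ |P| := abs_nonneg P
  have hcirc : F * ‖ce - ma‖ ≤ Cc * (1 + Cr) * (4 * π) * |P| * (δ + 1 / κ) := by
    calc _ ≤ F * (Cc * ‖circlePre R (n + k₁) k₁ d s w‖ * (w + 1 / s + 1 / (2 * π * R / w)) *
          √(1 / (2 * π * R / w))) := by gcongr
      _ = Cc * (F * ‖circlePre R (n + k₁) k₁ d s w‖ * √(1 / (2 * π * R / w))) *
          (w + 1 / s + 1 / (2 * π * R / w)) := by ring
      _ ≤ Cc * (|P| * (1 + Cr)) * (4 * π * (δ + 1 / κ)) := by gcongr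
      _ = _ := by ring
  calc _ ≤ Cl * (Cq * Ce) * |P| * (1 / κ) + Cc * (1 + Cr) * (4 * π) * |P| * (δ + 1 / κ) +
        |P| * (Cr * δ) := by gcongr
    _ ≤ Cl * (Cq * Ce) * |P| * (δ + 1 / κ) + Cc * (1 + Cr) * (4 * π) * |P| * (δ + 1 / κ) +
        |P| * (Cr * (δ + 1 / κ)) := by gcongr <;> linarith
    _ = _ := by ring

/-- Case II asymptotics on H-type groups: for δ → 0⁺ and κ → +∞,
p_{1,k₁,k₂}(x,t) = ((−1)^{k₂}π^{k₁+k₂}/(4ⁿ(πδ)^{n+k₁−(m+1)/2}√(2πκ^m))) e^{−d²/4}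
[1 + O(δ + 1/κ)]. -/
theorem htype_caseII (n m k₁ k₂ : ℕ) (hn : 1 ≤ n) (hm : 0 < m) :
    ∃ K : ℝ, 0 < K ∧ ∃ δ₀ : ℝ, 0 < δ₀ ∧ ∃ κ₀ : ℝ, 0 < κ₀ ∧
      ∀ (x : EuclideanSpace ℝ (Fin (2 * n))) (t : EuclideanSpace ℝ (Fin m)) (yω δ κ d P : ℝ),
        x ≠ 0 → t ≠ 0 →
        yω ∈ Set.Ico 0 π → theta yω = 4 * ‖t‖ / ‖x‖ ^ 2 →
        δ = Real.sqrt ((‖x‖ ^ 2 / 4) / (π * ‖t‖)) →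
        κ = 2 * Real.sqrt (π * ‖t‖ * (‖x‖ ^ 2 / 4)) →
        d = ‖x‖ * yω / Real.sin yω →
        P = ((-1 : ℝ) ^ k₂ * π ^ (k₁ + k₂) /
              (4 ^ n * (π * δ) ^ ((n : ℝ) + (k₁ : ℝ) - ((m : ℝ) + 1) / 2) *
                Real.sqrt (2 * π * κ ^ m))) *
            Real.exp (-d ^ 2 / 4) →
        δ ≤ δ₀ → κ₀ ≤ κ →
        ‖pT n m k₁ k₂ hm x t - (P : ℂ)‖ ≤ K * |P| * (δ + 1 / κ) := by
  obtain ⟨d', rfl⟩ := Nat.exists_eq_succ_of_ne_zero hm.ne'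
  obtain ⟨K, hK, δ₀, hδ₀, κ₀, hκ₀, h⟩ := exists_norm_kernel_sub_leading_le hn d' k₁ k₂
  refine ⟨K, hK, δ₀, hδ₀, κ₀, hκ₀, fun x t y δ κ d P hx ht hy hth hδ hκ hd hP hδδ hκκ => ?_⟩
  have hx0 : 0 < ‖x‖ := norm_pos_iff.2 hx
  have ht0 : 0 < ‖t‖ := norm_pos_iff.2 ht
  have hπ := Real.pi_pos
  have hδ0 : 0 < δ := by rw [hδ]; positivity
  have hδ2 : δ ^ 2 = (‖x‖ ^ 2 / 4) / (π * ‖t‖) := by rw [hδ, Real.sq_sqrt (by positivity)]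
  have hR : ‖x‖ ^ 2 / 4 = π * δ ^ 2 * ‖t‖ := by rw [hδ2]; field_simp
  obtain ⟨w₀, hw, hw1, hs, hmain⟩ := h (‖x‖ ^ 2 / 4) ‖t‖ y δ κ P (by positivity) ht0 hy.1 hy.2
    (by rw [hth]; field_simp) hδ0 hδδ hκκ hR
    (by
      rw [hκ, hR, show π * ‖t‖ * (π * δ ^ 2 * ‖t‖) = (π * δ * ‖t‖) ^ 2 by ring,
        Real.sqrt_sq (by positivity)]
      ring)
    (by
      rw [hP, hd, leadConst, mul_div_assoc ‖x‖, mul_pow, neg_div, mul_div_assoc ((-1 : ℝ) ^ k₂)]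
      congr 3
      ring)
  rw [pT_eq hn hm x t hw hw1 (by linarith)]
  exact hmain
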